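/- For every integer n ≥ 0, M_ω(2,5,5n+1) − M_ω(3,5,5n+1) = NT(2,5,5n+1) − NT(3,5,5n+1). -/

import Mathlib

/-!
Common definitions: for a partition `π` of `n`,
`numParts` is the number of parts, `largestPart` the largest part,
`omegaOnes` the number of parts equal to 1, `rank` and `crank` the
Dyson rank and Andrews–Garvan crank.  `NT m j n` is the total number of
parts over partitions of `n` with rank ≡ m (mod j), and `Mw m j n` is
the total number of ones over partitions of `n` with crank ≡ m (mod j).
`poch a q = (a; q)_∞ = ∏_{n ≥ 0} (1 - a qⁿ)`.
-/

namespace Beck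

/-- number of parts of a partition -/
def numParts {n : ℕ} (π : n.Partition) : ℕ := Multiset.card π.parts

/-- largest part of a partition (0 for the empty partition) -/
def largestPart {n : ℕ} (π : n.Partition) : ℕ := π.parts.sup

/-- number of ones in a partition -/
def omegaOnes {n : ℕ} (π : n.Partition) : ℕ := π.parts.count 1

/-- number of parts strictly larger than the number of ones -/
def muParts {n : ℕ} (π : n.Partition) : ℕ :=
  Multiset.card (π.parts.filter fun x => omegaOnes π < x)

/-- Dyson's rank: largest part minus number of parts -/
def rank {n : ℕ} (π : n.Partition) : ℤ :=
  (largestPart π : ℤ) - (numParts π : ℤ)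

/-- the Andrews–Garvan crank -/
def crank {n : ℕ} (π : n.Partition) : ℤ :=
  if omegaOnes π = 0 then (largestPart π : ℤ)
  else (muParts π : ℤ) - (omegaOnes π : ℤ)

/-- `NT m j n`: total number of parts in partitions of `n` with rank ≡ m (mod j) -/
def NT (m j n : ℕ) : ℤ :=
  ∑ π : n.Partition,
    if rank π % (j : ℤ) = (m : ℤ) % (j : ℤ) then (numParts π : ℤ) else 0

/-- `Mw m j n`: total number of ones in partitions of `n` with crank ≡ m (mod j) -/
def Mw (m j n : ℕ) : ℤ :=
  ∑ π : n.Partition,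
    if crank π % (j : ℤ) = (m : ℤ) % (j : ℤ) then (omegaOnes π : ℤ) else 0

/-- `(a; q)_∞ = ∏_{n ≥ 0} (1 - a qⁿ)` -/
noncomputable def poch (a q : ℂ) : ℂ := ∏' n : ℕ, (1 - a * q ^ n)

section

open Filter Topology

/-! ### Sums of simple fractions -/

/-- The simple fraction `1 / (1 - t Q ^ m)`. -/
noncomputable def frac (Q t : ℂ) (m : ℤ) : ℂ := (1 - t * Q ^ m)⁻¹

/-- The triangular number `m (m + 1) / 2`. -/
def tri (m : ℤ) : ℤ := m * (m + 1) / 2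

lemma two_mul_tri (m : ℤ) : 2 * tri m = m * (m + 1) :=
  Int.mul_ediv_cancel' (Int.even_mul_succ_self m).two_dvd

lemma tri_neg_sub_one (m : ℤ) : tri (-m - 1) = tri m := by
  have h : 2 * tri (-m - 1) = 2 * tri m := by
    rw [two_mul_tri, two_mul_tri]; ring
  omega

lemma tri_add (m n : ℤ) : tri (m + n) = tri m + tri n + m * n := by
  have h : 2 * tri (m + n) = 2 * (tri m + tri n + m * n) := by
    linear_combination two_mul_tri (m + n) - two_mul_tri m - two_mul_tri n
  omega

lemma tri_neg (m : ℤ) : tri (-m) = tri m - m := by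
  have h : 2 * tri (-m) = 2 * (tri m - m) := by
    linear_combination two_mul_tri (-m) - two_mul_tri m
  omega

@[simp] lemma tri_one : tri 1 = 1 := rfl
@[simp] lemma tri_zero : tri 0 = 0 := rfl

lemma frac_shift {Q : ℂ} (h0 : Q ≠ 0) (t : ℂ) (m n : ℤ) :
    frac Q (t * Q ^ n) m = frac Q t (m + n) := by
  rw [frac, frac, zpow_add₀ h0]; ring_nf

lemma frac_neg {Q : ℂ} {t : ℂ} (h0 : Q ≠ 0) (ht : t ≠ 0) (m : ℤ) :
    frac Q t (-m) = -t⁻¹ * Q ^ m * frac Q t⁻¹ m := by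
  have hQ : Q ^ m ≠ 0 := zpow_ne_zero _ h0
  rw [frac, frac, zpow_neg]
  by_cases h : Q ^ m = t
  · rw [h]; simp [ht]
  · have h1 : t - Q ^ m ≠ 0 := sub_ne_zero.2 (Ne.symm h)
    have h2 : 1 - t * (Q ^ m)⁻¹ ≠ 0 := by
      intro h3; apply h; field_simp at h3; linear_combination h3
    have h4 : 1 - t⁻¹ * Q ^ m ≠ 0 := by
      intro h3; apply h1; field_simp at h3; linear_combination h3
    field_simp
    ring_nf

lemma exists_norm_frac_le_of_nonneg {Q : ℂ} (h1 : ‖Q‖ < 1) (t : ℂ) :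
    ∃ C, ∀ m : ℕ, ‖frac Q t m‖ ≤ C := by
  have h : Tendsto (fun m : ℕ => frac Q t m) atTop (𝓝 (1 - t * 0)⁻¹) := by
    simp only [frac, zpow_natCast]
    exact ((tendsto_pow_atTop_nhds_zero_of_norm_lt_one h1).const_mul t).const_sub 1
      |>.inv₀ (by simp)
  obtain ⟨C, hC⟩ := h.norm.bddAbove_range
  exact ⟨C, fun m => hC ⟨m, rfl⟩⟩

lemma exists_norm_frac_le {Q : ℂ} (h0 : Q ≠ 0) (h1 : ‖Q‖ < 1) {t : ℂ} (ht : t ≠ 0) :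
    ∃ C, ∀ m : ℤ, ‖frac Q t m‖ ≤ C := by
  obtain ⟨C, hC⟩ := exists_norm_frac_le_of_nonneg h1 t
  obtain ⟨C', hC'⟩ := exists_norm_frac_le_of_nonneg h1 t⁻¹
  refine ⟨max C (‖t⁻¹‖ * C'), fun m => ?_⟩
  obtain ⟨k, rfl | rfl⟩ := m.eq_nat_or_neg
  · exact (hC k).trans (le_max_left _ _)
  · refine le_trans ?_ (le_max_right _ _)
    rw [frac_neg h0 ht, norm_mul, norm_mul, norm_neg, zpow_natCast, norm_pow]
    have := hC' k
    have h2 : ‖Q‖ ^ k ≤ 1 := pow_le_one₀ (norm_nonneg _) h1.le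
    calc ‖t⁻¹‖ * ‖Q‖ ^ k * ‖frac Q t⁻¹ k‖ ≤ ‖t⁻¹‖ * 1 * C' := by gcongr
      _ = _ := by ring

lemma summable_norm_mul_of_bdd {ι : Type*} {f g : ι → ℂ} (hf : Summable fun i => ‖f i‖) {C : ℝ}
    (hg : ∀ i, ‖g i‖ ≤ C) : Summable fun i => ‖f i * g i‖ := by
  refine Summable.of_nonneg_of_le (fun i => norm_nonneg _) (fun i => ?_) (hf.mul_right C)
  rw [norm_mul]
  exact mul_le_mul_of_nonneg_left (hg i) (norm_nonneg _)

lemma summable_norm_zpow_mul_frac {Q z : ℂ} (h0 : Q ≠ 0) (h1 : ‖Q‖ < 1) (hz : ‖Q‖ < ‖z‖)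
    (hz1 : ‖z‖ < 1) {t : ℂ} (ht : t ≠ 0) : Summable fun m : ℤ => ‖z ^ m * frac Q t m‖ := by
  have hz0 : 0 < ‖z‖ := (norm_nonneg _).trans_lt hz
  refine Summable.of_nat_of_neg ?_ ?_
  · obtain ⟨C, hC⟩ := exists_norm_frac_le_of_nonneg h1 t
    refine summable_norm_mul_of_bdd ?_ hC
    simp only [zpow_natCast, norm_pow]
    exact summable_geometric_of_lt_one (norm_nonneg _) hz1
  · obtain ⟨C, hC⟩ := exists_norm_frac_le_of_nonneg h1 t⁻¹
    have : ∀ m : ℕ, z ^ (-(m : ℤ)) * frac Q t (-m) = ((Q / z) ^ m * -t⁻¹) * frac Q t⁻¹ m := by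
      intro m
      rw [frac_neg h0 ht, zpow_neg, zpow_natCast, zpow_natCast, div_pow]; ring
    simp only [this]
    refine summable_norm_mul_of_bdd ?_ hC
    simp only [norm_mul, norm_pow]
    refine (summable_geometric_of_lt_one (norm_nonneg _) ?_).mul_right _
    rw [norm_div]
    exact (div_lt_one hz0).2 hz

lemma summable_pow_tri_mul_pow {r x : ℝ} (hr : 0 < r) (hr1 : r < 1) (hx : 0 < x) :
    Summable fun m : ℕ => r ^ tri m * x ^ (m : ℤ) := by
  have h2 : Tendsto (fun m : ℕ => r ^ (m + 1) * x) atTop (𝓝 (0 * x)) :=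
    (((tendsto_pow_atTop_nhds_zero_of_lt_one hr.le hr1).comp (tendsto_add_atTop_nat 1))).mul_const x
  rw [zero_mul] at h2
  refine summable_of_ratio_test_tendsto_lt_one zero_lt_one (.of_forall fun m => by positivity)
    (h2.congr fun m => ?_)
  push_cast
  rw [tri_add, Real.norm_of_nonneg (by positivity), Real.norm_of_nonneg (by positivity),
    zpow_add₀ hr.ne', zpow_add₀ hr.ne', zpow_add₀ hx.ne', tri_one, mul_one]
  have : r ^ tri m ≠ 0 := by positivity
  have : x ^ (m : ℤ) ≠ 0 := by positivity
  rw [pow_succ, ← zpow_natCast r m]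
  field_simp

lemma summable_zpow_tri_mul_zpow {Q z : ℂ} (h0 : Q ≠ 0) (h1 : ‖Q‖ < 1) (hz : z ≠ 0) :
    Summable fun m : ℤ => ‖Q ^ tri m * z ^ m‖ := by
  have hQ := norm_pos_iff.2 h0
  have hz' := norm_pos_iff.2 hz
  refine Summable.of_nat_of_neg ?_ ?_
  · simpa only [norm_mul, norm_zpow] using summable_pow_tri_mul_pow hQ h1 hz'
  · refine (summable_pow_tri_mul_pow hQ h1 (x := (‖Q‖ * ‖z‖)⁻¹) (by positivity)).congr fun m => ?_
    rw [norm_mul, norm_zpow, norm_zpow, tri_neg, zpow_sub₀ hQ.ne', zpow_neg, inv_zpow, mul_zpow]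
    field_simp

/-- The coefficient `(-1) ^ m Q ^ (m (m + 1) / 2)`. -/
noncomputable def triCoeff (Q : ℂ) (m : ℤ) : ℂ := (-1) ^ m * Q ^ tri m

lemma summable_triCoeff_mul_zpow {Q z : ℂ} (h0 : Q ≠ 0) (h1 : ‖Q‖ < 1) (hz : z ≠ 0) :
    Summable fun m : ℤ => ‖triCoeff Q m * z ^ m‖ := by
  refine (summable_zpow_tri_mul_zpow h0 h1 hz).congr fun m => ?_
  simp [triCoeff]

lemma summable_triCoeff {Q : ℂ} (h0 : Q ≠ 0) (h1 : ‖Q‖ < 1) :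
    Summable fun m : ℤ => ‖triCoeff Q m‖ := by
  simpa using summable_triCoeff_mul_zpow h0 h1 one_ne_zero

lemma summable_triCoeff_mul_frac {Q : ℂ} (h0 : Q ≠ 0) (h1 : ‖Q‖ < 1) {t : ℂ} (ht : t ≠ 0) :
    Summable fun m : ℤ => ‖triCoeff Q m * frac Q t m‖ := by
  obtain ⟨C, hC⟩ := exists_norm_frac_le h0 h1 ht
  exact summable_norm_mul_of_bdd (summable_triCoeff h0 h1) hC

lemma triCoeff_add {Q : ℂ} (h0 : Q ≠ 0) (m n : ℤ) :
    triCoeff Q (m + n) = triCoeff Q m * triCoeff Q n * Q ^ (m * n) := by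
  rw [triCoeff, triCoeff, triCoeff, tri_add, zpow_add₀ h0, zpow_add₀ h0, zpow_add₀ (by norm_num)]
  ring

lemma triCoeff_neg {Q : ℂ} (h0 : Q ≠ 0) (m : ℤ) :
    triCoeff Q (-m) = triCoeff Q m * Q ^ (-m) := by
  rw [triCoeff, triCoeff, tri_neg, sub_eq_add_neg, zpow_add₀ h0, zpow_neg (-1 : ℂ), ← inv_zpow]
  norm_num [mul_assoc]

/-- The sum `∑ (-1) ^ m Q ^ (m (m + 1) / 2) / (1 - t Q ^ m)` over all integers. -/
noncomputable def appell (Q t : ℂ) : ℂ := ∑' m : ℤ, triCoeff Q m * frac Q t m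

/-- The sum `∑ z ^ m / (1 - t Q ^ m)` over all integers. -/
noncomputable def kron (Q t z : ℂ) : ℂ := ∑' m : ℤ, z ^ m * frac Q t m

/-- The sum `∑ z ^ m / (1 - t Q ^ m) ^ 2` over all integers. -/
noncomputable def kronSq (Q t z : ℂ) : ℂ := ∑' m : ℤ, z ^ m * frac Q t m ^ 2

lemma kron_shift {Q : ℂ} (h0 : Q ≠ 0) (t : ℂ) {z : ℂ} (hz : z ≠ 0) (n : ℤ) :
    kron Q (t * Q ^ n) z = z ^ (-n) * kron Q t z := by
  rw [kron, kron, ← tsum_mul_left, ← (Equiv.addRight n).tsum_eq (fun m => z ^ (-n) * _)]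
  refine tsum_congr fun m => ?_
  rw [Equiv.coe_addRight, frac_shift h0, ← mul_assoc, ← zpow_add₀ hz]
  congr 2; ring

lemma kron_inv {Q : ℂ} (h0 : Q ≠ 0) {t : ℂ} (ht : t ≠ 0) (z : ℂ) :
    kron Q t⁻¹ z = -t * kron Q t (Q / z) := by
  rw [kron, kron, ← tsum_mul_left, ← (Equiv.neg ℤ).tsum_eq (fun m => _)]
  refine tsum_congr fun m => ?_
  rw [Equiv.neg_apply, frac_neg h0 (inv_ne_zero ht), inv_inv, div_zpow, zpow_neg]
  ring

lemma tsum_pow_mul_frac_comm {Q t z : ℂ} (h1 : ‖Q‖ < 1) (ht : ‖t‖ < 1) (hz : ‖z‖ < 1) :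
    ∑' m : ℕ, z ^ m * frac Q t m = ∑' m : ℕ, t ^ m * frac Q z m := by
  have key : ∀ t z : ℂ, ‖t‖ < 1 → ‖z‖ < 1 → ∀ m : ℕ,
      z ^ m * frac Q t m = ∑' n : ℕ, z ^ m * t ^ n * Q ^ (m * n) := by
    intro t z ht hz m
    have : ‖t * Q ^ m‖ < 1 := by
      rw [norm_mul, norm_pow]
      calc ‖t‖ * ‖Q‖ ^ m ≤ ‖t‖ * 1 := by
            gcongr; exact pow_le_one₀ (norm_nonneg _) h1.le
        _ < 1 := by simpa
    rw [frac, zpow_natCast, ← tsum_geometric_of_norm_lt_one this, ← tsum_mul_left]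
    refine tsum_congr fun n => ?_
    rw [mul_pow, pow_mul]; ring
  have hs : Summable fun p : ℕ × ℕ => z ^ p.1 * t ^ p.2 * Q ^ (p.1 * p.2) := by
    have h := (summable_geometric_of_lt_one (norm_nonneg z) hz).mul_of_nonneg
      (summable_geometric_of_lt_one (norm_nonneg t) ht) (fun n => pow_nonneg (norm_nonneg z) n)
      (fun n => pow_nonneg (norm_nonneg t) n)
    refine .of_norm (Summable.of_nonneg_of_le (fun _ => norm_nonneg _) (fun p => ?_) h)
    rw [norm_mul, norm_mul, norm_pow, norm_pow, norm_pow]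
    exact mul_le_of_le_one_right (by positivity) (pow_le_one₀ (norm_nonneg _) h1.le)
  rw [tsum_congr (key t z ht hz), tsum_congr (key z t hz ht),
    ← Summable.tsum_comm (f := fun m n : ℕ => z ^ m * t ^ n * Q ^ (m * n)) hs]
  refine tsum_congr fun m => tsum_congr fun n => ?_
  rw [mul_comm n m]; ring

lemma kron_eq_nat {Q t z : ℂ} (h0 : Q ≠ 0) (h1 : ‖Q‖ < 1) (ht : t ≠ 0)
    (hz : ‖Q‖ < ‖z‖) (hz1 : ‖z‖ < 1) :
    kron Q t z = ∑' m : ℕ, z ^ m * frac Q t m -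
      Q / (z * t) * ∑' m : ℕ, (Q / z) ^ m * frac Q (Q / t) m := by
  have hz0 : z ≠ 0 := norm_pos_iff.1 ((norm_nonneg _).trans_lt hz)
  have hs := (summable_norm_zpow_mul_frac h0 h1 hz hz1 ht).of_norm
  have hi : Function.Injective fun n : ℕ => -((n : ℤ) + 1) := fun a b h => by
    simp only at h; omega
  have hA : Summable fun m : ℕ => z ^ (m : ℤ) * frac Q t m :=
    hs.comp_injective Nat.cast_injective
  have hB : Summable fun m : ℕ => z ^ (-((m : ℤ) + 1)) * frac Q t (-((m : ℤ) + 1)) :=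
    hs.comp_injective hi
  rw [kron, tsum_of_nat_of_neg_add_one (f := fun m : ℤ => z ^ m * frac Q t m) hA hB,
    sub_eq_add_neg, ← tsum_mul_left, ← tsum_neg]
  simp only [zpow_natCast]
  congr 1
  refine tsum_congr fun m => ?_
  have h2 : t⁻¹ * Q ^ (1 : ℤ) = Q / t := by rw [zpow_one]; field_simp
  rw [frac_neg h0 ht, ← h2, frac_shift h0, zpow_neg, zpow_add₀ hz0, zpow_add₀ h0,
    zpow_natCast, zpow_natCast, div_pow, zpow_one, zpow_one]
  field_simp

lemma kron_comm {Q t z : ℂ} (h0 : Q ≠ 0) (h1 : ‖Q‖ < 1) (ht : ‖Q‖ < ‖t‖) (ht1 : ‖t‖ < 1)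
    (hz : ‖Q‖ < ‖z‖) (hz1 : ‖z‖ < 1) : kron Q t z = kron Q z t := by
  have hz0 : 0 < ‖z‖ := (norm_nonneg _).trans_lt hz
  have ht0 : 0 < ‖t‖ := (norm_nonneg _).trans_lt ht
  rw [kron_eq_nat h0 h1 (norm_pos_iff.1 ht0) hz hz1, kron_eq_nat h0 h1 (norm_pos_iff.1 hz0) ht ht1,
    tsum_pow_mul_frac_comm h1 ht1 hz1, mul_comm z t,
    tsum_pow_mul_frac_comm (t := Q / t) (z := Q / z) h1]
  · rw [norm_div]; exact (div_lt_one ht0).2 ht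
  · rw [norm_div]; exact (div_lt_one hz0).2 hz

lemma kron_inv_self {Q z : ℂ} (h0 : Q ≠ 0) (h1 : ‖Q‖ < 1) (hz : ‖Q‖ < ‖z‖)
    (hz1 : ‖z‖ < 1) : kron Q z⁻¹ z = 0 := by
  have hz0 : 0 < ‖z‖ := (norm_nonneg _).trans_lt hz
  have hz' := norm_pos_iff.1 hz0
  have h := kron_inv h0 hz' z
  have h2 : kron Q z (Q / z) = kron Q z⁻¹ z * z⁻¹ := by
    rw [kron_comm h0 h1 hz hz1, mul_comm, ← zpow_neg_one, ← kron_shift h0 _ hz', zpow_one,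
      zpow_neg_one, div_eq_inv_mul]
    · rw [norm_div, lt_div_iff₀ hz0]; exact mul_lt_of_lt_one_right (norm_pos_iff.2 h0) hz1
    · rw [norm_div]; exact (div_lt_one hz0).2 hz
  rw [h2] at h
  have : -z * (kron Q z⁻¹ z * z⁻¹) = - kron Q z⁻¹ z := by field_simp
  rw [this] at h
  exact self_eq_neg.1 h

lemma tsum_triCoeff {Q : ℂ} : ∑' m : ℤ, triCoeff Q m = 0 := by
  have h : ∑' m : ℤ, triCoeff Q m = - ∑' m : ℤ, triCoeff Q m := by
    rw [← tsum_neg, ← (Equiv.subLeft (-1 : ℤ)).tsum_eq]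
    refine tsum_congr fun m => ?_
    have : (-1 : ℤ) - m = -m - 1 := by ring
    rw [Equiv.subLeft_apply, triCoeff, triCoeff, this, tri_neg_sub_one, zpow_sub₀ (by norm_num),
      zpow_neg, ← inv_zpow]
    ring_nf
  exact self_eq_neg.1 h

lemma appell_mul {Q t : ℂ} (h0 : Q ≠ 0) (h1 : ‖Q‖ < 1) (ht : t ≠ 0)
    (hp : ∀ m : ℤ, t * Q ^ m ≠ 1) :
    appell Q (t * Q) = -t * appell Q t := by
  have hs := (summable_triCoeff_mul_frac h0 h1 ht).of_norm
  have h2 : ∀ m, triCoeff Q (m - 1) * frac Q t m =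
      triCoeff Q (m - 1) + -t * (triCoeff Q m * frac Q t m) := by
    intro m
    have hm : 1 - t * Q ^ m ≠ 0 := sub_ne_zero.2 (hp m).symm
    have hQ := zpow_ne_zero m h0
    have h3 : triCoeff Q (m - 1) = -triCoeff Q m * (Q ^ m)⁻¹ := by
      rw [sub_eq_add_neg, triCoeff_add h0, mul_neg_one, zpow_neg]
      simp [triCoeff, show tri (-1) = 0 from rfl]
    rw [frac, h3]
    linear_combination -triCoeff Q m * (Q ^ m)⁻¹ * inv_mul_cancel₀ hm -
      triCoeff Q m * t * (1 - t * Q ^ m)⁻¹ * inv_mul_cancel₀ hQ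
  have h4 : ∑' m : ℤ, triCoeff Q (m - 1) = 0 :=
    ((Equiv.subRight (1 : ℤ)).tsum_eq _).trans tsum_triCoeff
  have h5 : Summable fun m : ℤ => triCoeff Q (m - 1) :=
    (summable_triCoeff h0 h1).of_norm.comp_injective (Equiv.subRight (1 : ℤ)).injective
  rw [appell, appell, ← tsum_mul_left, ← (Equiv.subRight (1 : ℤ)).tsum_eq]
  simp only [Equiv.subRight_apply]
  have h6 := h5.tsum_add (hs.mul_left (-t))
  rw [h4, zero_add] at h6
  rw [← h6]
  refine tsum_congr fun m => ?_
  rw [← h2]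
  have := frac_shift h0 t (m - 1) 1
  rw [zpow_one, sub_add_cancel] at this
  rw [this]

lemma appell_inv {Q t : ℂ} (h0 : Q ≠ 0) (ht : t ≠ 0) : appell Q t⁻¹ = -t * appell Q t := by
  rw [appell, appell, ← tsum_mul_left, ← (Equiv.neg ℤ).tsum_eq]
  refine tsum_congr fun m => ?_
  rw [Equiv.neg_apply, frac_neg h0 (inv_ne_zero ht), triCoeff_neg h0, inv_inv, zpow_neg]
  have := zpow_ne_zero m h0
  field_simp

lemma appell_shift {Q t : ℂ} (h0 : Q ≠ 0) (h1 : ‖Q‖ < 1) (ht : t ≠ 0)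
    (hp : ∀ m : ℤ, t * Q ^ m ≠ 1) (n : ℤ) :
    appell Q (t * Q ^ (-n)) = triCoeff Q n * t ^ (-n) * appell Q t := by
  have key : ∀ n : ℤ, appell Q (t * Q ^ (-(n + 1))) = -(t * Q ^ (-(n + 1)))⁻¹ *
      appell Q (t * Q ^ (-n)) := by
    intro n
    have h2 : t * Q ^ (-(n + 1)) ≠ 0 := mul_ne_zero ht (zpow_ne_zero _ h0)
    have h := appell_mul h0 h1 h2 fun m => by
      rw [mul_assoc, ← zpow_add₀ h0]; exact hp _
    have h3 : t * Q ^ (-(n + 1)) * Q = t * Q ^ (-n) := by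
      rw [mul_assoc, ← zpow_add_one₀ h0]; congr 2; ring
    rw [h3] at h
    rw [h]
    field_simp
  have key2 : ∀ n : ℤ, triCoeff Q (n + 1) * t ^ (-(n + 1)) =
      -(t * Q ^ (-(n + 1)))⁻¹ * (triCoeff Q n * t ^ (-n)) := by
    intro n
    rw [triCoeff_add h0, mul_one, zpow_neg, zpow_neg, zpow_neg, zpow_add₀ ht, zpow_add₀ h0]
    simp only [triCoeff, tri_one, zpow_one]
    field_simp
  induction n using Int.induction_on with
  | zero => simp [triCoeff]
  | succ n ih => rw [key, ih, key2]; ring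
  | pred n ih =>
    have h2 := key (-n - 1)
    have h3 := key2 (-n - 1)
    rw [sub_add_cancel] at h2 h3
    rw [ih, h3] at h2
    have h4 : t * Q ^ (- -(n : ℤ)) ≠ 0 := mul_ne_zero ht (zpow_ne_zero _ h0)
    have h5 : -(t * Q ^ (- -(n : ℤ)))⁻¹ ≠ 0 := neg_ne_zero.2 (inv_ne_zero h4)
    refine mul_left_cancel₀ h5 ?_
    rw [← h2]; ring

end

section

open Filter Topology

/-! ### Products of bilateral sums -/

lemma tsum_mul_tsum_eq_add {f g : ℤ → ℂ} {P R : ℤ → ℤ → ℂ} (hf : Summable fun m => ‖f m‖)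
    (hg : Summable fun m => ‖g m‖) (h : ∀ m n, f m * g n = P m n + R m n)
    (hP : Summable fun p : ℤ × ℤ => P p.1 p.2) :
    (∑' m, f m) * ∑' n, g n = ∑' m, ∑' n, P m n + ∑' n, ∑' m, R m n := by
  have hfg := summable_mul_of_summable_norm hf hg
  have hR : Summable fun p : ℤ × ℤ => R p.1 p.2 := by
    refine (hfg.sub hP).congr fun p => ?_
    rw [h]; ring
  rw [tsum_mul_tsum_of_summable_norm hf hg, ← hP.tsum_prod' fun m => hP.prod_factor m,
    hR.tsum_comm (f := R), ← hR.tsum_prod' fun m => hR.prod_factor m, ← hP.tsum_add hR]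
  exact tsum_congr fun p => h _ _

lemma frac_mul_frac {Q s t : ℂ} (h0 : Q ≠ 0) {m n : ℤ} (hs : s ≠ 0) (ht : t ≠ 0)
    (hsn : s * Q ^ n ≠ 1) (htm : t * Q ^ m ≠ 1) (h : s * Q ^ n ≠ t * Q ^ m) :
    frac Q t m * frac Q s n =
      frac Q t m * frac Q (s / t) (n - m) + frac Q s n * frac Q (t / s) (m - n) := by
  have hm := zpow_ne_zero m h0
  have hn := zpow_ne_zero n h0
  have e1 : s / t * Q ^ (n - m) = (s * Q ^ n) / (t * Q ^ m) := by
    rw [zpow_sub₀ h0]; field_simp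
  have e2 : t / s * Q ^ (m - n) = (t * Q ^ m) / (s * Q ^ n) := by
    rw [zpow_sub₀ h0]; field_simp
  have hx : t * Q ^ m ≠ 0 := mul_ne_zero ht hm
  have hy : s * Q ^ n ≠ 0 := mul_ne_zero hs hn
  rw [frac, frac, frac, frac, e1, e2]
  generalize t * Q ^ m = x at *
  generalize s * Q ^ n = y at *
  have a1 : 1 - x ≠ 0 := sub_ne_zero.2 htm.symm
  have a2 : 1 - y ≠ 0 := sub_ne_zero.2 hsn.symm
  have a3 : x - y ≠ 0 := sub_ne_zero.2 h.symm
  have b1 : 1 - y / x = (x - y) / x := by field_simp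
  have b2 : 1 - x / y = -(x - y) / y := by field_simp; ring
  rw [b1, b2]
  field_simp
  ring

lemma mul_zpow_ne_one {Q z : ℂ} (h1 : ‖Q‖ < 1) (hz : ‖Q‖ < ‖z‖)
    (hz1 : ‖z‖ < 1) (m : ℤ) : z * Q ^ m ≠ 1 := by
  intro h
  have hz0 : 0 < ‖z‖ := (norm_nonneg _).trans_lt hz
  have h2 : ‖z‖ * ‖Q‖ ^ m = 1 := by rw [← norm_zpow, ← norm_mul, h, norm_one]
  rcases lt_or_ge m 0 with hm | hm
  · obtain ⟨k, rfl⟩ : ∃ k : ℕ, m = -(k + 1 : ℕ) := ⟨(-m - 1).toNat, by omega⟩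
    rcases eq_or_ne Q 0 with rfl | h0
    · rw [zpow_neg, zpow_natCast] at h; simp at h
    have hQ := norm_pos_iff.2 h0
    rw [zpow_neg, zpow_natCast, mul_inv_eq_one₀ (by positivity), pow_succ] at h2
    have : ‖Q‖ ^ k * ‖Q‖ ≤ 1 * ‖Q‖ := by gcongr; exact pow_le_one₀ (norm_nonneg _) h1.le
    linarith
  · obtain ⟨k, rfl⟩ := Int.eq_ofNat_of_zero_le hm
    rw [zpow_natCast] at h2
    have : ‖z‖ * ‖Q‖ ^ k ≤ ‖z‖ * 1 := by gcongr; exact pow_le_one₀ (norm_nonneg _) h1.le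
    linarith

/-- A Kronecker type identity. -/
lemma kron_mul_appell {Q t z : ℂ} (h0 : Q ≠ 0) (h1 : ‖Q‖ < 1) (ht : t ≠ 0)
    (hp : ∀ m : ℤ, t * Q ^ m ≠ 1) (hz : ‖Q‖ < ‖z‖) (hz1 : ‖z‖ < 1)
    (hp' : ∀ m : ℤ, t * z * Q ^ m ≠ 1) :
    kron Q t z * appell Q (t * z) = appell Q t * appell Q z := by
  have hz0 : z ≠ 0 := norm_pos_iff.1 ((norm_nonneg _).trans_lt hz)
  have hz' := mul_zpow_ne_one h1 hz hz1
  have htz : t * z ≠ 0 := mul_ne_zero ht hz0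
  have e1 : t * z / t = z := by field_simp
  have e2 : t / (t * z) = z⁻¹ := by field_simp
  have key : ∀ m n : ℤ, (z ^ m * frac Q t m) * (triCoeff Q n * frac Q (t * z) n) =
      z ^ m * frac Q t m * (triCoeff Q n * frac Q z (n - m)) +
        triCoeff Q n * frac Q (t * z) n * (z ^ m * frac Q z⁻¹ (m - n)) := by
    intro m n
    have hne : t * z * Q ^ n ≠ t * Q ^ m := by
      intro h
      refine hz' (n - m) ?_
      rw [mul_assoc] at h
      rw [zpow_sub₀ h0, ← mul_div_assoc, mul_left_cancel₀ ht h,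
        div_self (zpow_ne_zero _ h0)]
    have := frac_mul_frac h0 htz ht (hp' n) (hp m) hne
    rw [e1, e2] at this
    linear_combination (z ^ m * triCoeff Q n) * this
  have hA := summable_norm_zpow_mul_frac h0 h1 hz hz1 ht
  have hB := summable_triCoeff_mul_frac h0 h1 htz
  have hP : Summable fun p : ℤ × ℤ => z ^ p.1 * frac Q t p.1 *
      (triCoeff Q p.2 * frac Q z (p.2 - p.1)) := by
    obtain ⟨C, hC⟩ := exists_norm_frac_le h0 h1 hz0
    have := summable_norm_mul_of_bdd (hA.mul_norm (summable_triCoeff h0 h1))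
      (g := fun p : ℤ × ℤ => frac Q z (p.2 - p.1)) fun p => hC _
    exact this.of_norm.congr fun p => by ring
  rw [kron, appell, tsum_mul_tsum_eq_add hA hB key hP]
  have s1 : ∀ m : ℤ, ∑' n, z ^ m * frac Q t m * (triCoeff Q n * frac Q z (n - m)) =
      triCoeff Q m * frac Q t m * appell Q z := by
    intro m
    have h := appell_shift h0 h1 hz0 hz' m
    have h2 : ∑' n, triCoeff Q n * frac Q z (n - m) = appell Q (z * Q ^ (-m)) := by
      rw [appell]
      exact tsum_congr fun n => by rw [frac_shift h0, sub_eq_add_neg]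
    rw [tsum_mul_left, h2, h, zpow_neg]
    have := zpow_ne_zero m hz0
    field_simp
  have s2 : ∀ n : ℤ, ∑' m, triCoeff Q n * frac Q (t * z) n * (z ^ m * frac Q z⁻¹ (m - n)) = 0 := by
    intro n
    have h2 : ∑' m, z ^ m * frac Q z⁻¹ (m - n) = kron Q (z⁻¹ * Q ^ (-n)) z := by
      rw [kron]
      exact tsum_congr fun n => by rw [frac_shift h0, sub_eq_add_neg]
    rw [tsum_mul_left, h2, kron_shift h0 _ hz0, kron_inv_self h0 h1 hz hz1, mul_zero, mul_zero]
  rw [tsum_congr s1, tsum_congr s2, tsum_zero, add_zero, tsum_mul_right]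
  rfl

lemma frac_one_zero (Q : ℂ) : frac Q 1 0 = 0 := by simp [frac]

lemma summable_norm_zpow_mul_frac_mul_frac {Q z : ℂ} (h0 : Q ≠ 0) (h1 : ‖Q‖ < 1) (hz : ‖Q‖ < ‖z‖)
    (hz1 : ‖z‖ < 1) {s t : ℂ} (hs : s ≠ 0) (ht : t ≠ 0) :
    Summable fun m : ℤ => ‖z ^ m * frac Q t m * frac Q s m‖ := by
  obtain ⟨C, hC⟩ := exists_norm_frac_le h0 h1 hs
  exact summable_norm_mul_of_bdd (summable_norm_zpow_mul_frac h0 h1 hz hz1 ht) hC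

lemma kron_mul_kron_aux {Q t z w : ℂ} (h0 : Q ≠ 0) (h1 : ‖Q‖ < 1) (ht : t ≠ 0)
    (hz : ‖Q‖ < ‖z‖) (hz1 : ‖z‖ < 1) (hw : ‖Q‖ < ‖w‖)
    (hw1 : ‖w‖ < 1) (hv : ‖Q‖ < ‖z * w‖) {a : ℤ → ℂ}
    (key : ∀ m n, frac Q t m * frac Q t n = frac Q t m * frac Q 1 (n - m) +
      frac Q t n * frac Q 1 (m - n) + (if m = n then frac Q t m ^ 2 else 0) -
      (if n = 0 then a m else 0) - (if m = 0 then a n else 0))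
    (haz : Summable fun m => ‖z ^ m * a m‖) (haw : Summable fun m => ‖w ^ m * a m‖) :
    kron Q t z * kron Q t w = kron Q t (z * w) * (kron Q 1 z + kron Q 1 w) + kronSq Q t (z * w) -
      ∑' m, z ^ m * a m - ∑' m, w ^ m * a m := by
  have hz0 : z ≠ 0 := norm_pos_iff.1 ((norm_nonneg _).trans_lt hz)
  have hw0 : w ≠ 0 := norm_pos_iff.1 ((norm_nonneg _).trans_lt hw)
  have hv1 : ‖z * w‖ < 1 := by
    rw [norm_mul]; exact mul_lt_one_of_nonneg_of_lt_one_left (norm_nonneg _) hz1 hw1.le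
  have hV := summable_norm_zpow_mul_frac h0 h1 hv hv1 ht
  have hV2 := summable_norm_zpow_mul_frac_mul_frac h0 h1 hv hv1 ht ht
  have key2 : ∀ m n : ℤ, (z ^ m * frac Q t m) * (w ^ n * frac Q t n) =
      ((z * w) ^ m * frac Q t m * (w ^ (n - m) * frac Q 1 (n - m)) -
        if n = 0 then z ^ m * a m else 0) +
      ((z * w) ^ n * frac Q t n * (z ^ (m - n) * frac Q 1 (m - n)) +
        (if m = n then (z * w) ^ n * frac Q t n ^ 2 else 0) -
        if m = 0 then w ^ n * a n else 0) := by
    intro m n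
    have e : (z ^ m * frac Q t m) * (w ^ n * frac Q t n) = z ^ m * w ^ n *
      (frac Q t m * frac Q t n) := by ring
    have hzn := zpow_ne_zero n hz0
    have hwm := zpow_ne_zero m hw0
    rw [e, key, zpow_sub₀ hz0, zpow_sub₀ hw0, mul_zpow, mul_zpow]
    split_ifs <;> subst_vars <;> field_simp <;> simp <;> ring
  have hP : Summable fun p : ℤ × ℤ => (z * w) ^ p.1 * frac Q t p.1 *
      (w ^ (p.2 - p.1) * frac Q 1 (p.2 - p.1)) - if p.2 = 0 then z ^ p.1 * a p.1 else 0 := by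
    have hi : Function.Injective fun p : ℤ × ℤ => (p.1, p.2 - p.1) := by
      rintro ⟨a, b⟩ ⟨c, d⟩ h
      simp only [Prod.mk.injEq] at h ⊢
      omega
    have s1 := (summable_mul_of_summable_norm hV
      (summable_norm_zpow_mul_frac h0 h1 hw hw1 one_ne_zero)).comp_injective hi
    have hd : Summable fun n : ℤ => ‖if n = 0 then (1 : ℂ) else 0‖ := by
      refine (hasSum_ite_eq (0 : ℤ) (1 : ℝ)).summable.congr fun n => ?_
      split_ifs <;> simp
    have s2 := summable_mul_of_summable_norm haz hd
    refine (s1.sub s2).congr fun p => ?_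
    simp
  rw [kron, kron, tsum_mul_tsum_eq_add (summable_norm_zpow_mul_frac h0 h1 hz hz1 ht)
    (summable_norm_zpow_mul_frac h0 h1 hw hw1 ht) key2 hP]
  have hK : ∀ x : ℂ, ‖Q‖ < ‖x‖ → ‖x‖ < 1 → ∀ m : ℤ,
      HasSum (fun n : ℤ => x ^ (n - m) * frac Q 1 (n - m)) (kron Q 1 x) := by
    intro x hx hx1 m
    have h := (summable_norm_zpow_mul_frac h0 h1 hx hx1 one_ne_zero).of_norm.hasSum
    exact (Equiv.subRight m).hasSum_iff (f := fun n : ℤ => x ^ n * frac Q 1 n) |>.2 h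
  have s1 : ∀ m : ℤ, ∑' n, ((z * w) ^ m * frac Q t m * (w ^ (n - m) * frac Q 1 (n - m)) -
      if n = 0 then z ^ m * a m else 0) =
      (z * w) ^ m * frac Q t m * kron Q 1 w - z ^ m * a m := fun m =>
    (((hK w hw hw1 m).mul_left _).sub (hasSum_ite_eq 0 _)).tsum_eq
  have s2 : ∀ n : ℤ, ∑' m, ((z * w) ^ n * frac Q t n * (z ^ (m - n) * frac Q 1 (m - n)) +
        (if m = n then (z * w) ^ n * frac Q t n ^ 2 else 0) -
        if m = 0 then w ^ n * a n else 0) =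
      (z * w) ^ n * frac Q t n * kron Q 1 z + (z * w) ^ n * frac Q t n * frac Q t n -
        w ^ n * a n := fun n => by
    rw [(((hK z hz hz1 n).mul_left _).add (hasSum_ite_eq n _) |>.sub (hasSum_ite_eq 0 _)).tsum_eq]
    ring
  rw [tsum_congr s1, tsum_congr s2, Summable.tsum_sub (hV.of_norm.mul_right _) haz.of_norm,
    Summable.tsum_sub ((hV.of_norm.mul_right _).add hV2.of_norm) haw.of_norm,
    Summable.tsum_add (hV.of_norm.mul_right _) hV2.of_norm, tsum_mul_right, tsum_mul_right,
    show kron Q t (z * w) = ∑' m : ℤ, (z * w) ^ m * frac Q t m from rfl, kronSq]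
  simp only [pow_two, mul_assoc]
  ring

lemma frac_one_mul_neg {Q : ℂ} (h0 : Q ≠ 0) (n : ℤ) :
    frac Q 1 n * frac Q 1 (-n) = frac Q 1 n - frac Q 1 n ^ 2 := by
  rw [frac_neg h0 one_ne_zero, inv_one]
  by_cases h : Q ^ n = 1
  · simp [frac, h]
  · have h2 : 1 - 1 * Q ^ n ≠ 0 := by rw [one_mul]; exact sub_ne_zero.2 (Ne.symm h)
    rw [frac]
    linear_combination (1 - 1 * Q ^ n)⁻¹ * inv_mul_cancel₀ h2

lemma zpow_ne_one {Q : ℂ} (h1 : ‖Q‖ < 1) {n : ℤ} (hn : n ≠ 0) : Q ^ n ≠ 1 := by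
  intro h
  have h2 : ‖Q‖ ^ n = 1 := by rw [← norm_zpow, h, norm_one]
  rw [zpow_eq_one_iff_right₀ (norm_nonneg _) h1.ne] at h2
  exact hn h2

/-- A Fay type identity. -/
lemma kron_mul_kron {Q t z w : ℂ} (h0 : Q ≠ 0) (h1 : ‖Q‖ < 1) (ht : t ≠ 0)
    (hp : ∀ m : ℤ, t * Q ^ m ≠ 1) (hz : ‖Q‖ < ‖z‖) (hz1 : ‖z‖ < 1) (hw : ‖Q‖ < ‖w‖)
    (hw1 : ‖w‖ < 1) (hv : ‖Q‖ < ‖z * w‖) :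
    kron Q t z * kron Q t w =
      kron Q t (z * w) * (kron Q 1 z + kron Q 1 w) + kronSq Q t (z * w) := by
  have := kron_mul_kron_aux (a := 0) h0 h1 ht hz hz1 hw hw1 hv (fun m n => ?_) (by simp)
    (by simp)
  · simpa using this
  · by_cases hmn : m = n
    · subst hmn; simp [frac_one_zero, pow_two]
    · have hne : t * Q ^ n ≠ t * Q ^ m := fun h =>
        zpow_ne_one h1 (sub_ne_zero.2 hmn) (by
          rw [zpow_sub₀ h0, mul_left_cancel₀ ht h, div_self (zpow_ne_zero _ h0)])
      have := frac_mul_frac h0 ht ht (hp n) (hp m) hne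
      rw [div_self ht] at this
      simp [this, hmn]

lemma kron_one_mul_kron_one {Q z w : ℂ} (h0 : Q ≠ 0) (h1 : ‖Q‖ < 1)
    (hz : ‖Q‖ < ‖z‖) (hz1 : ‖z‖ < 1) (hw : ‖Q‖ < ‖w‖)
    (hw1 : ‖w‖ < 1) (hv : ‖Q‖ < ‖z * w‖) :
    kron Q 1 z * kron Q 1 w =
      kron Q 1 (z * w) * (kron Q 1 z + kron Q 1 w) + kronSq Q 1 (z * w)
      + (kronSq Q 1 z - kron Q 1 z) + (kronSq Q 1 w - kron Q 1 w) := by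
  have hs : ∀ x : ℂ, ‖Q‖ < ‖x‖ → ‖x‖ < 1 →
      Summable (fun m : ℤ => ‖x ^ m * (frac Q 1 m - frac Q 1 m ^ 2)‖) ∧
      ∑' m : ℤ, x ^ m * (frac Q 1 m - frac Q 1 m ^ 2) = kron Q 1 x - kronSq Q 1 x := by
    intro x hx hx1
    have e : (fun m : ℤ => x ^ m * (frac Q 1 m - frac Q 1 m ^ 2)) =
      fun m : ℤ => x ^ m * frac Q 1 m - x ^ m * frac Q 1 m * frac Q 1 m := by
      funext m; ring
    have A := summable_norm_zpow_mul_frac h0 h1 hx hx1 one_ne_zero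
    have B := summable_norm_zpow_mul_frac_mul_frac h0 h1 hx hx1 one_ne_zero one_ne_zero
    refine ⟨.of_nonneg_of_le (fun _ => norm_nonneg _) (fun m => ?_) (A.add B), ?_⟩
    · rw [congrFun e m]; exact norm_sub_le _ _
    · rw [e, Summable.tsum_sub A.of_norm B.of_norm, kron, kronSq]
      simp only [pow_two, mul_assoc]
  have := kron_mul_kron_aux (a := fun m => frac Q 1 m - frac Q 1 m ^ 2) h0 h1 one_ne_zero hz hz1
    hw hw1 hv (fun m n => ?_) (hs z hz hz1).1 (hs w hw hw1).1
  · rw [this, (hs z hz hz1).2, (hs w hw hw1).2]; ring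
  · by_cases hm : m = 0
    · subst hm
      by_cases hn : n = 0
      · subst hn; simp [frac_one_zero]
      · simp [frac_one_zero, hn, Ne.symm hn, frac_one_mul_neg h0]
    by_cases hn : n = 0
    · subst hn; simp [frac_one_zero, hm, frac_one_mul_neg h0]
    by_cases hmn : m = n
    · subst hmn; simp [frac_one_zero, pow_two, hm]
    · have hne : 1 * Q ^ n ≠ 1 * Q ^ m := fun h =>
        zpow_ne_one h1 (sub_ne_zero.2 hmn) (by
          rw [zpow_sub₀ h0, mul_left_cancel₀ one_ne_zero h, div_self (zpow_ne_zero _ h0)])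
      have := frac_mul_frac h0 one_ne_zero one_ne_zero (by simpa using zpow_ne_one h1 hn)
        (by simpa using zpow_ne_one h1 hm) hne
      rw [div_self one_ne_zero] at this
      simp [this, hmn, hm, hn]

end

section

open Filter Topology

/-! ### Products of sums of simple fractions -/

/-- The sum of simple fractions with numerators `ρ n`. -/
noncomputable def fracSum (y : ℂ) (ρ : ℤ → ℂ) (t : ℂ) : ℂ := ∑' n : ℤ, ρ n * frac y t n

lemma summable_mul_frac {y t : ℂ} (h0 : y ≠ 0) (h1 : ‖y‖ < 1) (ht : t ≠ 0) {ρ : ℤ → ℂ}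
    (hρ : Summable fun n => ‖ρ n‖) : Summable fun n => ‖ρ n * frac y t n‖ := by
  obtain ⟨C, hC⟩ := exists_norm_frac_le h0 h1 ht
  exact summable_norm_mul_of_bdd hρ hC

lemma fracSum_zpow {y : ℂ} (h0 : y ≠ 0) (ρ : ℤ → ℂ) (n : ℤ) :
    fracSum y ρ (y ^ (-n)) = ∑' m : ℤ, ρ m * frac y 1 (m - n) := by
  rw [fracSum]
  refine tsum_congr fun m => ?_
  have := frac_shift h0 1 m (-n)
  rw [one_mul] at this
  rw [this, sub_eq_add_neg]

lemma exists_norm_fracSum_zpow_le {y : ℂ} (h0 : y ≠ 0) (h1 : ‖y‖ < 1) {ρ : ℤ → ℂ}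
    (hρ : Summable fun n => ‖ρ n‖) : ∃ C, ∀ n : ℤ, ‖fracSum y ρ (y ^ (-n))‖ ≤ C := by
  obtain ⟨C, hC⟩ := exists_norm_frac_le h0 h1 one_ne_zero
  refine ⟨∑' n, ‖ρ n‖ * C, fun n => ?_⟩
  rw [fracSum_zpow h0]
  have hs := summable_norm_mul_of_bdd hρ (g := fun m => frac y 1 (m - n)) fun m => hC _
  refine (norm_tsum_le_tsum_norm hs).trans (hs.tsum_le_tsum (fun m => ?_) (hρ.mul_right C))
  rw [norm_mul]
  exact mul_le_mul_of_nonneg_left (hC _) (norm_nonneg _)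

/-- The numerators of the partial fraction expansion of a product. -/
noncomputable def fracMul (y : ℂ) (ρ σ : ℤ → ℂ) (n : ℤ) : ℂ :=
  ρ n * fracSum y σ (y ^ (-n)) + σ n * fracSum y ρ (y ^ (-n))

lemma summable_fracMul {y : ℂ} (h0 : y ≠ 0) (h1 : ‖y‖ < 1) {ρ σ : ℤ → ℂ}
    (hρ : Summable fun n => ‖ρ n‖) (hσ : Summable fun n => ‖σ n‖) :
    Summable fun n => ‖fracMul y ρ σ n‖ := by
  obtain ⟨C, hC⟩ := exists_norm_fracSum_zpow_le h0 h1 hρ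
  obtain ⟨D, hD⟩ := exists_norm_fracSum_zpow_le h0 h1 hσ
  exact .of_nonneg_of_le (fun _ => norm_nonneg _) (fun n => norm_add_le _ _)
    ((summable_norm_mul_of_bdd hρ hD).add (summable_norm_mul_of_bdd hσ hC))

lemma fracSum_mul_fracSum {y t : ℂ} (h0 : y ≠ 0) (h1 : ‖y‖ < 1) (ht : t ≠ 0) {ρ σ : ℤ → ℂ}
    (hρ : Summable fun n => ‖ρ n‖) (hσ : Summable fun n => ‖σ n‖) (hd : ∀ n, ρ n = 0 ∨ σ n = 0)
    (hpρ : ∀ n, ρ n ≠ 0 → t * y ^ n ≠ 1) (hpσ : ∀ n, σ n ≠ 0 → t * y ^ n ≠ 1) :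
    fracSum y ρ t * fracSum y σ t = fracSum y (fracMul y ρ σ) t := by
  have key : ∀ m n : ℤ, (ρ m * frac y t m) * (σ n * frac y t n) =
      ρ m * frac y t m * (σ n * frac y 1 (n - m)) +
        σ n * frac y t n * (ρ m * frac y 1 (m - n)) := by
    intro m n
    by_cases hm : ρ m = 0
    · simp [hm]
    by_cases hn : σ n = 0
    · simp [hn]
    have hmn : m ≠ n := fun h => by subst h; exact (hd m).elim hm hn
    have hne : t * y ^ n ≠ t * y ^ m := fun h =>
      zpow_ne_one h1 (sub_ne_zero.2 hmn) (by
        rw [zpow_sub₀ h0, mul_left_cancel₀ ht h, div_self (zpow_ne_zero _ h0)])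
    have := frac_mul_frac h0 ht ht (hpσ n hn) (hpρ m hm) hne
    rw [div_self ht] at this
    linear_combination (ρ m * σ n) * this
  have hA := summable_mul_frac h0 h1 ht hρ
  have hB := summable_mul_frac h0 h1 ht hσ
  obtain ⟨C, hC⟩ := exists_norm_frac_le h0 h1 one_ne_zero
  have hP : Summable fun p : ℤ × ℤ => ρ p.1 * frac y t p.1 * (σ p.2 * frac y 1 (p.2 - p.1)) := by
    have := summable_norm_mul_of_bdd (hA.mul_norm hσ)
      (g := fun p : ℤ × ℤ => frac y 1 (p.2 - p.1)) fun p => hC _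
    exact this.of_norm.congr fun p => by ring
  obtain ⟨D, hD⟩ := exists_norm_fracSum_zpow_le h0 h1 hρ
  obtain ⟨E, hE⟩ := exists_norm_fracSum_zpow_le h0 h1 hσ
  rw [fracSum, fracSum, tsum_mul_tsum_eq_add hA hB key hP]
  simp only [tsum_mul_left, ← fracSum_zpow h0]
  rw [← Summable.tsum_add (summable_norm_mul_of_bdd hA hE).of_norm
    (summable_norm_mul_of_bdd hB hD).of_norm, fracSum]
  refine tsum_congr fun n => ?_
  rw [fracMul]; ring

/-- The numerators of `appell (y ^ 5) (t * y ^ b)` as a sum of simple fractions in `y`. -/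
noncomputable def prog (y : ℂ) (b n : ℤ) : ℂ := if n % 5 = b then triCoeff (y ^ 5) (n / 5) else 0

lemma hasSum_prog_iff {b : ℤ} (hb : 0 ≤ b) (hb5 : b < 5) {f : ℤ → ℂ} {s : ℂ} :
    HasSum (fun n : ℤ => if n % 5 = b then f n else 0) s ↔
      HasSum (fun m : ℤ => f (5 * m + b)) s := by
  have hi : Function.Injective fun m : ℤ => 5 * m + b := fun m n h => by
    simp only at h; omega
  rw [← hi.hasSum_iff]
  · have : ∀ m : ℤ, (5 * m + b) % 5 = b := by omega
    simp [Function.comp_def, this]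
  · intro n hn
    rw [if_neg]
    intro h
    exact hn ⟨n / 5, by simp only; omega⟩

lemma summable_norm_prog_iff {b : ℤ} (hb : 0 ≤ b) (hb5 : b < 5) {f : ℤ → ℂ} :
    Summable (fun n : ℤ => ‖if n % 5 = b then f n else 0‖) ↔
      Summable (fun m : ℤ => ‖f (5 * m + b)‖) := by
  have hi : Function.Injective fun m : ℤ => 5 * m + b := fun m n h => by
    simp only at h; omega
  rw [← hi.summable_iff]
  · refine summable_congr fun m => ?_
    have : (5 * m + b) % 5 = b := by omega
    simp [this]
  · intro n hn
    rw [if_neg, norm_zero]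
    intro h
    exact hn ⟨n / 5, by simp only; omega⟩

variable {y : ℂ}

lemma norm_pow_five_lt_one (h1 : ‖y‖ < 1) : ‖y ^ 5‖ < 1 := by
  rw [norm_pow]; exact pow_lt_one₀ (norm_nonneg _) h1 (by norm_num)

lemma summable_prog (h0 : y ≠ 0) (h1 : ‖y‖ < 1) {b : ℤ} (hb : 0 ≤ b) (hb5 : b < 5) :
    Summable fun n => ‖prog y b n‖ := by
  unfold prog
  rw [summable_norm_prog_iff hb hb5]
  refine (summable_triCoeff (pow_ne_zero 5 h0) (norm_pow_five_lt_one h1)).congr fun m => ?_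
  rw [show (5 * m + b) / 5 = m by omega]

lemma frac_pow_five (h0 : y ≠ 0) (t : ℂ) (m b : ℤ) :
    frac (y ^ 5) (t * y ^ b) m = frac y t (5 * m + b) := by
  rw [frac, frac, zpow_add₀ h0, zpow_mul, zpow_ofNat]; ring_nf

lemma fracSum_prog (h0 : y ≠ 0) (t : ℂ) {b : ℤ} (hb : 0 ≤ b) (hb5 : b < 5) :
    fracSum y (prog y b) t = appell (y ^ 5) (t * y ^ b) := by
  have hi : Function.Injective fun m : ℤ => 5 * m + b := fun m n h => by
    simp only at h; omega
  rw [fracSum, appell, ← hi.tsum_eq]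
  · refine tsum_congr fun m => ?_
    rw [frac_pow_five h0, prog, if_pos (by omega), show (5 * m + b) / 5 = m by omega]
  · intro n hn
    simp only [prog, Function.mem_support, ne_eq, mul_eq_zero, ite_eq_right_iff, not_or,
      not_forall] at hn
    obtain ⟨⟨h, -⟩, -⟩ := hn
    exact ⟨n / 5, by simp only; omega⟩

lemma fracSum_prog_zpow (h0 : y ≠ 0) (h1 : ‖y‖ < 1) {b c : ℤ} (hb : 0 ≤ b) (hb5 : b < 5)
    (hc : 0 ≤ c) (hc5 : c < 5) (hbc : b ≠ c) {n : ℤ} (hn : n % 5 = b) :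
    fracSum y (prog y c) (y ^ (-n)) =
      triCoeff (y ^ 5) (n / 5) * y ^ ((b - c) * (n / 5)) * appell (y ^ 5) (y ^ (c - b)) := by
  have hm : -n + c = (c - b) + 5 * (-(n / 5)) := by omega
  rw [fracSum_prog h0 _ hc hc5, ← zpow_add₀ h0, hm, zpow_add₀ h0, zpow_mul y 5, zpow_ofNat,
    appell_shift (pow_ne_zero 5 h0) (norm_pow_five_lt_one h1) (zpow_ne_zero _ h0), ← zpow_mul]
  · congr 3; ring
  · intro m
    rw [← zpow_ofNat, ← zpow_mul, ← zpow_add₀ h0]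
    refine zpow_ne_one h1 ?_
    omega

/-- The numerators of a product of three `appell` sums at the poles indexed by `b` modulo `5`. -/
noncomputable def tripleCoeff (y : ℂ) (b c d n : ℤ) : ℂ :=
  if n % 5 = b then triCoeff (y ^ 5) (n / 5) ^ 3 * y ^ ((2 * b - c - d) * (n / 5)) *
    (appell (y ^ 5) (y ^ (c - b)) * appell (y ^ 5) (y ^ (d - b))) else 0

lemma tripleCoeff_eq (h0 : y ≠ 0) (h1 : ‖y‖ < 1) {b c d : ℤ} (hb : 0 ≤ b) (hb5 : b < 5)
    (hc : 0 ≤ c) (hc5 : c < 5) (hd : 0 ≤ d) (hd5 : d < 5) (hbc : b ≠ c) (hbd : b ≠ d) (n : ℤ) :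
    tripleCoeff y b c d n =
      prog y b n * fracSum y (prog y c) (y ^ (-n)) * fracSum y (prog y d) (y ^ (-n)) := by
  rw [tripleCoeff, prog]
  split_ifs with hn
  · rw [fracSum_prog_zpow h0 h1 hb hb5 hc hc5 hbc hn, fracSum_prog_zpow h0 h1 hb hb5 hd hd5 hbd hn,
      show (2 * b - c - d) * (n / 5) = (b - c) * (n / 5) + (b - d) * (n / 5) by ring,
      zpow_add₀ h0]
    ring
  · simp

lemma prog_ne_zero {b n : ℤ} (h : prog y b n ≠ 0) : n % 5 = b := by
  by_contra h2; exact h (if_neg h2)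

lemma appell_mul_mul (h0 : y ≠ 0) (h1 : ‖y‖ < 1) {t : ℂ} (ht : t ≠ 0)
    (hp : ∀ m : ℤ, t * y ^ m ≠ 1) {b c d : ℤ} (hb : 0 ≤ b) (hb5 : b < 5)
    (hc : 0 ≤ c) (hc5 : c < 5) (hd : 0 ≤ d) (hd5 : d < 5) (hbc : b ≠ c) (hbd : b ≠ d)
    (hcd : c ≠ d) :
    appell (y ^ 5) (t * y ^ b) * appell (y ^ 5) (t * y ^ c) * appell (y ^ 5) (t * y ^ d) =
      fracSum y (fun n => tripleCoeff y b c d n + tripleCoeff y c b d n + tripleCoeff y d b c n)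
        t := by
  have hB := summable_prog h0 h1 hb hb5
  have hC := summable_prog h0 h1 hc hc5
  have hD := summable_prog h0 h1 hd hd5
  have disj : ∀ n, prog y b n = 0 ∨ prog y c n = 0 := fun n => by
    by_contra! h
    exact hbc ((prog_ne_zero h.1).symm.trans (prog_ne_zero h.2))
  have hbcd : ∀ n, fracMul y (prog y b) (prog y c) n ≠ 0 → n % 5 ≠ d := by
    intro n hn hnd
    apply hn
    rw [fracMul, prog, prog, if_neg (by omega), if_neg (by omega)]
    ring
  rw [← fracSum_prog h0 _ hb hb5, ← fracSum_prog h0 _ hc hc5, ← fracSum_prog h0 _ hd hd5,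
    fracSum_mul_fracSum h0 h1 ht hB hC disj (fun n _ => hp n) (fun n _ => hp n),
    fracSum_mul_fracSum h0 h1 ht (summable_fracMul h0 h1 hB hC) hD _ (fun n _ => hp n)
      (fun n _ => hp n)]
  · congr 1
    funext n
    rw [tripleCoeff_eq h0 h1 hb hb5 hc hc5 hd hd5 hbc hbd,
      tripleCoeff_eq h0 h1 hc hc5 hb hb5 hd hd5 hbc.symm hcd,
      tripleCoeff_eq h0 h1 hd hd5 hb hb5 hc hc5 hbd.symm hcd.symm, fracMul, fracMul]
    by_cases hnd : prog y d n = 0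
    · rw [hnd]; ring
    have hn := prog_ne_zero hnd
    have hpole : ∀ x : ℤ, x ≠ d → ∀ m, prog y x m ≠ 0 → y ^ (-n) * y ^ m ≠ 1 := by
      intro x hx m hm
      have := prog_ne_zero hm
      rw [← zpow_add₀ h0]
      exact zpow_ne_one h1 (by rintro h; apply hx; omega)
    rw [← fracSum_mul_fracSum h0 h1 (zpow_ne_zero _ h0) hB hC disj (hpole b hbd) (hpole c hcd)]
    ring
  · intro n
    by_contra! h
    exact hbcd n h.1 (prog_ne_zero h.2)

lemma summable_tripleCoeff (h0 : y ≠ 0) (h1 : ‖y‖ < 1) {b c d : ℤ} (hb : 0 ≤ b) (hb5 : b < 5)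
    (hc : 0 ≤ c) (hc5 : c < 5) (hd : 0 ≤ d) (hd5 : d < 5) (hbc : b ≠ c) (hbd : b ≠ d) :
    Summable fun n => ‖tripleCoeff y b c d n‖ := by
  simp only [tripleCoeff_eq h0 h1 hb hb5 hc hc5 hd hd5 hbc hbd]
  obtain ⟨C, hC⟩ := exists_norm_fracSum_zpow_le h0 h1 (summable_prog h0 h1 hc hc5)
  obtain ⟨D, hD⟩ := exists_norm_fracSum_zpow_le h0 h1 (summable_prog h0 h1 hd hd5)
  exact summable_norm_mul_of_bdd
    (summable_norm_mul_of_bdd (summable_prog h0 h1 hb hb5) hC) hD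

end

section

open Filter Topology

/-! ### Appell and Kronecker sums modulo five -/

lemma kronSq_inv {Q : ℂ} (h0 : Q ≠ 0) (h1 : ‖Q‖ < 1) {t z : ℂ} (ht : t ≠ 0) (hz : ‖Q‖ < ‖z‖)
    (hz1 : ‖z‖ < 1) :
    kronSq Q t⁻¹ z = t * (kronSq Q t (Q / z) - kron Q t (Q / z)) := by
  have hz0 : 0 < ‖z‖ := (norm_nonneg _).trans_lt hz
  have hw : ‖Q‖ < ‖Q / z‖ := by
    rw [norm_div, lt_div_iff₀ hz0]; exact mul_lt_of_lt_one_right (norm_pos_iff.2 h0) hz1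
  have hw1 : ‖Q / z‖ < 1 := by rw [norm_div]; exact (div_lt_one hz0).2 hz
  have A := summable_norm_zpow_mul_frac h0 h1 hw hw1 ht
  have B := summable_norm_zpow_mul_frac_mul_frac h0 h1 hw hw1 ht ht
  simp only [mul_assoc, ← pow_two] at B
  rw [kronSq, kronSq, kron, ← Summable.tsum_sub B.of_norm A.of_norm, ← tsum_mul_left,
    ← (Equiv.neg ℤ).tsum_eq]
  refine tsum_congr fun m => ?_
  have key : t * Q ^ m * frac Q t m ^ 2 = frac Q t m ^ 2 - frac Q t m := by
    rw [frac]
    by_cases h : 1 - t * Q ^ m = 0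
    · simp [h]
    · linear_combination (-(1 - t * Q ^ m)⁻¹) * inv_mul_cancel₀ h
  rw [Equiv.neg_apply, frac_neg h0 (inv_ne_zero ht), inv_inv, div_zpow, zpow_neg]
  linear_combination (t * Q ^ m * (z ^ m)⁻¹) * key

variable {y : ℂ}

lemma norm_pow_five_lt_norm_pow (h0 : y ≠ 0) (h1 : ‖y‖ < 1) {b : ℕ} (hb : b < 5) :
    ‖y ^ 5‖ < ‖y ^ b‖ := by
  rw [norm_pow, norm_pow]
  exact pow_lt_pow_right_of_lt_one₀ (norm_pos_iff.2 h0) h1 hb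

lemma norm_pow_lt_one_of_pos (h1 : ‖y‖ < 1) {b : ℕ} (hb : 0 < b) : ‖y ^ b‖ < 1 := by
  rw [norm_pow]; exact pow_lt_one₀ (norm_nonneg _) h1 hb.ne'

lemma pow_mul_pow_five_zpow_ne_one (h0 : y ≠ 0) (h1 : ‖y‖ < 1) {b : ℕ} (hb : b % 5 ≠ 0) (m : ℤ) :
    y ^ b * (y ^ 5) ^ m ≠ 1 := by
  have e : y ^ b * (y ^ 5) ^ m = y ^ ((b : ℤ) + 5 * m) := by
    rw [zpow_add₀ h0, zpow_mul, zpow_natCast, zpow_ofNat]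
  rw [e]
  exact zpow_ne_one h1 (by omega)

lemma inv_mul_pow_five_zpow_ne_one (h0 : y ≠ 0) (h1 : ‖y‖ < 1) {b : ℕ} (hb : b % 5 ≠ 0) (m : ℤ) :
    (y ^ b)⁻¹ * (y ^ 5) ^ m ≠ 1 := by
  have e : (y ^ b)⁻¹ * (y ^ 5) ^ m = y ^ (-(b : ℤ) + 5 * m) := by
    rw [zpow_add₀ h0, zpow_mul, zpow_neg, zpow_natCast, zpow_ofNat]
  rw [e]
  exact zpow_ne_one h1 (by omega)

lemma appell_pow_add_five (h0 : y ≠ 0) (h1 : ‖y‖ < 1) {b : ℕ} (hb : b % 5 ≠ 0) :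
    appell (y ^ 5) (y ^ (b + 5)) = -y ^ b * appell (y ^ 5) (y ^ b) := by
  rw [pow_add, appell_mul (pow_ne_zero 5 h0) (norm_pow_five_lt_one h1) (pow_ne_zero _ h0)
    (pow_mul_pow_five_zpow_ne_one h0 h1 hb)]

lemma appell_pow_five_sub (h0 : y ≠ 0) (h1 : ‖y‖ < 1) {b : ℕ} (hb : b % 5 ≠ 0) {c : ℕ}
    (hbc : b + c = 5) : appell (y ^ 5) (y ^ c) = appell (y ^ 5) (y ^ b) := by
  have h := appell_mul (pow_ne_zero 5 h0) (norm_pow_five_lt_one h1)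
    (inv_ne_zero (pow_ne_zero b h0)) (inv_mul_pow_five_zpow_ne_one h0 h1 hb)
  rw [appell_inv (pow_ne_zero 5 h0) (pow_ne_zero b h0)] at h
  have hy := pow_ne_zero b h0
  have e : (y ^ b)⁻¹ * y ^ 5 = y ^ c := by rw [← hbc, pow_add]; field_simp
  rw [e] at h
  rw [h]; field_simp

lemma kron_pow_mul_appell (h0 : y ≠ 0) (h1 : ‖y‖ < 1) {b c : ℕ} (hb : b % 5 ≠ 0) (hc : 0 < c)
    (hc5 : c < 5) (hbc : (b + c) % 5 ≠ 0) :
    kron (y ^ 5) (y ^ b) (y ^ c) * appell (y ^ 5) (y ^ (b + c)) =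
      appell (y ^ 5) (y ^ b) * appell (y ^ 5) (y ^ c) := by
  rw [pow_add]
  refine kron_mul_appell (pow_ne_zero 5 h0) (norm_pow_five_lt_one h1) (pow_ne_zero _ h0)
    (pow_mul_pow_five_zpow_ne_one h0 h1 hb) (norm_pow_five_lt_norm_pow h0 h1 hc5)
    (norm_pow_lt_one_of_pos h1 hc) ?_
  rw [← pow_add]
  exact pow_mul_pow_five_zpow_ne_one h0 h1 hbc

lemma kron_pow_eq_zero (h0 : y ≠ 0) (h1 : ‖y‖ < 1) {b c : ℕ} (hc : 0 < c) (hc5 : c < 5)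
    (hbc : b + c = 5) : kron (y ^ 5) (y ^ b) (y ^ c) = 0 := by
  have h := kron_inv_self (pow_ne_zero 5 h0) (norm_pow_five_lt_one h1)
    (norm_pow_five_lt_norm_pow h0 h1 hc5) (norm_pow_lt_one_of_pos h1 hc)
  have hy := pow_ne_zero c h0
  have e : y ^ b = (y ^ c)⁻¹ * (y ^ 5) ^ (1 : ℤ) := by rw [zpow_one, ← hbc, pow_add]; field_simp
  rw [e, kron_shift (pow_ne_zero 5 h0) _ hy, h, mul_zero]

lemma kron_one_pow (h0 : y ≠ 0) {b c : ℕ} (hbc : b + c = 5) :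
    kron (y ^ 5) 1 (y ^ b) = -kron (y ^ 5) 1 (y ^ c) := by
  have h := kron_inv (pow_ne_zero 5 h0) one_ne_zero (y ^ b)
  have hy := pow_ne_zero b h0
  rw [inv_one] at h
  rw [h, show y ^ 5 / y ^ b = y ^ c by rw [← hbc, pow_add]; field_simp]
  ring

/-- The value at `t = y ^ b` of the Appell sum with base `y ^ 5`. -/
noncomputable def app (y : ℂ) (b : ℕ) : ℂ := appell (y ^ 5) (y ^ b)

/-- The value at `t = 1`, `z = y ^ b` of the Kronecker sum with base `y ^ 5`, its pole removed. -/
noncomputable def lam (y : ℂ) (b : ℕ) : ℂ := kron (y ^ 5) 1 (y ^ b)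

/-- The next Laurent coefficient at `t = 1` of the Kronecker sum with `z = y ^ b`. -/
noncomputable def eta (y : ℂ) (b : ℕ) : ℂ := kronSq (y ^ 5) 1 (y ^ b) - kron (y ^ 5) 1 (y ^ b)

lemma app_three (h0 : y ≠ 0) (h1 : ‖y‖ < 1) : app y 3 = app y 2 :=
  appell_pow_five_sub h0 h1 (by norm_num) (by norm_num)

lemma app_four (h0 : y ≠ 0) (h1 : ‖y‖ < 1) : app y 4 = app y 1 :=
  appell_pow_five_sub h0 h1 (by norm_num) (by norm_num)

lemma app_six (h0 : y ≠ 0) (h1 : ‖y‖ < 1) : app y 6 = -y * app y 1 := by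
  have h := appell_pow_add_five h0 h1 (b := 1) (by norm_num)
  rw [pow_one] at h
  simpa [app] using h

lemma lam_three (h0 : y ≠ 0) : lam y 3 = -lam y 2 := kron_one_pow h0 (by norm_num)

lemma lam_four (h0 : y ≠ 0) : lam y 4 = -lam y 1 := kron_one_pow h0 (by norm_num)

lemma eta_symm (h0 : y ≠ 0) (h1 : ‖y‖ < 1) {b c : ℕ} (hb : 0 < b) (hb5 : b < 5)
    (hbc : b + c = 5) : eta y c = eta y b + lam y b := by
  have h := kronSq_inv (pow_ne_zero 5 h0) (norm_pow_five_lt_one h1) one_ne_zero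
    (norm_pow_five_lt_norm_pow h0 h1 hb5) (norm_pow_lt_one_of_pos h1 hb)
  have hy := pow_ne_zero b h0
  rw [inv_one, show y ^ 5 / y ^ b = y ^ c by rw [← hbc, pow_add]; field_simp] at h
  have h' := kron_one_pow h0 hbc
  rw [eta, eta, lam, h, h']
  ring_nf

lemma lam_mul_lam (h0 : y ≠ 0) (h1 : ‖y‖ < 1) {b c : ℕ} (hb : 0 < b) (hc : 0 < c)
    (hbc : b + c < 5) : lam y b * lam y c = lam y (b + c) * (lam y b + lam y c) +
      (eta y (b + c) + lam y (b + c)) + eta y b + eta y c := by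
  have h := kron_one_mul_kron_one (pow_ne_zero 5 h0) (norm_pow_five_lt_one h1)
    (norm_pow_five_lt_norm_pow h0 h1 (b := b) (by omega)) (norm_pow_lt_one_of_pos h1 hb)
    (norm_pow_five_lt_norm_pow h0 h1 (b := c) (by omega)) (norm_pow_lt_one_of_pos h1 hc)
    (by rw [← pow_add]; exact norm_pow_five_lt_norm_pow h0 h1 hbc)
  rw [← pow_add] at h
  simp only [lam, eta]
  rw [h]; ring

lemma eta_one (h0 : y ≠ 0) (h1 : ‖y‖ < 1) :
    2 * eta y 1 + eta y 2 = lam y 1 ^ 2 - 2 * lam y 1 * lam y 2 - lam y 2 := by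
  have h := lam_mul_lam h0 h1 (b := 1) (c := 1) (by norm_num) (by norm_num) (by norm_num)
  norm_num at h
  linear_combination -h

lemma eta_two (h0 : y ≠ 0) (h1 : ‖y‖ < 1) :
    eta y 1 + 2 * eta y 2 = 2 * lam y 1 * lam y 2 + lam y 2 ^ 2 := by
  have h := lam_mul_lam h0 h1 (b := 1) (c := 2) (by norm_num) (by norm_num) (by norm_num)
  have h3 := eta_symm h0 h1 (b := 2) (c := 3) (by norm_num) (by norm_num) (by norm_num)
  norm_num [lam_three h0] at h h3
  linear_combination -h - h3

lemma kron_mul_kron_pow (h0 : y ≠ 0) (h1 : ‖y‖ < 1) {a b c : ℕ} (ha : a % 5 ≠ 0) (hb : 0 < b)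
    (hc : 0 < c) (hbc : b + c < 5) :
    kron (y ^ 5) (y ^ a) (y ^ b) * kron (y ^ 5) (y ^ a) (y ^ c) =
      kron (y ^ 5) (y ^ a) (y ^ (b + c)) * (lam y b + lam y c) +
        kronSq (y ^ 5) (y ^ a) (y ^ (b + c)) := by
  rw [pow_add]
  refine kron_mul_kron (pow_ne_zero 5 h0) (norm_pow_five_lt_one h1) (pow_ne_zero _ h0)
    (pow_mul_pow_five_zpow_ne_one h0 h1 ha)
    (norm_pow_five_lt_norm_pow h0 h1 (by omega)) (norm_pow_lt_one_of_pos h1 hb)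
    (norm_pow_five_lt_norm_pow h0 h1 (by omega)) (norm_pow_lt_one_of_pos h1 hc) ?_
  rw [← pow_add]
  exact norm_pow_five_lt_norm_pow h0 h1 hbc

lemma kron_one_one (h0 : y ≠ 0) (h1 : ‖y‖ < 1) (ha2 : app y 2 ≠ 0) :
    kron (y ^ 5) (y ^ 1) (y ^ 1) = app y 1 ^ 2 / app y 2 := by
  rw [eq_div_iff ha2, pow_two]
  exact kron_pow_mul_appell h0 h1 (by norm_num) (by norm_num) (by norm_num) (by norm_num)

lemma kron_one_two (h0 : y ≠ 0) (h1 : ‖y‖ < 1) (ha2 : app y 2 ≠ 0) :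
    kron (y ^ 5) (y ^ 1) (y ^ 2) = app y 1 := by
  have h := kron_pow_mul_appell h0 h1 (b := 1) (c := 2) (by norm_num) (by norm_num) (by norm_num)
    (by norm_num)
  change _ * app y 3 = app y 1 * app y 2 at h
  rw [app_three h0 h1] at h
  exact mul_right_cancel₀ ha2 h

lemma kron_one_three (h0 : y ≠ 0) (h1 : ‖y‖ < 1) (ha1 : app y 1 ≠ 0) :
    kron (y ^ 5) (y ^ 1) (y ^ 3) = app y 2 := by
  have h := kron_pow_mul_appell h0 h1 (b := 1) (c := 3) (by norm_num) (by norm_num) (by norm_num)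
    (by norm_num)
  change _ * app y 4 = app y 1 * app y 3 at h
  rw [app_three h0 h1, app_four h0 h1, mul_comm (app y 1)] at h
  exact mul_right_cancel₀ ha1 h

lemma kron_two_one (h0 : y ≠ 0) (h1 : ‖y‖ < 1) (ha2 : app y 2 ≠ 0) :
    kron (y ^ 5) (y ^ 2) (y ^ 1) = app y 1 := by
  have h := kron_pow_mul_appell h0 h1 (b := 2) (c := 1) (by norm_num) (by norm_num) (by norm_num)
    (by norm_num)
  change _ * app y 3 = app y 2 * app y 1 at h
  rw [app_three h0 h1, mul_comm (app y 2)] at h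
  exact mul_right_cancel₀ ha2 h

lemma kron_two_two (h0 : y ≠ 0) (h1 : ‖y‖ < 1) (ha1 : app y 1 ≠ 0) :
    kron (y ^ 5) (y ^ 2) (y ^ 2) = app y 2 ^ 2 / app y 1 := by
  have h := kron_pow_mul_appell h0 h1 (b := 2) (c := 2) (by norm_num) (by norm_num) (by norm_num)
    (by norm_num)
  change _ * app y 4 = app y 2 * app y 2 at h
  rw [app_four h0 h1, ← pow_two] at h
  rw [eq_div_iff ha1, h]

lemma kron_two_four (h0 : y ≠ 0) (h1 : ‖y‖ < 1) (ha1 : app y 1 ≠ 0) :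
    kron (y ^ 5) (y ^ 2) (y ^ 4) = -app y 2 / y := by
  have h := kron_pow_mul_appell h0 h1 (b := 2) (c := 4) (by norm_num) (by norm_num) (by norm_num)
    (by norm_num)
  change _ * app y 6 = app y 2 * app y 4 at h
  rw [app_four h0 h1, app_six h0 h1] at h
  rw [eq_div_iff h0]
  apply mul_right_cancel₀ ha1
  linear_combination -h

lemma lam_one_sub (h0 : y ≠ 0) (h1 : ‖y‖ < 1) (ha1 : app y 1 ≠ 0) (ha2 : app y 2 ≠ 0) :
    lam y 1 - 3 * lam y 2 = y * app y 2 ^ 3 / app y 1 ^ 2 := by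
  have hA := kron_mul_kron_pow h0 h1 (a := 2) (b := 1) (c := 3) (by norm_num) (by norm_num)
    (by norm_num) (by norm_num)
  have hB := kron_mul_kron_pow h0 h1 (a := 2) (b := 2) (c := 2) (by norm_num) (by norm_num)
    (by norm_num) (by norm_num)
  rw [kron_pow_eq_zero h0 h1 (b := 2) (c := 3) (by norm_num) (by norm_num) (by norm_num)] at hA
  norm_num only [lam_three h0, kron_two_four h0 h1 ha1, kron_two_two h0 h1 ha1] at hA hB
  have hC : app y 2 ^ 4 / app y 1 ^ 2 = app y 2 / y * (lam y 1 - 3 * lam y 2) := by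
    linear_combination hB - hA
  field_simp at hC
  rw [eq_div_iff (pow_ne_zero 2 ha1)]
  linear_combination -hC

lemma lam_one_add (h0 : y ≠ 0) (h1 : ‖y‖ < 1) (ha1 : app y 1 ≠ 0) (ha2 : app y 2 ≠ 0) :
    3 * lam y 1 + lam y 2 + 1 = app y 1 ^ 3 / app y 2 ^ 2 := by
  have hA := kron_mul_kron_pow h0 h1 (a := 1) (b := 1) (c := 2) (by norm_num) (by norm_num)
    (by norm_num) (by norm_num)
  rw [kron_one_one h0 h1 ha2, kron_one_two h0 h1 ha2] at hA
  norm_num only [kron_one_three h0 h1 ha1] at hA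
  have hB := kron_mul_kron (pow_ne_zero 5 h0) (norm_pow_five_lt_one h1)
    (inv_ne_zero (pow_ne_zero 1 h0)) (inv_mul_pow_five_zpow_ne_one h0 h1 (by norm_num))
    (norm_pow_five_lt_norm_pow h0 h1 (b := 1) (by norm_num))
    (norm_pow_lt_one_of_pos h1 zero_lt_one)
    (norm_pow_five_lt_norm_pow h0 h1 (b := 1) (by norm_num))
    (norm_pow_lt_one_of_pos h1 zero_lt_one)
    (by rw [← pow_add]; exact norm_pow_five_lt_norm_pow h0 h1 (by norm_num))
  have e : y ^ 5 / (y ^ 1 * y ^ 1) = y ^ 3 := by field_simp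
  rw [kron_inv_self (pow_ne_zero 5 h0) (norm_pow_five_lt_one h1)
    (norm_pow_five_lt_norm_pow h0 h1 (b := 1) (by norm_num))
    (norm_pow_lt_one_of_pos h1 zero_lt_one), kron_inv (pow_ne_zero 5 h0) (pow_ne_zero 1 h0),
    kronSq_inv (pow_ne_zero 5 h0) (norm_pow_five_lt_one h1) (pow_ne_zero 1 h0)
    (by rw [← pow_add]; exact norm_pow_five_lt_norm_pow h0 h1 (by norm_num))
    (by rw [← pow_add]; exact norm_pow_lt_one_of_pos h1 (by norm_num)), e,
    kron_one_three h0 h1 ha1] at hB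
  change _ = _ * (lam y 1 + lam y 1) + _ at hB
  have hB' : 2 * lam y 1 * app y 2 + app y 2 = kronSq (y ^ 5) (y ^ 1) (y ^ 3) := by
    apply mul_left_cancel₀ h0
    linear_combination hB
  have hC : app y 1 ^ 3 / app y 2 = app y 2 * (3 * lam y 1 + lam y 2 + 1) := by
    linear_combination hA - hB'
  rw [eq_div_iff (pow_ne_zero 2 ha2)]
  rw [div_eq_iff ha2] at hC
  linear_combination -hC

end

section

open Filter Topology

/-! ### Behaviour at the pole -/

/-- The second order remainder at `s = 0` of `∑ c m / (1 - (1 - s) Q ^ m)`. -/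
noncomputable def fracTail (Q : ℂ) (c : ℤ → ℂ) (s : ℂ) : ℂ :=
  ∑' m : ℤ, c m * frac Q 1 m * (Q ^ m * frac Q (1 - s) m)

lemma norm_one_sub_mul_zpow_ge {Q s : ℂ} (h0 : Q ≠ 0) (h1 : ‖Q‖ < 1)
    (hs : ‖s‖ ≤ (1 - ‖Q‖) / 2) {m : ℤ} (hm : m ≠ 0) :
    (1 - ‖Q‖) / 2 * ‖Q ^ m‖ ≤ ‖1 - (1 - s) * Q ^ m‖ := by
  have hQ : 0 < ‖Q‖ := norm_pos_iff.2 h0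
  have hup : ‖1 - s‖ ≤ 1 + ‖s‖ := by simpa using norm_sub_le (1 : ℂ) s
  have hlo : 1 - ‖s‖ ≤ ‖1 - s‖ := by simpa using norm_sub_norm_le (1 : ℂ) s
  rcases lt_or_gt_of_ne hm with hm | hm
  · have hx : ‖Q ^ (-m)‖ ≤ ‖Q‖ := by
      rw [norm_zpow]
      simpa using zpow_le_zpow_right_of_le_one₀ hQ h1.le (show (1 : ℤ) ≤ -m by omega)
    have h2 : ‖1 - s‖ - ‖Q ^ (-m)‖ ≤ ‖(1 - s) - Q ^ (-m)‖ := norm_sub_norm_le _ _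
    have e : 1 - (1 - s) * Q ^ m = -((1 - s) - Q ^ (-m)) * Q ^ m := by
      rw [zpow_neg]
      linear_combination -inv_mul_cancel₀ (zpow_ne_zero m h0)
    rw [e, norm_mul, norm_neg]
    gcongr
    linarith
  · have hx : ‖Q ^ m‖ ≤ ‖Q‖ := by
      rw [norm_zpow]
      simpa using zpow_le_zpow_right_of_le_one₀ hQ h1.le (show (1 : ℤ) ≤ m by omega)
    have h2 : 1 - ‖(1 - s) * Q ^ m‖ ≤ ‖1 - (1 - s) * Q ^ m‖ := by
      simpa using norm_sub_norm_le (1 : ℂ) ((1 - s) * Q ^ m)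
    rw [norm_mul] at h2
    have h3 : ‖1 - s‖ * ‖Q ^ m‖ ≤ (1 + ‖s‖) * ‖Q‖ := by gcongr
    nlinarith [norm_nonneg s, norm_nonneg (Q ^ m)]

lemma norm_zpow_mul_frac_le {Q s : ℂ} (h0 : Q ≠ 0) (h1 : ‖Q‖ < 1)
    (hs : ‖s‖ ≤ (1 - ‖Q‖) / 2) {m : ℤ} (hm : m ≠ 0) :
    ‖Q ^ m * frac Q (1 - s) m‖ ≤ 2 / (1 - ‖Q‖) := by
  have h := norm_one_sub_mul_zpow_ge h0 h1 hs hm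
  have hp : 0 < ‖Q ^ m‖ := norm_pos_iff.2 (zpow_ne_zero m h0)
  have hq : 0 < 1 - ‖Q‖ := by linarith
  rw [frac, norm_mul, norm_inv, ← div_eq_mul_inv, div_le_div_iff₀ (by nlinarith) hq]
  linarith

lemma one_sub_mul_zpow_ne_one {Q s : ℂ} (h0 : Q ≠ 0) (h1 : ‖Q‖ < 1)
    (hs : ‖s‖ ≤ (1 - ‖Q‖) / 2) (hs0 : s ≠ 0) (m : ℤ) : (1 - s) * Q ^ m ≠ 1 := by
  intro he
  rcases eq_or_ne m 0 with rfl | hm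
  · simp [hs0] at he
  · have h := norm_one_sub_mul_zpow_ge h0 h1 hs hm
    rw [he, sub_self, norm_zero] at h
    have hp : 0 < ‖Q ^ m‖ := norm_pos_iff.2 (zpow_ne_zero m h0)
    nlinarith

lemma norm_fracTail_term_le {Q s : ℂ} (h0 : Q ≠ 0) (h1 : ‖Q‖ < 1)
    (hs : ‖s‖ ≤ (1 - ‖Q‖) / 2) (c : ℤ → ℂ) (m : ℤ) :
    ‖c m * frac Q 1 m * (Q ^ m * frac Q (1 - s) m)‖ ≤ ‖c m * frac Q 1 m‖ * (2 / (1 - ‖Q‖)) := by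
  rcases eq_or_ne m 0 with rfl | hm
  · simp [frac_one_zero]
  · rw [norm_mul]
    gcongr
    exact norm_zpow_mul_frac_le h0 h1 hs hm

lemma tendsto_fracTail {Q : ℂ} (h0 : Q ≠ 0) (h1 : ‖Q‖ < 1) {c : ℤ → ℂ}
    (hc : Summable fun m => ‖c m * frac Q 1 m‖) :
    Tendsto (fracTail Q c) (𝓝[≠] 0) (𝓝 (fracTail Q c 0)) := by
  have hev : ∀ᶠ s : ℂ in 𝓝[≠] 0, ‖s‖ ≤ (1 - ‖Q‖) / 2 := by
    filter_upwards [nhdsWithin_le_nhds (Metric.closedBall_mem_nhds (0 : ℂ)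
      (show 0 < (1 - ‖Q‖) / 2 by linarith))] with s hs
    simpa using hs
  refine tendsto_tsum_of_dominated_convergence (hc.mul_right (2 / (1 - ‖Q‖))) (fun m => ?_)
    (hev.mono fun s hs m => norm_fracTail_term_le h0 h1 hs c m)
  rcases eq_or_ne m 0 with rfl | hm
  · simp [frac_one_zero]
  · refine (Tendsto.mono_left ?_ nhdsWithin_le_nhds)
    have hne : 1 - (1 - (0 : ℂ)) * Q ^ m ≠ 0 := by
      simpa [sub_eq_zero] using (zpow_ne_one h1 hm).symm
    have : ContinuousAt (fun s : ℂ => c m * frac Q 1 m * (Q ^ m * (1 - (1 - s) * Q ^ m)⁻¹)) 0 := by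
      fun_prop (disch := exact hne)
    exact this

lemma tsum_mul_frac_one_sub {Q s : ℂ} (h0 : Q ≠ 0) (h1 : ‖Q‖ < 1)
    (hs : ‖s‖ ≤ (1 - ‖Q‖) / 2) (hs0 : s ≠ 0) {c : ℤ → ℂ}
    (hc : Summable fun m => ‖c m * frac Q 1 m‖) :
    ∑' m, c m * frac Q (1 - s) m = c 0 / s + ∑' m, c m * frac Q 1 m - s * fracTail Q c s := by
  have hT : Summable fun m => c m * frac Q 1 m * (Q ^ m * frac Q (1 - s) m) :=
    ((hc.mul_right (2 / (1 - ‖Q‖))).of_nonneg_of_le (fun _ => norm_nonneg _)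
      (norm_fracTail_term_le h0 h1 hs c)).of_norm
  have h := ((hasSum_ite_eq (0 : ℤ) (c 0 / s)).add hc.of_norm.hasSum).sub (hT.hasSum.mul_left s)
  rw [fracTail, ← h.tsum_eq]
  refine tsum_congr fun m => ?_
  rcases eq_or_ne m 0 with rfl | hm
  · simp [frac, div_eq_mul_inv]
  · have e1 : 1 - 1 * Q ^ m ≠ 0 := by
      simpa [sub_eq_zero] using (zpow_ne_one h1 hm).symm
    have e2 : 1 - (1 - s) * Q ^ m ≠ 0 := sub_ne_zero.2 (one_sub_mul_zpow_ne_one h0 h1 hs hs0 m).symm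
    have i1 := inv_mul_cancel₀ e1
    have i2 := inv_mul_cancel₀ e2
    rw [if_neg hm, frac, frac]
    linear_combination (-c m * (1 - (1 - s) * Q ^ m)⁻¹) * i1 + c m * (1 - 1 * Q ^ m)⁻¹ * i2

lemma fracTail_zero_zpow {Q z : ℂ} (h0 : Q ≠ 0) (h1 : ‖Q‖ < 1) (hz : ‖Q‖ < ‖z‖) (hz1 : ‖z‖ < 1) :
    fracTail Q (fun m => z ^ m) 0 = kronSq Q 1 z - kron Q 1 z := by
  have A := summable_norm_zpow_mul_frac h0 h1 hz hz1 one_ne_zero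
  have B := summable_norm_zpow_mul_frac_mul_frac h0 h1 hz hz1 one_ne_zero one_ne_zero
  simp only [mul_assoc, ← pow_two] at B
  rw [kronSq, kron, ← Summable.tsum_sub B.of_norm A.of_norm, fracTail]
  refine tsum_congr fun m => ?_
  have key : Q ^ m * frac Q 1 m ^ 2 = frac Q 1 m ^ 2 - frac Q 1 m := by
    rw [frac]
    by_cases h : 1 - 1 * Q ^ m = 0
    · rw [h]; simp
    · linear_combination (-(1 - 1 * Q ^ m)⁻¹) * inv_mul_cancel₀ h
  rw [sub_zero]
  linear_combination z ^ m * key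

lemma tsum_triCoeff_mul_frac_one {Q : ℂ} (h0 : Q ≠ 0) :
    ∑' m, triCoeff Q m * frac Q 1 m = 0 := by
  have h : ∑' m, triCoeff Q m * frac Q 1 m = -∑' m, triCoeff Q m * frac Q 1 m := by
    rw [← tsum_neg]
    nth_rewrite 1 [← (Equiv.neg ℤ).tsum_eq]
    refine tsum_congr fun m => ?_
    have hm := zpow_ne_zero m h0
    rw [Equiv.neg_apply, triCoeff_neg h0, frac_neg h0 one_ne_zero, inv_one, zpow_neg]
    linear_combination (-triCoeff Q m * frac Q 1 m) * inv_mul_cancel₀ hm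
  linear_combination h / 2

/-- Comparison of the first two Taylor coefficients at `s = 0` in
`s Ψ κ₁ κ₂ κ₃ κ₄ = α³ (d s κ₄ + b κ₁ κ₃ - a κ₂ κ₃ - e κ₁ κ₄)`. -/
lemma taylor_comparison {ψ : ℂ} {l₁ l₂ η₁ η₂ η₃ η₄ ψ' d a e : ℂ} {T S t₁ t₂ t₃ t₄ : ℂ → ℂ}
    (hT : Tendsto T (𝓝[≠] 0) (𝓝 ψ')) {σ₀ : ℂ} (hS : Tendsto S (𝓝[≠] 0) (𝓝 σ₀))
    (h₁ : Tendsto t₁ (𝓝[≠] 0) (𝓝 η₁)) (h₂ : Tendsto t₂ (𝓝[≠] 0) (𝓝 η₂))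
    (h₃ : Tendsto t₃ (𝓝[≠] 0) (𝓝 η₃)) (h₄ : Tendsto t₄ (𝓝[≠] 0) (𝓝 η₄))
    (H : ∀ᶠ s in 𝓝[≠] (0 : ℂ), ∀ κ₁ κ₂ κ₃ κ₄ α : ℂ, κ₁ = 1 + s * l₁ - s ^ 2 * t₁ s →
      κ₂ = 1 + s * l₂ - s ^ 2 * t₂ s → κ₃ = 1 + s * -l₂ - s ^ 2 * t₃ s →
      κ₄ = 1 + s * -l₁ - s ^ 2 * t₄ s → α = 1 - s ^ 2 * S s →
      s * (ψ - s * T s) * κ₁ * κ₂ * κ₃ * κ₄ =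
        α ^ 3 * (d * s * κ₄ + (a + e) * κ₁ * κ₃ - a * κ₂ * κ₃ - e * κ₁ * κ₄)) :
    ψ = d + (a + e) * (l₁ - l₂) ∧
      -ψ' = -d * l₁ + (a + e) * (-η₁ - η₃ - l₁ * l₂) + a * (η₂ + η₃ + l₂ ^ 2) +
        e * (η₁ + η₄ + l₁ ^ 2) := by
  have hid : Tendsto (fun s : ℂ => s) (𝓝[≠] 0) (𝓝 0) := nhdsWithin_le_nhds
  have hs0 : ∀ᶠ s : ℂ in 𝓝[≠] 0, s ≠ 0 := eventually_mem_nhdsWithin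
  have hprod := hid.prodMk_nhds (hT.prodMk_nhds (hS.prodMk_nhds (h₁.prodMk_nhds (h₂.prodMk_nhds
    (h₃.prodMk_nhds h₄)))))
  have lim : ∀ F : ℂ × ℂ × ℂ × ℂ × ℂ × ℂ × ℂ → ℂ, Continuous F →
      (∀ᶠ s in 𝓝[≠] (0 : ℂ), F (s, T s, S s, t₁ s, t₂ s, t₃ s, t₄ s) = 0) →
      F (0, ψ', σ₀, η₁, η₂, η₃, η₄) = 0 := by
    intro F hF hev
    have hlim := (hF.tendsto (0, ψ', σ₀, η₁, η₂, η₃, η₄)).comp hprod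
    exact tendsto_nhds_unique hlim (tendsto_const_nhds.congr' (hev.mono fun s hs => hs.symm))
  have A : ψ = d + (a + e) * (l₁ - l₂) := by
    have := lim (fun p => (ψ - p.1 * p.2.1) * (1 + p.1 * (l₁ - p.1 * p.2.2.2.1)) *
        (1 + p.1 * (l₂ - p.1 * p.2.2.2.2.1)) * (1 + p.1 * (-l₂ - p.1 * p.2.2.2.2.2.1)) *
        (1 + p.1 * (-l₁ - p.1 * p.2.2.2.2.2.2)) - (1 - p.1 ^ 2 * p.2.2.1) ^ 3 *
        (d * (1 + p.1 * (-l₁ - p.1 * p.2.2.2.2.2.2)) +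
        (a + e) * ((l₁ - p.1 * p.2.2.2.1) + (-l₂ - p.1 * p.2.2.2.2.2.1) +
          p.1 * (l₁ - p.1 * p.2.2.2.1) * (-l₂ - p.1 * p.2.2.2.2.2.1)) -
        a * ((l₂ - p.1 * p.2.2.2.2.1) + (-l₂ - p.1 * p.2.2.2.2.2.1) +
          p.1 * (l₂ - p.1 * p.2.2.2.2.1) * (-l₂ - p.1 * p.2.2.2.2.2.1)) -
        e * ((l₁ - p.1 * p.2.2.2.1) + (-l₁ - p.1 * p.2.2.2.2.2.2) +
          p.1 * (l₁ - p.1 * p.2.2.2.1) * (-l₁ - p.1 * p.2.2.2.2.2.2))))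
      (by fun_prop) (by
        filter_upwards [H, hs0] with s hs hs0
        have h := hs _ _ _ _ _ rfl rfl rfl rfl rfl
        apply mul_left_cancel₀ hs0
        linear_combination h)
    linear_combination this
  refine ⟨A, ?_⟩
  have := lim (fun p => ψ * (
      (1 + p.1 * (l₂ - p.1 * p.2.2.2.2.1)) * (1 + p.1 * (-l₂ - p.1 * p.2.2.2.2.2.1)) *
        (1 + p.1 * (-l₁ - p.1 * p.2.2.2.2.2.2)) * (l₁ - p.1 * p.2.2.2.1) +
      (1 + p.1 * (-l₂ - p.1 * p.2.2.2.2.2.1)) * (1 + p.1 * (-l₁ - p.1 * p.2.2.2.2.2.2)) *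
        (l₂ - p.1 * p.2.2.2.2.1) +
      (1 + p.1 * (-l₁ - p.1 * p.2.2.2.2.2.2)) * (-l₂ - p.1 * p.2.2.2.2.2.1) +
      (-l₁ - p.1 * p.2.2.2.2.2.2)) -
      p.2.1 * (1 + p.1 * (l₁ - p.1 * p.2.2.2.1)) *
        (1 + p.1 * (l₂ - p.1 * p.2.2.2.2.1)) * (1 + p.1 * (-l₂ - p.1 * p.2.2.2.2.2.1)) *
        (1 + p.1 * (-l₁ - p.1 * p.2.2.2.2.2.2)) -
      (-(p.1 * p.2.2.1) * (3 - 3 * p.1 ^ 2 * p.2.2.1 + (p.1 ^ 2 * p.2.2.1) ^ 2)) *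
        (d * (1 + p.1 * (-l₁ - p.1 * p.2.2.2.2.2.2)) +
        (a + e) * ((l₁ - p.1 * p.2.2.2.1) + (-l₂ - p.1 * p.2.2.2.2.2.1) +
          p.1 * (l₁ - p.1 * p.2.2.2.1) * (-l₂ - p.1 * p.2.2.2.2.2.1)) -
        a * ((l₂ - p.1 * p.2.2.2.2.1) + (-l₂ - p.1 * p.2.2.2.2.2.1) +
          p.1 * (l₂ - p.1 * p.2.2.2.2.1) * (-l₂ - p.1 * p.2.2.2.2.2.1)) -
        e * ((l₁ - p.1 * p.2.2.2.1) + (-l₁ - p.1 * p.2.2.2.2.2.2) +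
          p.1 * (l₁ - p.1 * p.2.2.2.1) * (-l₁ - p.1 * p.2.2.2.2.2.2))) -
      (d * (-l₁ - p.1 * p.2.2.2.2.2.2) +
        (a + e) * (-p.2.2.2.1 - p.2.2.2.2.2.1 +
          (l₁ - p.1 * p.2.2.2.1) * (-l₂ - p.1 * p.2.2.2.2.2.1)) -
        a * (-p.2.2.2.2.1 - p.2.2.2.2.2.1 +
          (l₂ - p.1 * p.2.2.2.2.1) * (-l₂ - p.1 * p.2.2.2.2.2.1)) -
        e * (-p.2.2.2.1 - p.2.2.2.2.2.2 +
          (l₁ - p.1 * p.2.2.2.1) * (-l₁ - p.1 * p.2.2.2.2.2.2))))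
    (by fun_prop) (by
      filter_upwards [H, hs0] with s hs hs0
      have h := hs _ _ _ _ _ rfl rfl rfl rfl rfl
      apply mul_left_cancel₀ (pow_ne_zero 2 hs0)
      linear_combination h - s * A)
  linear_combination this

end

section

open Filter Topology

/-! ### Triple products of Appell sums -/

variable {y : ℂ}

/-- The residue sequence of the product of three shifted Appell sums. -/
noncomputable def tripleSum (y : ℂ) (b c d n : ℤ) : ℂ :=
  tripleCoeff y b c d n + tripleCoeff y c b d n + tripleCoeff y d b c n

/-- The residue sequence of
`α₀ A₁ A₂ A₃ + A₀ (β₀ A₂ A₄ - α₁ A₁ A₄ - β₁ A₂ A₃)`. -/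
noncomputable def combCoeff (y α₀ β₀ α₁ β₁ : ℂ) (n : ℤ) : ℂ :=
  α₀ * tripleSum y 1 2 3 n + β₀ * tripleSum y 0 2 4 n - α₁ * tripleSum y 0 1 4 n -
    β₁ * tripleSum y 0 2 3 n

lemma summable_tripleSum (h0 : y ≠ 0) (h1 : ‖y‖ < 1) {b c d : ℤ} (hb : 0 ≤ b) (hb5 : b < 5)
    (hc : 0 ≤ c) (hc5 : c < 5) (hd : 0 ≤ d) (hd5 : d < 5) (hbc : b ≠ c) (hbd : b ≠ d)
    (hcd : c ≠ d) : Summable fun n => ‖tripleSum y b c d n‖ := by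
  have A := summable_tripleCoeff h0 h1 hb hb5 hc hc5 hd hd5 hbc hbd
  have B := summable_tripleCoeff h0 h1 hc hc5 hb hb5 hd hd5 hbc.symm hcd
  have C := summable_tripleCoeff h0 h1 hd hd5 hb hb5 hc hc5 hbd.symm hcd.symm
  exact (((A.add B).add C).of_nonneg_of_le (fun _ => norm_nonneg _) fun n =>
    (norm_add_le _ _).trans (add_le_add_left (norm_add_le _ _) _))

lemma summable_combCoeff (h0 : y ≠ 0) (h1 : ‖y‖ < 1) (α₀ β₀ α₁ β₁ : ℂ) :
    Summable fun n => ‖combCoeff y α₀ β₀ α₁ β₁ n‖ := by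
  have A := summable_tripleSum h0 h1 (b := 1) (c := 2) (d := 3) (by norm_num) (by norm_num)
    (by norm_num) (by norm_num) (by norm_num) (by norm_num) (by norm_num) (by norm_num)
    (by norm_num)
  have B := summable_tripleSum h0 h1 (b := 0) (c := 2) (d := 4) (by norm_num) (by norm_num)
    (by norm_num) (by norm_num) (by norm_num) (by norm_num) (by norm_num) (by norm_num)
    (by norm_num)
  have C := summable_tripleSum h0 h1 (b := 0) (c := 1) (d := 4) (by norm_num) (by norm_num)
    (by norm_num) (by norm_num) (by norm_num) (by norm_num) (by norm_num) (by norm_num)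
    (by norm_num)
  have D := summable_tripleSum h0 h1 (b := 0) (c := 2) (d := 3) (by norm_num) (by norm_num)
    (by norm_num) (by norm_num) (by norm_num) (by norm_num) (by norm_num) (by norm_num)
    (by norm_num)
  refine ((((A.mul_left ‖α₀‖).add (B.mul_left ‖β₀‖)).add (C.mul_left ‖α₁‖)).add
    (D.mul_left ‖β₁‖)).of_nonneg_of_le (fun _ => norm_nonneg _) fun n => ?_
  simp only [← norm_mul, combCoeff]
  exact (norm_sub_le _ _).trans (add_le_add_left ((norm_sub_le _ _).trans
    (add_le_add_left (norm_add_le _ _) _)) _)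

lemma combCoeff_zero (h0 : y ≠ 0) (h1 : ‖y‖ < 1) {α₀ β₀ α₁ β₁ : ℂ}
    (hβ : β₀ * (app y 1 * app y 2) = α₁ * app y 1 ^ 2 + β₁ * app y 2 ^ 2) :
    combCoeff y α₀ β₀ α₁ β₁ 0 = 0 := by
  have h3 : appell (y ^ 5) (y ^ 3) = appell (y ^ 5) (y ^ 2) := app_three h0 h1
  have h4 : appell (y ^ 5) (y ^ 4) = appell (y ^ 5) (y ^ 1) := app_four h0 h1
  simp [app] at hβ h4
  simp [combCoeff, tripleSum, tripleCoeff, triCoeff, tri_zero, zpow_ofNat, h3, h4]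
  linear_combination hβ

lemma fracSum_combCoeff (h0 : y ≠ 0) (h1 : ‖y‖ < 1) {t : ℂ} (ht : t ≠ 0)
    (hp : ∀ m : ℤ, t * y ^ m ≠ 1) (α₀ β₀ α₁ β₁ : ℂ) :
    fracSum y (combCoeff y α₀ β₀ α₁ β₁) t =
      α₀ * (appell (y ^ 5) (t * y ^ (1 : ℤ)) * appell (y ^ 5) (t * y ^ (2 : ℤ)) *
        appell (y ^ 5) (t * y ^ (3 : ℤ))) +
      β₀ * (appell (y ^ 5) (t * y ^ (0 : ℤ)) * appell (y ^ 5) (t * y ^ (2 : ℤ)) *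
        appell (y ^ 5) (t * y ^ (4 : ℤ))) -
      α₁ * (appell (y ^ 5) (t * y ^ (0 : ℤ)) * appell (y ^ 5) (t * y ^ (1 : ℤ)) *
        appell (y ^ 5) (t * y ^ (4 : ℤ))) -
      β₁ * (appell (y ^ 5) (t * y ^ (0 : ℤ)) * appell (y ^ 5) (t * y ^ (2 : ℤ)) *
        appell (y ^ 5) (t * y ^ (3 : ℤ))) := by
  have S : ∀ {b c d : ℤ}, 0 ≤ b → b < c → c < d → d < 5 →
      HasSum (fun n => tripleSum y b c d n * frac y t n) (appell (y ^ 5) (t * y ^ b) *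
        appell (y ^ 5) (t * y ^ c) * appell (y ^ 5) (t * y ^ d)) := by
    intro b c d hb hbc hcd hd
    rw [appell_mul_mul h0 h1 ht hp hb (by omega) (by omega) (by omega) (by omega) hd
      (by omega) (by omega) (by omega)]
    exact (summable_mul_frac h0 h1 ht (summable_tripleSum h0 h1 hb (by omega) (by omega) (by omega)
      (by omega) hd (by omega) (by omega) (by omega))).of_norm.hasSum
  have A := (S (b := 1) (c := 2) (d := 3) (by norm_num) (by norm_num) (by norm_num)
    (by norm_num)).mul_left α₀
  have B := (S (b := 0) (c := 2) (d := 4) (by norm_num) (by norm_num) (by norm_num)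
    (by norm_num)).mul_left β₀
  have C := (S (b := 0) (c := 1) (d := 4) (by norm_num) (by norm_num) (by norm_num)
    (by norm_num)).mul_left α₁
  have D := (S (b := 0) (c := 2) (d := 3) (by norm_num) (by norm_num) (by norm_num)
    (by norm_num)).mul_left β₁
  rw [← (((A.add B).sub C).sub D).tsum_eq, fracSum]
  refine tsum_congr fun n => ?_
  rw [combCoeff]
  ring

lemma mul_kron_one_sub (h0 : y ≠ 0) (h1 : ‖y‖ < 1) {s : ℂ}
    (hs : ‖s‖ ≤ (1 - ‖y ^ 5‖) / 2) (hs0 : s ≠ 0) {b : ℕ} (hb : 0 < b) (hb5 : b < 5) :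
    s * kron (y ^ 5) (1 - s) (y ^ b) =
      1 + s * lam y b - s ^ 2 * fracTail (y ^ 5) (fun m => (y ^ b) ^ m) s := by
  have hQ := pow_ne_zero 5 h0
  have hQ1 := norm_pow_five_lt_one h1
  rw [kron, tsum_mul_frac_one_sub hQ hQ1 hs hs0 (summable_norm_zpow_mul_frac hQ hQ1
    (norm_pow_five_lt_norm_pow h0 h1 hb5) (norm_pow_lt_one_of_pos h1 hb) one_ne_zero), zpow_zero]
  change s * (1 / s + lam y b - _) = _
  field_simp

lemma combCoeff_values (h0 : y ≠ 0) (h1 : ‖y‖ < 1) {α₀ β₀ α₁ β₁ : ℂ}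
    (hβ : β₀ * (app y 1 * app y 2) = α₁ * app y 1 ^ 2 + β₁ * app y 2 ^ 2) :
    (∑' n, combCoeff y α₀ β₀ α₁ β₁ n * frac y 1 n =
      α₀ * (app y 1 * app y 2 ^ 2) +
        (α₁ * app y 1 ^ 2 + β₁ * app y 2 ^ 2) * (lam y 1 - lam y 2)) ∧
    -∑' n, combCoeff y α₀ β₀ α₁ β₁ n * (y ^ n * frac y 1 n ^ 2) =
      -(α₀ * (app y 1 * app y 2 ^ 2)) * lam y 1 +
        (α₁ * app y 1 ^ 2 + β₁ * app y 2 ^ 2) * (-eta y 1 - eta y 3 - lam y 1 * lam y 2) +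
        α₁ * app y 1 ^ 2 * (eta y 2 + eta y 3 + lam y 2 ^ 2) +
        β₁ * app y 2 ^ 2 * (eta y 1 + eta y 4 + lam y 1 ^ 2) := by
  have hQ := pow_ne_zero 5 h0
  have hQ1 := norm_pow_five_lt_one h1
  have hρ := summable_combCoeff h0 h1 α₀ β₀ α₁ β₁
  have hρ1 := summable_mul_frac h0 h1 one_ne_zero hρ
  have hk : ∀ b : ℕ, 0 < b → b < 5 → Tendsto (fracTail (y ^ 5) fun m => (y ^ b) ^ m)
      (𝓝[≠] 0) (𝓝 (eta y b)) := by
    intro b hb hb5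
    have hz := norm_pow_five_lt_norm_pow h0 h1 hb5
    have hz1 := norm_pow_lt_one_of_pos h1 hb
    rw [eta, ← fracTail_zero_zpow hQ hQ1 hz hz1]
    exact tendsto_fracTail hQ hQ1 (summable_norm_zpow_mul_frac hQ hQ1 hz hz1 one_ne_zero)
  have hA := summable_triCoeff_mul_frac hQ hQ1 one_ne_zero
  have hψ : ∑' n, combCoeff y α₀ β₀ α₁ β₁ n * (y ^ n * frac y 1 n ^ 2) =
      fracTail y (combCoeff y α₀ β₀ α₁ β₁) 0 := by
    rw [fracTail, sub_zero]
    exact tsum_congr fun n => by ring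
  rw [hψ]
  refine taylor_comparison (tendsto_fracTail h0 h1 hρ1) (tendsto_fracTail hQ hQ1 hA)
    (hk 1 (by norm_num) (by norm_num)) (hk 2 (by norm_num) (by norm_num))
    (hk 3 (by norm_num) (by norm_num)) (hk 4 (by norm_num) (by norm_num)) ?_
  filter_upwards [nhdsWithin_le_nhds (Metric.closedBall_mem_nhds (0 : ℂ)
    (show 0 < (1 - ‖y‖) / 2 by linarith)), eventually_mem_nhdsWithin] with s hs hs0
  replace hs : ‖s‖ ≤ (1 - ‖y‖) / 2 := by simpa using hs
  have hyQ : ‖y ^ 5‖ ≤ ‖y‖ := by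
    rw [norm_pow]; exact pow_le_of_le_one (norm_nonneg _) h1.le (by norm_num)
  have hsQ : ‖s‖ ≤ (1 - ‖y ^ 5‖) / 2 := by linarith
  have hp := one_sub_mul_zpow_ne_one h0 h1 hs hs0
  have hpQ := one_sub_mul_zpow_ne_one hQ hQ1 hsQ hs0
  have ht : (1 - s : ℂ) ≠ 0 := by
    intro h
    have : ‖s‖ = 1 := by rw [← sub_eq_zero.1 h, norm_one]
    have := norm_nonneg y
    linarith
  intro κ₁ κ₂ κ₃ κ₄ α e₁ e₂ e₃ e₄ eα
  have hK : ∀ b : ℕ, 0 < b → b < 5 → (s * kron (y ^ 5) (1 - s) (y ^ b)) *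
      appell (y ^ 5) ((1 - s) * y ^ (b : ℤ)) = (s * appell (y ^ 5) (1 - s)) * app y b := by
    intro b hb hb5
    rw [zpow_natCast, mul_assoc, kron_mul_appell hQ hQ1 ht hpQ (norm_pow_five_lt_norm_pow h0 h1 hb5)
      (norm_pow_lt_one_of_pos h1 hb), mul_assoc, app]
    intro m he
    refine hp (b + 5 * m) (Eq.trans ?_ he)
    rw [zpow_add₀ h0, zpow_mul, zpow_natCast, zpow_ofNat, mul_assoc (1 - s)]
  have K1 := hK 1 (by norm_num) (by norm_num)
  have K2 := hK 2 (by norm_num) (by norm_num)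
  have K3 := hK 3 (by norm_num) (by norm_num)
  have K4 := hK 4 (by norm_num) (by norm_num)
  rw [mul_kron_one_sub h0 h1 hsQ hs0 (by norm_num) (by norm_num)] at K1 K2 K3 K4
  rw [← e₁] at K1
  rw [← e₂] at K2
  rw [lam_three h0, ← e₃, app_three h0 h1] at K3
  rw [lam_four h0, ← e₄, app_four h0 h1] at K4
  have hα : s * appell (y ^ 5) (1 - s) = α := by
    rw [eα, appell, tsum_mul_frac_one_sub hQ hQ1 hsQ hs0 hA, tsum_triCoeff_mul_frac_one hQ]
    simp only [triCoeff, tri_zero, zpow_zero, mul_one, add_zero]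
    have hs0' : s ≠ 0 := hs0
    field_simp
  have hΨ := fracSum_combCoeff h0 h1 ht hp α₀ β₀ α₁ β₁
  rw [fracSum, tsum_mul_frac_one_sub h0 h1 hs hs0 hρ1, combCoeff_zero h0 h1 hβ, zero_div,
    zero_add] at hΨ
  rw [hΨ]
  rw [hα] at K1 K2 K3 K4
  simp only [Nat.cast_one, Nat.cast_ofNat] at K1 K2 K3 K4
  rw [zpow_zero, mul_one]
  generalize appell (y ^ 5) ((1 - s) * y ^ (1 : ℤ)) = A1 at *
  generalize appell (y ^ 5) ((1 - s) * y ^ (2 : ℤ)) = A2 at *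
  generalize appell (y ^ 5) ((1 - s) * y ^ (3 : ℤ)) = A3 at *
  generalize appell (y ^ 5) ((1 - s) * y ^ (4 : ℤ)) = A4 at *
  generalize appell (y ^ 5) (1 - s) = A0 at *
  rw [← hβ]
  have hs123 : (κ₁ * A1) * (κ₂ * A2) * (κ₃ * A3) =
      (α * app y 1) * (α * app y 2) * (α * app y 2) := by rw [K1, K2, K3]
  have hs24 : (κ₂ * A2) * (κ₄ * A4) = (α * app y 2) * (α * app y 1) := by rw [K2, K4]
  have hs14 : (κ₁ * A1) * (κ₄ * A4) = (α * app y 1) * (α * app y 1) := by rw [K1, K4]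
  have hs23 : (κ₂ * A2) * (κ₃ * A3) = (α * app y 2) * (α * app y 2) := by rw [K2, K3]
  linear_combination s * α₀ * κ₄ * hs123 + β₀ * κ₁ * κ₃ * s * A0 * hs24 -
    α₁ * κ₂ * κ₃ * s * A0 * hs14 - β₁ * κ₁ * κ₄ * s * A0 * hs23 +
    α ^ 2 * (β₀ * κ₁ * κ₃ * app y 1 * app y 2 - α₁ * κ₂ * κ₃ * app y 1 ^ 2 -
      β₁ * κ₁ * κ₄ * app y 2 ^ 2) * hα

end

section

open Filter Topology

/-! ### The rank side as a sum of simple fractions -/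

variable {y : ℂ}

/-- The residue sequence of the rank side in base `y`. -/
noncomputable def rankCoeff (y : ℂ) (n : ℤ) : ℂ :=
  combCoeff y
    (y * (3 * (app y 1 / app y 2) + y * (app y 2 / app y 1) ^ 4) / (app y 1 * app y 2))
    (-((app y 1 / app y 2) ^ 3 + 2 * y * (app y 2 / app y 1) ^ 2) / (app y 1 * app y 2))
    (-(2 * (app y 1 / app y 2) ^ 2 - y * (app y 2 / app y 1) ^ 3) / (app y 1 * app y 2))
    (((app y 1 / app y 2) ^ 4 - 3 * y * (app y 2 / app y 1)) / (app y 1 * app y 2)) n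

lemma rankCoeff_identity (h0 : y ≠ 0) (h1 : ‖y‖ < 1) (ha1 : app y 1 ≠ 0) (ha2 : app y 2 ≠ 0) :
    2 * ∑' n, rankCoeff y n * frac y 1 n +
      5 * ∑' n, rankCoeff y n * (y ^ n * frac y 1 n ^ 2) =
    ((app y 1 / app y 2) ^ 5 - 11 * y - y ^ 2 * (app y 2 / app y 1) ^ 5) *
      (app y 1 * (lam y 1 - 2 * lam y 2) - 2 * y * app y 2 ^ 3 / app y 1) := by
  have hβ : -((app y 1 / app y 2) ^ 3 + 2 * y * (app y 2 / app y 1) ^ 2) / (app y 1 * app y 2) *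
      (app y 1 * app y 2) =
      -(2 * (app y 1 / app y 2) ^ 2 - y * (app y 2 / app y 1) ^ 3) / (app y 1 * app y 2) *
        app y 1 ^ 2 +
      ((app y 1 / app y 2) ^ 4 - 3 * y * (app y 2 / app y 1)) / (app y 1 * app y 2) *
        app y 2 ^ 2 := by
    field_simp
    ring
  obtain ⟨A, B⟩ := combCoeff_values
    (α₀ := y * (3 * (app y 1 / app y 2) + y * (app y 2 / app y 1) ^ 4) / (app y 1 * app y 2))
    h0 h1 hβ
  have e3 := eta_symm h0 h1 (b := 2) (c := 3) (by norm_num) (by norm_num) (by norm_num)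
  have e4 := eta_symm h0 h1 (b := 1) (c := 4) (by norm_num) (by norm_num) (by norm_num)
  have hl1 : lam y 1 =
      (3 * (app y 1 ^ 3 / app y 2 ^ 2) + y * app y 2 ^ 3 / app y 1 ^ 2 - 3) / 10 := by
    linear_combination (3 * lam_one_add h0 h1 ha1 ha2 + lam_one_sub h0 h1 ha1 ha2) / 10
  have hl2 : lam y 2 =
      (app y 1 ^ 3 / app y 2 ^ 2 - 3 * (y * app y 2 ^ 3 / app y 1 ^ 2) - 1) / 10 := by
    linear_combination (lam_one_add h0 h1 ha1 ha2 - 3 * lam_one_sub h0 h1 ha1 ha2) / 10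
  have he1 : eta y 1 = (2 * (lam y 1 ^ 2 - 2 * lam y 1 * lam y 2 - lam y 2) -
      (2 * lam y 1 * lam y 2 + lam y 2 ^ 2)) / 3 := by
    linear_combination (2 * eta_one h0 h1 - eta_two h0 h1) / 3
  have he2 : eta y 2 = (2 * (2 * lam y 1 * lam y 2 + lam y 2 ^ 2) -
      (lam y 1 ^ 2 - 2 * lam y 1 * lam y 2 - lam y 2)) / 3 := by
    linear_combination (2 * eta_two h0 h1 - eta_one h0 h1) / 3
  rw [e3, e4, he1, he2] at B
  change ∑' n, rankCoeff y n * frac y 1 n = _ at A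
  change -∑' n, rankCoeff y n * (y ^ n * frac y 1 n ^ 2) = _ at B
  rw [A, ← neg_neg (∑' n, rankCoeff y n * (y ^ n * frac y 1 n ^ 2)), B, hl1, hl2]
  field_simp
  ring

end

section

open Filter Topology

/-! ### Products and the triple product identity -/

variable {q : ℂ}

lemma summable_norm_mul_pow (h1 : ‖q‖ < 1) (a : ℂ) : Summable fun n : ℕ => ‖-(a * q ^ n)‖ := by
  simpa using (summable_geometric_of_lt_one (norm_nonneg q) h1).mul_left ‖a‖

lemma multipliable_poch (h1 : ‖q‖ < 1) (a : ℂ) : Multipliable fun n : ℕ => 1 - a * q ^ n := by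
  simpa [sub_eq_add_neg] using multipliable_one_add_of_summable (summable_norm_mul_pow h1 a)

lemma tendsto_poch (h1 : ‖q‖ < 1) (a : ℂ) :
    Tendsto (fun N => ∏ k ∈ Finset.range N, (1 - a * q ^ k)) atTop (𝓝 (poch a q)) :=
  (multipliable_poch h1 a).tendsto_prod_tprod_nat

lemma poch_ne_zero (h1 : ‖q‖ < 1) {a : ℂ} (h : ∀ n : ℕ, a * q ^ n ≠ 1) : poch a q ≠ 0 := by
  have := tprod_one_add_ne_zero_of_summable (f := fun n : ℕ => -(a * q ^ n))
    (fun n => by simpa [← sub_eq_add_neg, sub_eq_zero] using (h n).symm)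
    (summable_norm_mul_pow h1 a)
  simpa [poch, sub_eq_add_neg] using this

lemma poch_ne_zero_of_norm_lt_one (h1 : ‖q‖ < 1) {a : ℂ} (h : ‖a‖ < 1) : poch a q ≠ 0 := by
  refine poch_ne_zero h1 fun n hn => ?_
  have : ‖a * q ^ n‖ < 1 := by
    rw [norm_mul, norm_pow]
    exact (mul_le_of_le_one_right (norm_nonneg _) (pow_le_one₀ (norm_nonneg _) h1.le)).trans_lt h
  simp [hn] at this

lemma poch_eq_prod_mul (h1 : ‖q‖ < 1) (a : ℂ) (n : ℕ) :
    poch a q = (∏ k ∈ Finset.range n, (1 - a * q ^ k)) * poch (a * q ^ n) q := by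
  have h := (tendsto_poch h1 (a * q ^ n)).const_mul (∏ k ∈ Finset.range n, (1 - a * q ^ k))
  refine tendsto_nhds_unique (((tendsto_add_atTop_iff_nat n).2 (tendsto_poch h1 a))) ?_
  refine h.congr fun N => ?_
  rw [add_comm N n, Finset.prod_range_add]
  simp only [pow_add, mul_assoc]

lemma poch_succ (h1 : ‖q‖ < 1) (a : ℂ) : poch a q = (1 - a) * poch (a * q) q := by
  simpa using poch_eq_prod_mul h1 a 1

lemma poch_eq_zero (h1 : ‖q‖ < 1) {a : ℂ} {n : ℕ} (h : a * q ^ n = 1) : poch a q = 0 := by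
  rw [poch_eq_prod_mul h1 a (n + 1), Finset.prod_range_succ, h]
  simp

/-- The finite product `(1 - q) ⋯ (1 - q ^ n)`. -/
noncomputable def qfac (q : ℂ) (n : ℕ) : ℂ := ∏ k ∈ Finset.range n, (1 - q ^ (k + 1))

lemma qfac_zero (q : ℂ) : qfac q 0 = 1 := by simp [qfac]

lemma qfac_succ (q : ℂ) (n : ℕ) : qfac q (n + 1) = qfac q n * (1 - q ^ (n + 1)) :=
  Finset.prod_range_succ _ _

lemma one_sub_pow_ne_zero (h1 : ‖q‖ < 1) (n : ℕ) : 1 - q ^ (n + 1) ≠ 0 := by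
  intro h
  have := norm_pow_lt_one_of_pos h1 (Nat.succ_pos n)
  rw [Nat.succ_eq_add_one, ← sub_eq_zero.1 h, norm_one] at this
  exact lt_irrefl _ this

lemma qfac_ne_zero (h1 : ‖q‖ < 1) (n : ℕ) : qfac q n ≠ 0 :=
  Finset.prod_ne_zero_iff.2 fun k _ => one_sub_pow_ne_zero h1 k

lemma qfac_mul_poch (h1 : ‖q‖ < 1) (n : ℕ) : qfac q n * poch (q ^ (n + 1)) q = poch q q := by
  rw [poch_eq_prod_mul h1 q n, qfac]
  congr 1
  · exact Finset.prod_congr rfl fun k _ => by rw [pow_succ']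
  · rw [pow_succ']

lemma tendsto_qfac (h1 : ‖q‖ < 1) : Tendsto (qfac q) atTop (𝓝 (poch q q)) := by
  refine (tendsto_poch h1 q).congr fun N => ?_
  exact Finset.prod_congr rfl fun k _ => by rw [pow_succ']

lemma exists_norm_inv_qfac_le (h1 : ‖q‖ < 1) : ∃ C, ∀ n, ‖(qfac q n)⁻¹‖ ≤ C := by
  have h := ((tendsto_qfac h1).inv₀ (poch_ne_zero_of_norm_lt_one h1 h1)).norm.bddAbove_range
  obtain ⟨C, hC⟩ := h
  exact ⟨C, fun n => hC ⟨n, rfl⟩⟩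

lemma summable_norm_pow_div_qfac (h1 : ‖q‖ < 1) {x : ℂ} (hx : ‖x‖ < 1) :
    Summable fun n : ℕ => ‖x ^ n * (qfac q n)⁻¹‖ := by
  obtain ⟨C, hC⟩ := exists_norm_inv_qfac_le h1
  exact summable_norm_mul_of_bdd (summable_norm_geometric_of_norm_lt_one hx) hC

lemma tendsto_tsum_mul_pow_zero {c : ℕ → ℂ} {u : ℕ → ℂ} {x : ℂ}
    (hc : Summable fun n => ‖c n * x ^ n‖) (hu : Tendsto u atTop (𝓝 0)) (hux : ∀ N, ‖u N‖ ≤ ‖x‖) :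
    Tendsto (fun N => ∑' n, c n * u N ^ n) atTop (𝓝 (c 0)) := by
  have h0 : c 0 = ∑' n, c n * 0 ^ n := by
    rw [tsum_eq_single 0 fun n hn => by simp [hn]]; simp
  rw [h0]
  refine tendsto_tsum_of_dominated_convergence hc (fun n => (hu.pow n).const_mul _)
    (Eventually.of_forall fun N n => ?_)
  rw [norm_mul, norm_mul, norm_pow, norm_pow]
  gcongr
  exact hux N

lemma tendsto_mul_pow_zero (h1 : ‖q‖ < 1) (x : ℂ) :
    Tendsto (fun N : ℕ => x * q ^ N) atTop (𝓝 0) := by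
  simpa using (tendsto_pow_atTop_nhds_zero_of_norm_lt_one h1).const_mul x

lemma norm_mul_pow_le (h1 : ‖q‖ < 1) (x : ℂ) (N : ℕ) : ‖x * q ^ N‖ ≤ ‖x‖ := by
  rw [norm_mul, norm_pow]
  exact mul_le_of_le_one_right (norm_nonneg _) (pow_le_one₀ (norm_nonneg _) h1.le)

/-- Euler: `∑ x ^ n / (q)_n = 1 / (x; q)_∞`. -/
lemma tsum_pow_div_qfac (h1 : ‖q‖ < 1) {x : ℂ} (hx : ‖x‖ < 1) :
    (∑' n : ℕ, x ^ n * (qfac q n)⁻¹) * poch x q = 1 := by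
  set E : ℂ → ℂ := fun x => ∑' n : ℕ, x ^ n * (qfac q n)⁻¹ with hE
  have step : ∀ z : ℂ, ‖z‖ < 1 → E z * (1 - z) = E (z * q) := by
    intro z hz
    have hzq : ‖z * q‖ < 1 := by
      rw [norm_mul]; exact mul_lt_one_of_nonneg_of_lt_one_left (norm_nonneg _) hz h1.le
    have A := (summable_norm_pow_div_qfac h1 hz).of_norm
    have B := (summable_norm_pow_div_qfac h1 hzq).of_norm
    have key : E z - E (z * q) = z * E z := by
      simp only [hE]
      rw [← Summable.tsum_sub A B, (A.sub B).tsum_eq_zero_add, ← tsum_mul_left]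
      simp only [pow_zero, sub_self, zero_add]
      refine tsum_congr fun n => ?_
      have h2 := one_sub_pow_ne_zero h1 n
      have h3 := qfac_ne_zero h1 n
      rw [qfac_succ, mul_inv]
      linear_combination (z ^ (n + 1) * (qfac q n)⁻¹) * inv_mul_cancel₀ h2
    linear_combination key
  have iter : ∀ N : ℕ, E x * ∏ k ∈ Finset.range N, (1 - x * q ^ k) = E (x * q ^ N) := by
    intro N
    induction N with
    | zero => simp
    | succ N ih =>
      rw [Finset.prod_range_succ, ← mul_assoc, ih, step _ ((norm_mul_pow_le h1 x N).trans_lt hx),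
        mul_assoc, ← pow_succ]
  have hlim : Tendsto (fun N : ℕ => E (x * q ^ N)) atTop (𝓝 ((qfac q 0)⁻¹)) := by
    have := tendsto_tsum_mul_pow_zero (c := fun n => (qfac q n)⁻¹)
      (by simpa only [mul_comm] using summable_norm_pow_div_qfac h1 hx)
      (tendsto_mul_pow_zero h1 x) (norm_mul_pow_le h1 x)
    simpa only [hE, mul_comm] using this
  have := tendsto_nhds_unique ((tendsto_poch h1 x).const_mul (E x))
    (hlim.congr fun N => (iter N).symm)
  simpa [qfac_zero] using this

lemma summable_triCoeff_mul_pow_div_qfac (h0 : q ≠ 0) (h1 : ‖q‖ < 1) (x : ℂ) :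
    Summable fun n : ℕ => ‖triCoeff q n * x ^ n * (qfac q n)⁻¹‖ := by
  obtain ⟨C, hC⟩ := exists_norm_inv_qfac_le h1
  refine summable_norm_mul_of_bdd ?_ hC
  rcases eq_or_ne x 0 with rfl | hx
  · refine summable_of_ne_finset_zero (s := {0}) fun n hn => ?_
    have : n ≠ 0 := by simpa using hn
    simp [this]
  · have := (summable_triCoeff_mul_zpow h0 h1 hx).comp_injective (Nat.cast_injective (R := ℤ))
    simpa [Function.comp_def] using this

lemma triCoeff_succ (h0 : q ≠ 0) (n : ℕ) :
    triCoeff q ((n + 1 : ℕ) : ℤ) = -triCoeff q n * q ^ (n + 1) := by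
  have h : triCoeff q 1 = -q := by simp [triCoeff, tri_one]
  rw [Nat.cast_succ, triCoeff_add h0, h, mul_one, zpow_natCast, pow_succ]
  ring

lemma triCoeff_zero (q : ℂ) : triCoeff q 0 = 1 := by simp [triCoeff, tri_zero]

/-- Euler: `∑ (-1) ^ n q ^ (n (n + 1) / 2) x ^ n / (q)_n = (x q; q)_∞`. -/
lemma tsum_triCoeff_mul_pow_div_qfac (h0 : q ≠ 0) (h1 : ‖q‖ < 1) (x : ℂ) :
    ∑' n : ℕ, triCoeff q n * x ^ n * (qfac q n)⁻¹ = poch (x * q) q := by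
  set E : ℂ → ℂ := fun x => ∑' n : ℕ, triCoeff q n * x ^ n * (qfac q n)⁻¹ with hE
  have step : ∀ z : ℂ, E z = (1 - z * q) * E (z * q) := by
    intro z
    have A := (summable_triCoeff_mul_pow_div_qfac h0 h1 z).of_norm
    have B := (summable_triCoeff_mul_pow_div_qfac h0 h1 (z * q)).of_norm
    have key : E z - E (z * q) = -(z * q) * E (z * q) := by
      simp only [hE]
      rw [← Summable.tsum_sub A B, (A.sub B).tsum_eq_zero_add, ← tsum_mul_left]
      simp only [pow_zero, sub_self, zero_add]
      refine tsum_congr fun n => ?_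
      have h2 := one_sub_pow_ne_zero h1 n
      rw [qfac_succ, mul_inv, triCoeff_succ h0]
      linear_combination (-triCoeff q n * q ^ (n + 1) * z ^ (n + 1) * (qfac q n)⁻¹)
        * inv_mul_cancel₀ h2
    linear_combination key
  have iter : ∀ N : ℕ, (∏ k ∈ Finset.range N, (1 - x * q * q ^ k)) * E (x * q ^ N) = E x := by
    intro N
    induction N with
    | zero => simp
    | succ N ih =>
      rw [← ih, step (x * q ^ N), Finset.prod_range_succ]
      ring_nf
  have hlim : Tendsto (fun N : ℕ => E (x * q ^ N)) atTop (𝓝 1) := by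
    have := tendsto_tsum_mul_pow_zero (c := fun n : ℕ => triCoeff q n * (qfac q n)⁻¹) (x := x)
      (by simpa only [mul_right_comm] using summable_triCoeff_mul_pow_div_qfac h0 h1 x)
      (tendsto_mul_pow_zero h1 x) (norm_mul_pow_le h1 x)
    simpa [hE, mul_right_comm, triCoeff_zero, qfac_zero] using this
  have := tendsto_nhds_unique (((tendsto_poch h1 (x * q)).mul hlim).congr iter)
    tendsto_const_nhds
  simpa using this.symm

/-- The theta series `∑ (-1) ^ n q ^ (n (n + 1) / 2) z ^ n`. -/
noncomputable def theta (q z : ℂ) : ℂ := ∑' n : ℤ, triCoeff q n * z ^ n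

/-- The Jacobi triple product. -/
lemma theta_eq (h0 : q ≠ 0) (h1 : ‖q‖ < 1) {z : ℂ} (hz : z ≠ 0) (hz1 : ‖z * q‖ < 1) :
    theta q z = poch q q * (poch (z * q) q * poch z⁻¹ q) := by
  have hzq : z * q ≠ 0 := mul_ne_zero hz h0
  have A := summable_triCoeff_mul_zpow h0 h1 hz
  have E := summable_norm_pow_div_qfac h1 hz1
  have AE := summable_mul_of_summable_norm E A
  let e : ℕ × ℤ ≃ ℕ × ℤ := (Equiv.refl ℕ).prodShear fun k => Equiv.subRight (k : ℤ)
  have AE' : Summable fun p : ℕ × ℤ => (z * q) ^ p.1 * (qfac q p.1)⁻¹ *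
      (triCoeff q (p.2 - p.1) * z ^ (p.2 - p.1 : ℤ)) :=
    (Equiv.summable_iff (f := fun p : ℕ × ℤ => (z * q) ^ p.1 * (qfac q p.1)⁻¹ *
      (triCoeff q p.2 * z ^ p.2)) e).2 AE
  have term : ∀ (k : ℕ) (n : ℤ), (z * q) ^ k * (qfac q k)⁻¹ *
      (triCoeff q (n - k) * z ^ (n - k : ℤ)) =
      triCoeff q n * z ^ n * (triCoeff q k * (q ^ (-n)) ^ k * (qfac q k)⁻¹) := by
    intro k n
    have hk := pow_ne_zero k h0
    have hzk := pow_ne_zero k hz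
    rw [sub_eq_add_neg, triCoeff_add h0, triCoeff_neg h0, zpow_add₀ hz, mul_neg,
      ← zpow_natCast (q ^ (-n)), ← zpow_mul, zpow_neg q (k : ℤ), zpow_neg z, zpow_natCast,
      zpow_natCast, mul_pow, neg_mul]
    field_simp
  have main : (∑' k : ℕ, (z * q) ^ k * (qfac q k)⁻¹) * theta q z =
      ∑' n : ℤ, triCoeff q n * z ^ n * poch (q ^ (-n) * q) q := by
    rw [← tsum_mul_right]
    have : ∀ k : ℕ, (z * q) ^ k * (qfac q k)⁻¹ * theta q z = ∑' n : ℤ, (z * q) ^ k * (qfac q k)⁻¹ *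
      (triCoeff q (n - k) * z ^ (n - k : ℤ)) := by
      intro k
      rw [theta, ← tsum_mul_left]
      exact ((Equiv.subRight (k : ℤ)).tsum_eq (fun n => (z * q) ^ k * (qfac q k)⁻¹ *
        (triCoeff q n * z ^ n))).symm
    simp_rw [this]
    rw [← Summable.tsum_comm (f := fun (k : ℕ) (n : ℤ) => (z * q) ^ k * (qfac q k)⁻¹ *
      (triCoeff q (n - k) * z ^ (n - k : ℤ))) AE']
    refine tsum_congr fun n => ?_
    simp_rw [term]
    rw [tsum_mul_left, tsum_triCoeff_mul_pow_div_qfac h0 h1]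
  have main2 : ∑' n : ℤ, triCoeff q n * z ^ n * poch (q ^ (-n) * q) q = poch q q * poch z⁻¹ q := by
    have hinj : Function.Injective fun m : ℕ => -(m : ℤ) := fun a b h => by simpa using h
    have hs : Function.support (fun n : ℤ => triCoeff q n * z ^ n * poch (q ^ (-n) * q) q) ⊆
        Set.range fun m : ℕ => -(m : ℤ) := by
      intro n hn
      by_contra hcon
      have hpos : 0 < n := by
        by_contra hle
        exact hcon ⟨n.natAbs, by simp only; omega⟩
      refine hn ?_
      have : q ^ (-n) * q * q ^ (n - 1).toNat = 1 := by
        rw [← zpow_natCast, ← zpow_add_one₀ h0, ← zpow_add₀ h0]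
        convert zpow_zero q using 2
        omega
      simp only [poch_eq_zero h1 this, mul_zero]
    rw [← hinj.tsum_eq hs]
    have := tsum_triCoeff_mul_pow_div_qfac h0 h1 (z * q)⁻¹
    rw [mul_inv, mul_assoc, inv_mul_cancel₀ h0, mul_one] at this
    rw [← this, ← tsum_mul_left]
    refine tsum_congr fun m => ?_
    have h3 := qfac_ne_zero h1 m
    rw [triCoeff_neg h0, neg_neg, zpow_natCast, ← pow_succ, zpow_neg, zpow_neg, zpow_natCast,
      zpow_natCast, ← qfac_mul_poch h1 m, mul_pow, inv_pow, inv_pow]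
    field_simp
  rw [main2] at main
  have h3 := tsum_pow_div_qfac h1 hz1
  linear_combination poch (z * q) q * main - theta q z * h3

end

section

open Filter Topology

/-! ### Partial fractions of infinite products -/

variable {q : ℂ}

/-- The coefficients in the partial fraction expansion of `(q)_∞ / (t; q)_∞`. -/
noncomputable def pfCoeff (q : ℂ) (m : ℕ) : ℂ := triCoeff q m * (qfac q m)⁻¹

lemma summable_pfCoeff (h0 : q ≠ 0) (h1 : ‖q‖ < 1) : Summable fun m => ‖pfCoeff q m‖ := by
  simpa [pfCoeff] using summable_triCoeff_mul_pow_div_qfac h0 h1 1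

lemma poch_mul_tsum_pfCoeff (h0 : q ≠ 0) (h1 : ‖q‖ < 1) {t : ℂ} (ht : ‖t‖ < 1) :
    poch t q * ∑' m : ℕ, pfCoeff q m * frac q t m = poch q q := by
  have hsum : Summable fun p : ℕ × ℕ => t ^ p.1 * (pfCoeff q p.2 * (q ^ p.1) ^ p.2) := by
    refine Summable.of_norm_bounded (g := fun p : ℕ × ℕ => ‖t ^ p.1 * pfCoeff q p.2‖) ?_ ?_
    · exact (summable_mul_of_summable_norm (summable_norm_geometric_of_norm_lt_one ht)
        (summable_pfCoeff h0 h1)).norm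
    · rintro ⟨n, m⟩
      simp only [norm_mul, norm_pow, ← mul_assoc]
      exact mul_le_of_le_one_right (by positivity)
        (pow_le_one₀ (by positivity) (pow_le_one₀ (norm_nonneg _) h1.le))
  have e1 : ∀ n : ℕ, ∑' m : ℕ, t ^ n * (pfCoeff q m * (q ^ n) ^ m) =
      poch q q * (t ^ n * (qfac q n)⁻¹) := by
    intro n
    have h2 := qfac_ne_zero h1 n
    have h3 := tsum_triCoeff_mul_pow_div_qfac h0 h1 (q ^ n)
    rw [← pow_succ] at h3
    have h4 : ∀ m : ℕ, t ^ n * (pfCoeff q m * (q ^ n) ^ m) =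
        t ^ n * (triCoeff q m * (q ^ n) ^ m * (qfac q m)⁻¹) := fun m => by
      rw [pfCoeff]; ring
    simp_rw [h4]
    rw [tsum_mul_left, h3, ← qfac_mul_poch h1 n]
    field_simp
  have e2 : ∀ m : ℕ, ∑' n : ℕ, t ^ n * (pfCoeff q m * (q ^ n) ^ m) = pfCoeff q m * frac q t m := by
    intro m
    have h4 : ∀ n : ℕ, t ^ n * (pfCoeff q m * (q ^ n) ^ m) = pfCoeff q m * (t * q ^ m) ^ n :=
      fun n => by ring
    simp_rw [h4]
    rw [tsum_mul_left, tsum_geometric_of_norm_lt_one ((norm_mul_pow_le h1 t m).trans_lt ht), frac,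
      zpow_natCast]
  have := Summable.tsum_comm (f := fun (n m : ℕ) => t ^ n * (pfCoeff q m * (q ^ n) ^ m)) hsum
  simp_rw [e1, e2] at this
  rw [this, tsum_mul_left]
  linear_combination poch q q * tsum_pow_div_qfac h1 ht

lemma tsum_pfCoeff_mul_frac_pow (h0 : q ≠ 0) (h1 : ‖q‖ < 1) (m : ℕ) :
    ∑' n : ℕ, pfCoeff q n * frac q (q ^ (m + 1)) n = qfac q m := by
  have h := poch_mul_tsum_pfCoeff h0 h1 (norm_pow_lt_one_of_pos h1 (Nat.succ_pos m))
  rw [← qfac_mul_poch h1 m, mul_comm] at h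
  exact mul_right_cancel₀
    (poch_ne_zero_of_norm_lt_one h1 (norm_pow_lt_one_of_pos h1 (Nat.succ_pos m))) h

lemma appell_eq_nat (h0 : q ≠ 0) (h1 : ‖q‖ < 1) {t : ℂ} (ht : t ≠ 0) :
    appell q t = ∑' m : ℕ, triCoeff q m * frac q t m +
      ∑' n : ℕ, triCoeff q n * (q / t * q ^ n * frac q (q / t) n) := by
  have hs := (summable_triCoeff_mul_frac h0 h1 ht).of_norm
  rw [appell, tsum_of_nat_of_neg_add_one (f := fun m : ℤ => triCoeff q m * frac q t m)
    (hs.comp_injective (f := fun m : ℤ => triCoeff q m * frac q t m) (i := fun n : ℕ => (n : ℤ))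
      Nat.cast_injective)
    (hs.comp_injective (f := fun m : ℤ => triCoeff q m * frac q t m)
      (i := fun n : ℕ => -((n : ℤ) + 1)) fun a b h => by simpa using h)]
  congr 1
  refine tsum_congr fun n => ?_
  have e1 : triCoeff q (-((n : ℤ) + 1)) = -triCoeff q n := by
    have hn : (-((n : ℤ) + 1)) = -(n : ℤ) - 1 := by ring
    rw [triCoeff, triCoeff, hn, tri_neg_sub_one, zpow_sub₀ (by norm_num), zpow_neg, ← inv_zpow]
    norm_num
    ring
  have e2 : frac q t (-((n : ℤ) + 1)) = -(q / t * q ^ n * frac q (q / t) n) := by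
    have e : frac q t⁻¹ ((n : ℤ) + 1) = frac q (q / t) n := by
      rw [frac, frac, zpow_add_one₀ h0]
      congr 2; field_simp
    rw [frac_neg h0 ht, e, zpow_add_one₀ h0, zpow_natCast]
    ring
  rw [e1, e2]; ring

lemma appell_mul_poch (h0 : q ≠ 0) (h1 : ‖q‖ < 1) {t : ℂ} (ht0 : ‖q‖ < ‖t‖) (ht1 : ‖t‖ < 1) :
    appell q t * (poch t q * poch (q / t) q) = poch q q ^ 2 := by
  have ht : t ≠ 0 := by
    rintro rfl
    exact absurd ht0 (by simp)
  have hqt : ‖q / t‖ < 1 := by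
    rw [norm_div, div_lt_one (norm_pos_iff.2 ht)]; exact ht0
  have hc := summable_pfCoeff h0 h1
  have H1 := poch_mul_tsum_pfCoeff h0 h1 ht1
  have H2 := poch_mul_tsum_pfCoeff h0 h1 hqt
  obtain ⟨C, hC⟩ := exists_norm_frac_le_of_nonneg h1 t
  obtain ⟨D, hD⟩ := exists_norm_frac_le_of_nonneg h1 (q / t)
  obtain ⟨M, hM⟩ := exists_norm_frac_le_of_nonneg h1 q
  have S1 := summable_norm_mul_of_bdd hc hC
  have S2 := summable_norm_mul_of_bdd hc hD
  have hne : ∀ {s : ℂ}, ‖s‖ < 1 → ∀ m : ℕ, 1 - s * q ^ m ≠ 0 := by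
    intro s hs m h
    have := (norm_mul_pow_le h1 s m).trans_lt hs
    rw [← sub_eq_zero.1 h, norm_one] at this
    exact lt_irrefl _ this
  have split : ∀ m n : ℕ, pfCoeff q m * frac q t m * (pfCoeff q n * frac q (q / t) n) =
      pfCoeff q m * frac q t m * (pfCoeff q n * frac q (q ^ (m + 1)) n) +
      pfCoeff q n * (q / t * q ^ n * frac q (q / t) n) *
        (pfCoeff q m * frac q (q ^ (n + 1)) m) := by
    intro m n
    have a1 := hne ht1 m
    have a2 := hne hqt n
    have a3 := one_sub_pow_ne_zero h1 (m + n)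
    simp only [frac, zpow_natCast]
    have b1 : q ^ (m + 1) * q ^ n = q ^ (m + n + 1) := by ring
    have b2 : q ^ (n + 1) * q ^ m = q ^ (m + n + 1) := by ring
    rw [b1, b2]
    have key : (1 - t * q ^ m)⁻¹ * (1 - q / t * q ^ n)⁻¹ = (1 - q ^ (m + n + 1))⁻¹ *
        ((1 - t * q ^ m)⁻¹ + q / t * q ^ n * (1 - q / t * q ^ n)⁻¹) := by
      have e : q ^ (m + n + 1) = (t * q ^ m) * (q / t * q ^ n) := by
        field_simp; ring
      rw [e] at a3 ⊢
      generalize t * q ^ m = u at *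
      generalize q / t * q ^ n = v at *
      field_simp
      ring
    linear_combination pfCoeff q m * pfCoeff q n * key
  have P1 : Summable fun p : ℕ × ℕ => pfCoeff q p.1 * frac q t p.1 *
      (pfCoeff q p.2 * frac q (q ^ (p.1 + 1)) p.2) := by
    refine Summable.of_norm_bounded (g := fun p : ℕ × ℕ => ‖pfCoeff q p.1 * frac q t p.1‖ *
      ‖pfCoeff q p.2‖ * M) ?_ ?_
    · exact ((summable_mul_of_summable_norm S1 hc).norm.congr fun p => by
        rw [norm_mul]).mul_right M
    · rintro ⟨m, n⟩
      have e : frac q (q ^ (m + 1)) n = frac q q ((m + n : ℕ) : ℤ) := by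
        simp only [frac, zpow_natCast]; ring
      rw [norm_mul, norm_mul (pfCoeff q n), ← mul_assoc, e]
      gcongr
      exact hM _
  have T := summable_mul_of_summable_norm S1 S2
  have P2 : Summable fun p : ℕ × ℕ => pfCoeff q p.2 * (q / t * q ^ p.2 * frac q (q / t) p.2) *
        (pfCoeff q p.1 * frac q (q ^ (p.2 + 1)) p.1) := by
    refine (T.sub P1).congr fun p => ?_
    rw [split]; ring
  have prod : (∑' m : ℕ, pfCoeff q m * frac q t m) * (∑' n : ℕ, pfCoeff q n * frac q (q / t) n) =
      ∑' m : ℕ, triCoeff q m * frac q t m +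
      ∑' n : ℕ, triCoeff q n * (q / t * q ^ n * frac q (q / t) n) := by
    rw [tsum_mul_tsum_of_summable_norm S1 S2]
    simp_rw [split]
    rw [P1.tsum_add P2, P1.tsum_prod' fun m => P1.prod_factor m,
      P2.tsum_prod' fun m => P2.prod_factor m,
      ← Summable.tsum_comm (f := fun (m n : ℕ) => pfCoeff q n * (q / t * q ^ n * frac q (q / t) n) *
        (pfCoeff q m * frac q (q ^ (n + 1)) m)) P2]
    congr 1
    · refine tsum_congr fun m => ?_
      dsimp only
      rw [tsum_mul_left, tsum_pfCoeff_mul_frac_pow h0 h1, pfCoeff]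
      have := qfac_ne_zero h1 m
      field_simp
    · refine tsum_congr fun m => ?_
      rw [tsum_mul_left, tsum_pfCoeff_mul_frac_pow h0 h1, pfCoeff]
      have := qfac_ne_zero h1 m
      field_simp
  rw [appell_eq_nat h0 h1 ht, ← prod]
  linear_combination (poch (q / t) q * ∑' n : ℕ, pfCoeff q n * frac q (q / t) n) * H1
    + poch q q * H2

lemma appell_mul_theta (h0 : q ≠ 0) (h1 : ‖q‖ < 1) {t : ℂ} (ht0 : ‖q‖ < ‖t‖) (ht1 : ‖t‖ < 1) :
    appell q t * theta q t⁻¹ = poch q q ^ 3 := by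
  have ht : t ≠ 0 := by
    rintro rfl
    exact absurd ht0 (by simp)
  have hqt : ‖t⁻¹ * q‖ < 1 := by
    rw [norm_mul, norm_inv, inv_mul_lt_one₀ (norm_pos_iff.2 ht)]; exact ht0
  rw [theta_eq h0 h1 (inv_ne_zero ht) hqt, inv_inv, inv_mul_eq_div]
  linear_combination poch q q * appell_mul_poch h0 h1 ht0 ht1

end

section

open Filter Topology

/-! ### Dissection of theta products -/

variable {q : ℂ}

lemma poch_eq_five (h1 : ‖q‖ < 1) (a : ℂ) :
    poch a q = poch a (q ^ 5) * poch (a * q) (q ^ 5) * poch (a * q ^ 2) (q ^ 5) *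
      poch (a * q ^ 3) (q ^ 5) * poch (a * q ^ 4) (q ^ 5) := by
  have h5 := norm_pow_five_lt_one h1
  have hl := (tendsto_poch h1 a).comp (tendsto_id.const_mul_atTop' (show 0 < 5 by norm_num))
  refine tendsto_nhds_unique hl (Tendsto.congr (fun N => ?_) (((((tendsto_poch h5 a).mul
    (tendsto_poch h5 (a * q))).mul (tendsto_poch h5 (a * q ^ 2))).mul
    (tendsto_poch h5 (a * q ^ 3))).mul (tendsto_poch h5 (a * q ^ 4))))
  simp only [Function.comp_apply, id]
  induction N with
  | zero => simp
  | succ N ih =>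
    rw [mul_add, mul_one]
    simp only [Finset.prod_range_succ]
    rw [← ih]
    ring

lemma prod_poch_roots {ζ : ℂ} (hζ : IsPrimitiveRoot ζ 5) (h1 : ‖q‖ < 1) :
    poch q q * poch (ζ * q) q * poch (ζ ^ 2 * q) q * poch (ζ ^ 3 * q) q * poch (ζ ^ 4 * q) q =
      poch (q ^ 5) (q ^ 5) := by
  have h5 := norm_pow_five_lt_one h1
  have e5 : ζ ^ 5 = 1 := hζ.pow_eq_one
  have es : 1 + ζ + ζ ^ 2 + ζ ^ 3 + ζ ^ 4 = 0 := by
    have := hζ.geom_sum_eq_zero (by norm_num)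
    simpa [Finset.sum_range_succ] using this
  refine tendsto_nhds_unique (Tendsto.congr (fun N => ?_) (((((tendsto_poch h1 q).mul
    (tendsto_poch h1 (ζ * q))).mul (tendsto_poch h1 (ζ ^ 2 * q))).mul
    (tendsto_poch h1 (ζ ^ 3 * q))).mul (tendsto_poch h1 (ζ ^ 4 * q)))) (tendsto_poch h5 (q ^ 5))
  simp only [← Finset.prod_mul_distrib]
  refine Finset.prod_congr rfl fun n _ => ?_
  have e : q ^ 5 * (q ^ 5) ^ n = (q * q ^ n) ^ 5 := by ring
  rw [e]
  simp only [mul_assoc]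
  generalize q * q ^ n = x
  have f1 : (1 - ζ * x) * (1 - ζ ^ 4 * x) = 1 - (ζ + ζ ^ 4) * x + x ^ 2 := by
    linear_combination x ^ 2 * e5
  have f2 : (1 - ζ ^ 2 * x) * (1 - ζ ^ 3 * x) = 1 - (-1 - (ζ + ζ ^ 4)) * x + x ^ 2 := by
    linear_combination x ^ 2 * e5 - x * es
  have f3 : (ζ + ζ ^ 4) ^ 2 = 1 - (ζ + ζ ^ 4) := by
    linear_combination es + (ζ ^ 3 + 2) * e5
  calc _ = (1 - x) * (((1 - ζ * x) * (1 - ζ ^ 4 * x)) * ((1 - ζ ^ 2 * x) * (1 - ζ ^ 3 * x))) := by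
        ring
    _ = _ := by
      rw [f1, f2]
      linear_combination (-(1 - x) * x ^ 2) * f3

/-- The theta values `∑ (-1) ^ n y ^ (5 n (n - 1) / 2 + b n)`. -/
noncomputable def thB (y : ℂ) (b : ℕ) : ℂ := theta (y ^ 5) (y ^ b)⁻¹

lemma app_mul_thB (h0 : q ≠ 0) (h1 : ‖q‖ < 1) {b : ℕ} (hb : 0 < b) (hb5 : b < 5) :
    app q b * thB q b = poch (q ^ 5) (q ^ 5) ^ 3 :=
  appell_mul_theta (pow_ne_zero 5 h0) (norm_pow_five_lt_one h1)
    (norm_pow_five_lt_norm_pow h0 h1 hb5) (norm_pow_lt_one_of_pos h1 hb)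

lemma poch_five_ne_zero (h1 : ‖q‖ < 1) : poch (q ^ 5) (q ^ 5) ≠ 0 :=
  poch_ne_zero_of_norm_lt_one (norm_pow_five_lt_one h1) (norm_pow_five_lt_one h1)

lemma app_ne_zero (h0 : q ≠ 0) (h1 : ‖q‖ < 1) {b : ℕ} (hb : 0 < b) (hb5 : b < 5) : app q b ≠ 0 :=
  left_ne_zero_of_mul ((app_mul_thB h0 h1 hb hb5).symm ▸ pow_ne_zero 3 (poch_five_ne_zero h1))

lemma thB_ne_zero (h0 : q ≠ 0) (h1 : ‖q‖ < 1) {b : ℕ} (hb : 0 < b) (hb5 : b < 5) : thB q b ≠ 0 :=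
  right_ne_zero_of_mul ((app_mul_thB h0 h1 hb hb5).symm ▸ pow_ne_zero 3 (poch_five_ne_zero h1))

lemma thB_eq (h0 : q ≠ 0) (h1 : ‖q‖ < 1) {b c : ℕ} (hc : 0 < c) (hbc : c + b = 5) :
    thB q b = poch (q ^ 5) (q ^ 5) * (poch (q ^ c) (q ^ 5) * poch (q ^ b) (q ^ 5)) := by
  have e : (q ^ b)⁻¹ * q ^ 5 = q ^ c := by
    rw [← hbc, pow_add]
    field_simp
  have hlt : ‖(q ^ b)⁻¹ * q ^ 5‖ < 1 := e ▸ norm_pow_lt_one_of_pos h1 hc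
  rw [thB, theta_eq (pow_ne_zero 5 h0) (norm_pow_five_lt_one h1)
    (inv_ne_zero (pow_ne_zero b h0)) hlt,
    e, inv_inv]

lemma thB_mul_thB (h0 : q ≠ 0) (h1 : ‖q‖ < 1) :
    thB q 1 * thB q 2 = poch (q ^ 5) (q ^ 5) * poch q q := by
  rw [thB_eq h0 h1 (c := 4) (by norm_num) rfl, thB_eq h0 h1 (c := 3) (by norm_num) rfl,
    poch_eq_five h1 q]
  ring_nf

lemma theta_inv {z : ℂ} (hz : z ≠ 0) : theta q z = -z⁻¹ * theta q z⁻¹ := by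
  rw [theta, theta, ← tsum_mul_left, ← ((Equiv.neg ℤ).trans (Equiv.subRight 1)).tsum_eq]
  refine tsum_congr fun n => ?_
  have hn := zpow_ne_zero n hz
  simp only [Equiv.trans_apply, Equiv.neg_apply, Equiv.subRight_apply]
  have e : ((-1 : ℂ) ^ (-n - 1)) = -(-1) ^ n := by
    rw [zpow_sub₀ (by norm_num), zpow_neg, ← inv_zpow]
    norm_num
    ring
  rw [triCoeff, triCoeff, tri_neg_sub_one, e, zpow_sub₀ hz, zpow_neg, inv_zpow, zpow_one]
  ring

lemma theta_one : theta q 1 = 0 := by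
  simpa [theta] using tsum_triCoeff (Q := q)

lemma hasSum_five {f : ℤ → ℂ} {s : ℤ → ℂ}
    (h : ∀ b : ℤ, 0 ≤ b → b < 5 → HasSum (fun m : ℤ => f (5 * m + b)) (s b)) :
    HasSum f (s 0 + s 1 + s 2 + s 3 + s 4) := by
  have H : ∀ b : ℤ, 0 ≤ b → b < 5 → HasSum (fun n : ℤ => if n % 5 = b then f n else 0) (s b) :=
    fun b hb hb5 => (hasSum_prog_iff hb hb5).2 (h b hb hb5)
  refine (((((H 0 (by norm_num) (by norm_num)).add (H 1 (by norm_num) (by norm_num))).add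
    (H 2 (by norm_num) (by norm_num))).add (H 3 (by norm_num) (by norm_num))).add
    (H 4 (by norm_num) (by norm_num))).congr_fun fun n => ?_
  have h5 : n % 5 = 0 ∨ n % 5 = 1 ∨ n % 5 = 2 ∨ n % 5 = 3 ∨ n % 5 = 4 := by omega
  rcases h5 with h | h | h | h | h <;> simp [h]

lemma triCoeff_five_mul_add (h0 : q ≠ 0) (m b : ℤ) :
    triCoeff q (5 * m + b) =
      triCoeff q b * (triCoeff ((q ^ 5) ^ 5) m * ((q ^ 5) ^ (b - 2)) ^ m) := by
  have e1 : tri (5 * m) = 25 * tri m - 10 * m := by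
    have : 2 * tri (5 * m) = 2 * (25 * tri m - 10 * m) := by
      linear_combination two_mul_tri (5 * m) - 25 * two_mul_tri m
    omega
  have e2 : (-1 : ℂ) ^ (5 * m) = (-1) ^ m := by
    rw [zpow_mul]; norm_num
  rw [triCoeff_add h0, triCoeff, triCoeff, e1, e2, triCoeff]
  have : ∀ k : ℤ, (q ^ 5) ^ k = q ^ (5 * k) := fun k => by rw [zpow_mul, zpow_ofNat]
  rw [← pow_mul, this, ← zpow_mul]
  have : ((q ^ (5 * 5)) ^ tri m) = q ^ (25 * tri m) := by rw [zpow_mul, zpow_ofNat]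
  rw [this]
  have : q ^ (25 * tri m - 10 * m) * q ^ (5 * m * b) =
      q ^ (25 * tri m) * q ^ (5 * (b - 2) * m) := by
    rw [← zpow_add₀ h0, ← zpow_add₀ h0]
    congr 1; ring
  linear_combination (-1) ^ m * ((-1) ^ b * q ^ tri b) * this

lemma hasSum_theta (h0 : q ≠ 0) (h1 : ‖q‖ < 1) {z : ℂ} (hz : z ≠ 0) :
    HasSum (fun n => triCoeff q n * z ^ n) (theta q z) :=
  (summable_triCoeff_mul_zpow h0 h1 hz).of_norm.hasSum

lemma theta_dissect (h0 : q ≠ 0) (h1 : ‖q‖ < 1) {z : ℂ} (hz : z ^ 5 = 1) :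
    theta q z = (1 - z ^ 4) * thB (q ^ 5) 2 - q * (z - z ^ 3) * thB (q ^ 5) 1 := by
  have hz0 : z ≠ 0 := by rintro rfl; norm_num at hz
  have hq5 := pow_ne_zero 5 h0
  have h15 := norm_pow_five_lt_one h1
  have H := hasSum_five (f := fun n => triCoeff q n * z ^ n)
    (s := fun b => triCoeff q b * z ^ b * theta ((q ^ 5) ^ 5) ((q ^ 5) ^ (b - 2))) fun b _ _ => by
      refine ((hasSum_theta (pow_ne_zero 5 hq5) (norm_pow_five_lt_one h15)
        (zpow_ne_zero (b - 2) hq5)).mul_left (triCoeff q b * z ^ b)).congr_fun fun m => ?_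
      have : z ^ (5 * m + b) = z ^ b := by
        rw [zpow_add₀ hz0, zpow_mul, zpow_ofNat, hz, one_zpow, one_mul]
      rw [triCoeff_five_mul_add h0, this]
      ring
  rw [(hasSum_theta h0 h1 hz0).unique H]
  have t1 : tri 1 = 1 := rfl
  have t2 : tri 2 = 3 := rfl
  have t3 : tri 3 = 6 := rfl
  have t4 : tri 4 = 10 := rfl
  have i1 := theta_inv (q := (q ^ 5) ^ 5) (z := q ^ 5) hq5
  have i2 := theta_inv (q := (q ^ 5) ^ 5) (z := (q ^ 5) ^ 2) (pow_ne_zero 2 hq5)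
  simp only [triCoeff, tri_zero, t1, t2, t3, t4, thB]
  norm_num
  norm_cast
  simp only [i1, i2, theta_one]
  generalize theta _ _ = b1
  generalize theta _ _ = b2
  field_simp
  ring

/-- The product `(q)_∞ (z q)_∞ (q / z)_∞`. -/
noncomputable def tripleProd (q z : ℂ) : ℂ := poch q q * poch (z * q) q * poch (z ^ 4 * q) q

lemma tripleProd_eq (h0 : q ≠ 0) (h1 : ‖q‖ < 1) {z : ℂ} (hz : z ^ 5 = 1) (hz1 : z ≠ 1) :
    tripleProd q z = thB (q ^ 5) 2 - q * (1 + z + z ^ 4) * thB (q ^ 5) 1 := by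
  have hz0 : z ≠ 0 := by rintro rfl; norm_num at hz
  have hzi : z⁻¹ = z ^ 4 := by
    field_simp; exact hz.symm
  have hn : ‖z‖ = 1 := by
    have : ‖z‖ ^ 5 = 1 := by rw [← norm_pow, hz, norm_one]
    exact (pow_eq_one_iff_of_nonneg (norm_nonneg _) (by norm_num)).1 this
  have h := theta_eq h0 h1 hz0 (by simpa [hn] using h1)
  rw [theta_dissect h0 h1 hz, hzi, poch_succ h1 (z ^ 4)] at h
  have hne : 1 - z ^ 4 ≠ 0 := by
    intro h4
    refine hz1 ?_
    linear_combination z * h4 + hz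
  refine mul_left_cancel₀ hne ?_
  rw [tripleProd]
  linear_combination -h - q * thB (q ^ 5) 1 * (1 + z ^ 3) * hz

lemma tripleProd_mul_tripleProd {ζ : ℂ} (hζ : IsPrimitiveRoot ζ 5) (h1 : ‖q‖ < 1) :
    tripleProd q ζ * tripleProd q (ζ ^ 2) = poch q q * poch (q ^ 5) (q ^ 5) := by
  have e : (ζ ^ 2) ^ 4 = ζ ^ 3 := by
    linear_combination ζ ^ 3 * hζ.pow_eq_one
  rw [← prod_poch_roots hζ h1, tripleProd, tripleProd, e]
  ring

lemma poch_eq_ratio (h0 : q ≠ 0) (h1 : ‖q‖ < 1) :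
    poch q q = poch ((q ^ 5) ^ 5) ((q ^ 5) ^ 5) *
      (app (q ^ 5) 1 / app (q ^ 5) 2 - q - q ^ 2 * (app (q ^ 5) 2 / app (q ^ 5) 1)) := by
  have hζ := Complex.isPrimitiveRoot_exp 5 (by norm_num)
  generalize Complex.exp _ = ζ at hζ
  have e5 : ζ ^ 5 = 1 := hζ.pow_eq_one
  have es : 1 + ζ + ζ ^ 2 + ζ ^ 3 + ζ ^ 4 = 0 := by
    have := hζ.geom_sum_eq_zero (by norm_num)
    simpa [Finset.sum_range_succ] using this
  have hq5 := pow_ne_zero 5 h0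
  have h15 := norm_pow_five_lt_one h1
  have H := tripleProd_mul_tripleProd hζ h1
  rw [tripleProd_eq h0 h1 e5 (hζ.ne_one (by norm_num)), tripleProd_eq h0 h1
    (by rw [← pow_mul, mul_comm, pow_mul, e5, one_pow])
    (hζ.pow_ne_one_of_pos_of_lt (by norm_num) (by norm_num))] at H
  have B := thB_mul_thB hq5 h15
  have A1 := app_mul_thB hq5 h15 (b := 1) (by norm_num) (by norm_num)
  have A2 := app_mul_thB hq5 h15 (b := 2) (by norm_num) (by norm_num)
  have n1 := app_ne_zero hq5 h15 (b := 1) (by norm_num) (by norm_num)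
  have n2 := app_ne_zero hq5 h15 (b := 2) (by norm_num) (by norm_num)
  have m1 := thB_ne_zero hq5 h15 (b := 1) (by norm_num) (by norm_num)
  have m2 := thB_ne_zero hq5 h15 (b := 2) (by norm_num) (by norm_num)
  have r1 : app (q ^ 5) 1 / app (q ^ 5) 2 = thB (q ^ 5) 2 / thB (q ^ 5) 1 := by
    rw [div_eq_div_iff n2 m1]
    linear_combination A1 - A2
  have r2 : app (q ^ 5) 2 / app (q ^ 5) 1 = thB (q ^ 5) 1 / thB (q ^ 5) 2 := by
    rw [div_eq_div_iff n1 m2]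
    linear_combination A2 - A1
  rw [r1, r2]
  have hY := poch_five_ne_zero h1
  generalize thB (q ^ 5) 1 = b1 at *
  generalize thB (q ^ 5) 2 = b2 at *
  generalize poch ((q ^ 5) ^ 5) ((q ^ 5) ^ 5) = J at *
  have H' : poch q q * poch (q ^ 5) (q ^ 5) = b2 ^ 2 - q * b1 * b2 - q ^ 2 * b1 ^ 2 := by
    have e8 : (ζ ^ 2) ^ 4 = ζ ^ 3 := by linear_combination ζ ^ 3 * e5
    have s1 : (1 + ζ + ζ ^ 4) + (1 + ζ ^ 2 + ζ ^ 3) = 1 := by linear_combination es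
    have s2 : (1 + ζ + ζ ^ 4) * (1 + ζ ^ 2 + ζ ^ 3) = -1 := by
      linear_combination 2 * es + (ζ + ζ ^ 2) * e5
    rw [← H, e8]
    linear_combination -q * b1 * b2 * s1 + q ^ 2 * b1 ^ 2 * s2
  refine mul_right_cancel₀ hY (H'.trans ?_)
  field_simp
  linear_combination (b2 ^ 2 - q * b1 * b2 - q ^ 2 * b1 ^ 2) * B

end

section

open Filter Topology

/-! ### Extraction of a residue class -/

variable {q : ℂ}

lemma sum_roots_pow {ζ : ℂ} (hζ : IsPrimitiveRoot ζ 5) (j : ℕ) :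
    ∑ k ∈ Finset.range 5, (ζ ^ k) ^ j = if 5 ∣ j then 5 else 0 := by
  have e : ∀ k : ℕ, (ζ ^ k) ^ j = (ζ ^ j) ^ k := fun k => by rw [← pow_mul, ← pow_mul, mul_comm]
  simp_rw [e]
  split_ifs with h
  · rw [(hζ.pow_eq_one_iff_dvd j).2 h]
    simp
  · have hne : ζ ^ j ≠ 1 := fun h1 => h ((hζ.pow_eq_one_iff_dvd j).1 h1)
    rw [geom_sum_eq hne, ← pow_mul, mul_comm, pow_mul, hζ.pow_eq_one]
    simp

/-- Extraction of the component of degree one modulo five of a function of a fifth root of unity. -/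
noncomputable def classOne (ζ : ℂ) (F : ℂ → ℂ) : ℂ := ∑ k ∈ Finset.range 5, (ζ ^ k) ^ 4 * F (ζ ^ k)

lemma classOne_congr {ζ : ℂ} (hζ : IsPrimitiveRoot ζ 5) {F G : ℂ → ℂ}
    (h : ∀ z, z ^ 5 = 1 → F z = G z) : classOne ζ F = classOne ζ G := by
  refine Finset.sum_congr rfl fun k _ => ?_
  rw [h]
  rw [← pow_mul, mul_comm, pow_mul, hζ.pow_eq_one, one_pow]

lemma classOne_add (ζ : ℂ) (F G : ℂ → ℂ) :
    classOne ζ (fun z => F z + G z) = classOne ζ F + classOne ζ G := by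
  simp [classOne, mul_add, Finset.sum_add_distrib]

lemma classOne_mul (ζ c : ℂ) (F : ℂ → ℂ) : classOne ζ (fun z => c * F z) = c * classOne ζ F := by
  simp only [classOne, Finset.mul_sum]
  exact Finset.sum_congr rfl fun k _ => by ring

lemma classOne_pow {ζ : ℂ} (hζ : IsPrimitiveRoot ζ 5) (j : ℕ) :
    classOne ζ (fun z => z ^ j) = if j % 5 = 1 then 5 else 0 := by
  simp only [classOne, ← pow_add]
  rw [sum_roots_pow hζ]
  congr 1
  rw [eq_iff_iff]
  omega

lemma classOne_pow_mul {ζ : ℂ} (hζ : IsPrimitiveRoot ζ 5) (j : ℕ) (p : ℕ → ℂ) :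
    classOne ζ (fun z => z ^ j * ∑ i ∈ Finset.range 5, p i * z ^ i) = 5 * p ((4 * j + 1) % 5) := by
  have e : ∀ z : ℂ, z ^ j * ∑ i ∈ Finset.range 5, p i * z ^ i =
      ∑ i ∈ Finset.range 5, p i * z ^ (j + i) := fun z => by
    rw [Finset.mul_sum]
    exact Finset.sum_congr rfl fun i _ => by ring
  have : classOne ζ (fun z => z ^ j * ∑ i ∈ Finset.range 5, p i * z ^ i) =
      ∑ i ∈ Finset.range 5, p i * classOne ζ (fun z => z ^ (j + i)) := by
    simp_rw [e]
    simp only [classOne, Finset.mul_sum]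
    rw [Finset.sum_comm]
    exact Finset.sum_congr rfl fun i _ => Finset.sum_congr rfl fun k _ => by ring
  rw [this]
  simp_rw [classOne_pow hζ]
  rw [Finset.sum_eq_single ((4 * j + 1) % 5)]
  · rw [if_pos (by omega)]; ring
  · intro i hi hne
    rw [Finset.mem_range] at hi
    rw [if_neg (by omega), mul_zero]
  · intro h
    exact absurd (Finset.mem_range.2 (Nat.mod_lt _ (by norm_num))) h

/-- The cofactor of `a - q - q ^ 2 / a` in `a ^ 5 - 11 q ^ 5 - q ^ 10 / a ^ 5`, with `b = a⁻¹`. -/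
noncomputable def cofactor (a b q : ℂ) : ℂ :=
  a ^ 4 + q * a ^ 3 + 2 * q ^ 2 * a ^ 2 + 3 * q ^ 3 * a + 5 * q ^ 4 - 3 * q ^ 5 * b +
    2 * q ^ 6 * b ^ 2 - q ^ 7 * b ^ 3 + q ^ 8 * b ^ 4

lemma mul_cofactor {a b : ℂ} (h : a * b = 1) (q : ℂ) :
    (a - q - q ^ 2 * b) * cofactor a b q = a ^ 5 - 11 * q ^ 5 - (q ^ 5) ^ 2 * b ^ 5 := by
  have ha : a ≠ 0 := left_ne_zero_of_mul_eq_one h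
  rw [eq_inv_of_mul_eq_one_right h, cofactor]
  field_simp
  ring

/-- The components of `cofactor a b` at a multiple `z q` with `z ^ 5 = 1`. -/
noncomputable def cofactorComp (a b q : ℂ) : ℕ → ℂ
  | 0 => a ^ 4 - 3 * q ^ 5 * b
  | 1 => q * (a ^ 3 + 2 * q ^ 5 * b ^ 2)
  | 2 => q ^ 2 * (2 * a ^ 2 - q ^ 5 * b ^ 3)
  | 3 => q ^ 3 * (3 * a + q ^ 5 * b ^ 4)
  | _ => 5 * q ^ 4

lemma cofactor_eq_sum (a b q : ℂ) {z : ℂ} (hz : z ^ 5 = 1) :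
    cofactor a b (z * q) = ∑ i ∈ Finset.range 5, cofactorComp a b q i * z ^ i := by
  simp only [Finset.sum_range_succ, Finset.sum_range_zero, cofactorComp, cofactor]
  linear_combination (-3 * q ^ 5 * b + 2 * q ^ 6 * b ^ 2 * z - q ^ 7 * b ^ 3 * z ^ 2
    + q ^ 8 * b ^ 4 * z ^ 3) * hz

lemma cofactor_eq_prod {a b ζ : ℂ} (h : a * b = 1) (e5 : ζ ^ 5 = 1)
    (es : 1 + ζ + ζ ^ 2 + ζ ^ 3 + ζ ^ 4 = 0) (q : ℂ) :
    cofactor a b q = (a - ζ * q - (ζ * q) ^ 2 * b) * (a - ζ ^ 4 * q - (ζ ^ 4 * q) ^ 2 * b) *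
      ((a - ζ ^ 2 * q - (ζ ^ 2 * q) ^ 2 * b) * (a - ζ ^ 3 * q - (ζ ^ 3 * q) ^ 2 * b)) := by
  have pair : ∀ z : ℂ, z ^ 5 = 1 → 1 + z + z ^ 2 + z ^ 3 + z ^ 4 = 0 →
      (a - z * q - (z * q) ^ 2 * b) * (a - z ^ 4 * q - (z ^ 4 * q) ^ 2 * b) =
      (a ^ 2 + 2 * q ^ 2 + q ^ 4 * b ^ 2) + (z + z ^ 4) * (-a * q + q ^ 2 + q ^ 3 * b) := by
    intro z h5 h4
    linear_combination (-q ^ 2 * (z ^ 2 + z ^ 8)) * h - q ^ 2 * h4 +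
      (q ^ 2 - q ^ 2 * z ^ 3 + q ^ 3 * b * (z ^ 4 + z) + q ^ 4 * b ^ 2 * (1 + z ^ 5)) * h5
  have e2 : (ζ ^ 2) ^ 5 = 1 := by rw [← pow_mul, mul_comm, pow_mul, e5, one_pow]
  have e8 : (ζ ^ 2) ^ 4 = ζ ^ 3 := by linear_combination ζ ^ 3 * e5
  have p2 := pair (ζ ^ 2) e2 (by linear_combination es + (ζ + ζ ^ 3) * e5)
  rw [e8] at p2
  rw [pair ζ e5 es, p2]
  have s1 : ζ ^ 2 + ζ ^ 3 = -1 - (ζ + ζ ^ 4) := by linear_combination es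
  have s2 : (ζ + ζ ^ 4) ^ 2 = 1 - (ζ + ζ ^ 4) := by linear_combination es + (ζ ^ 3 + 2) * e5
  have ha : a ≠ 0 := left_ne_zero_of_mul_eq_one h
  have key : cofactor a b q = (a ^ 2 + 2 * q ^ 2 + q ^ 4 * b ^ 2) ^ 2 -
      (a ^ 2 + 2 * q ^ 2 + q ^ 4 * b ^ 2) * (-a * q + q ^ 2 + q ^ 3 * b) -
      (-a * q + q ^ 2 + q ^ 3 * b) ^ 2 := by
    rw [eq_inv_of_mul_eq_one_right h, cofactor]
    field_simp
    ring
  rw [s1, key]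
  generalize a ^ 2 + 2 * q ^ 2 + q ^ 4 * b ^ 2 = u
  generalize -a * q + q ^ 2 + q ^ 3 * b = v
  linear_combination v ^ 2 * s2

/-- The theta weights of the rank generating function. -/
noncomputable def rankExp (q : ℂ) (n : ℤ) : ℂ := (-1) ^ n * (q ^ (3 * tri n + n) - q ^ (3 * tri n))

lemma rankExp_five_mul_add (h0 : q ≠ 0) (m b : ℤ) :
    rankExp q (5 * m + b) = triCoeff ((q ^ 5) ^ 5) m ^ 3 * (-1) ^ b *
      ((q ^ 5) ^ ((3 * b - 5) * m) * q ^ (3 * tri b + b) -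
        (q ^ 5) ^ ((3 * b - 6) * m) * q ^ (3 * tri b)) := by
  have e1 : tri (5 * m + b) = 25 * tri m + 5 * ((b - 2) * m) + tri b := by
    have : 2 * tri (5 * m + b) = 2 * (25 * tri m + 5 * ((b - 2) * m) + tri b) := by
      linear_combination two_mul_tri (5 * m + b) - 25 * two_mul_tri m - two_mul_tri b
    omega
  have e2 : (-1 : ℂ) ^ (5 * m + b) = ((-1) ^ m) ^ 3 * (-1) ^ b := by
    rw [zpow_add₀ (by norm_num), ← zpow_natCast, ← zpow_mul, zpow_mul (-1 : ℂ) 5, mul_comm m,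
      zpow_mul]
    norm_num
  have e3 : ∀ k : ℤ, (q ^ 5) ^ k = q ^ (5 * k) := fun k => by rw [zpow_mul, zpow_ofNat]
  have e4 : ((q ^ 5) ^ 5) ^ tri m = q ^ (25 * tri m) := by
    rw [zpow_mul, zpow_ofNat, ← pow_mul]
  have e5 : (q ^ (25 * tri m)) ^ 3 = q ^ (75 * tri m) := by
    rw [← zpow_natCast, ← zpow_mul]; congr 1; push_cast; ring
  rw [rankExp, e2, triCoeff, e3, e3, e4, mul_pow, e5]
  have f1 : q ^ (3 * tri (5 * m + b) + (5 * m + b)) =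
      q ^ (75 * tri m) * (q ^ (5 * ((3 * b - 5) * m)) * q ^ (3 * tri b + b)) := by
    rw [← zpow_add₀ h0, ← zpow_add₀ h0, e1]; congr 1; ring
  have f2 : q ^ (3 * tri (5 * m + b)) =
      q ^ (75 * tri m) * (q ^ (5 * ((3 * b - 6) * m)) * q ^ (3 * tri b)) := by
    rw [← zpow_add₀ h0, ← zpow_add₀ h0, e1]; congr 1; ring
  rw [f1, f2]
  ring

set_option linter.unusedSimpArgs false in
lemma classOne_rankExp (h0 : q ≠ 0) (h1 : ‖q‖ < 1) {ζ : ℂ} (hζ : IsPrimitiveRoot ζ 5) (n : ℤ) :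
    classOne ζ (fun z => rankExp (z * q) n *
      cofactor (app (q ^ 5) 1 / app (q ^ 5) 2) (app (q ^ 5) 2 / app (q ^ 5) 1) (z * q)) =
      5 * (q * rankCoeff (q ^ 5) n) := by
  have hq5 := pow_ne_zero 5 h0
  have h15 := norm_pow_five_lt_one h1
  have n1 := app_ne_zero hq5 h15 (b := 1) (by norm_num) (by norm_num)
  have n2 := app_ne_zero hq5 h15 (b := 2) (by norm_num) (by norm_num)
  have gen : ∀ (m : ℤ) (b : ℕ) (i j : ℕ), 3 * tri b + b = i → 3 * tri b = j →
      classOne ζ (fun z => rankExp (z * q) (5 * m + b) *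
      cofactor (app (q ^ 5) 1 / app (q ^ 5) 2) (app (q ^ 5) 2 / app (q ^ 5) 1) (z * q)) =
      5 * (triCoeff ((q ^ 5) ^ 5) m ^ 3 * (-1) ^ b *
      ((q ^ 5) ^ ((3 * b - 5) * m) * q ^ i * cofactorComp (app (q ^ 5) 1 / app (q ^ 5) 2)
        (app (q ^ 5) 2 / app (q ^ 5) 1) q ((4 * i + 1) % 5)
      - (q ^ 5) ^ ((3 * b - 6) * m) * q ^ j * cofactorComp (app (q ^ 5) 1 / app (q ^ 5) 2)
        (app (q ^ 5) 2 / app (q ^ 5) 1) q ((4 * j + 1) % 5))) := by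
    intro m b i j hi hj
    set p := cofactorComp (app (q ^ 5) 1 / app (q ^ 5) 2) (app (q ^ 5) 2 / app (q ^ 5) 1) q
    rw [classOne_congr hζ (G := fun z =>
      (triCoeff ((q ^ 5) ^ 5) m ^ 3 * (-1) ^ b * ((q ^ 5) ^ ((3 * b - 5) * m) * q ^ i)) *
        (z ^ i * ∑ i ∈ Finset.range 5, p i * z ^ i) +
      -(triCoeff ((q ^ 5) ^ 5) m ^ 3 * (-1) ^ b * ((q ^ 5) ^ ((3 * b - 6) * m) * q ^ j)) *
        (z ^ j * ∑ i ∈ Finset.range 5, p i * z ^ i)), classOne_add, classOne_mul, classOne_mul,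
      classOne_pow_mul hζ, classOne_pow_mul hζ]
    · ring
    · intro z hz
      have hz0 : z ≠ 0 := by rintro rfl; norm_num at hz
      have e : (z * q) ^ 5 = q ^ 5 := by rw [mul_pow, hz, one_mul]
      rw [cofactor_eq_sum _ _ _ hz, rankExp_five_mul_add (mul_ne_zero hz0 h0), e, hi, hj]
      simp only [zpow_natCast, mul_pow]
      ring
  have a3 : appell ((q ^ 5) ^ 5) ((q ^ 5) ^ 3) = app (q ^ 5) 2 := app_three hq5 h15
  have a4 : appell ((q ^ 5) ^ 5) ((q ^ 5) ^ 4) = app (q ^ 5) 1 := app_four hq5 h15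
  have a1 : appell ((q ^ 5) ^ 5) (q ^ 5) = app (q ^ 5) 1 := by rw [app, pow_one]
  have a2 : appell ((q ^ 5) ^ 5) ((q ^ 5) ^ 2) = app (q ^ 5) 2 := rfl
  have i1 : appell ((q ^ 5) ^ 5) (q ^ 5)⁻¹ = -q ^ 5 * app (q ^ 5) 1 := by
    rw [appell_inv (pow_ne_zero 5 hq5) hq5, a1]
  have i2 : appell ((q ^ 5) ^ 5) ((q ^ 5) ^ 2)⁻¹ = -(q ^ 5) ^ 2 * app (q ^ 5) 2 := by
    rw [appell_inv (pow_ne_zero 5 hq5) (pow_ne_zero 2 hq5), a2]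
  have i3 : appell ((q ^ 5) ^ 5) ((q ^ 5) ^ 3)⁻¹ = -(q ^ 5) ^ 3 * app (q ^ 5) 2 := by
    rw [appell_inv (pow_ne_zero 5 hq5) (pow_ne_zero 3 hq5), a3]
  have i4 : appell ((q ^ 5) ^ 5) ((q ^ 5) ^ 4)⁻¹ = -(q ^ 5) ^ 4 * app (q ^ 5) 1 := by
    rw [appell_inv (pow_ne_zero 5 hq5) (pow_ne_zero 4 hq5), a4]
  obtain ⟨m, b, hb, rfl⟩ : ∃ (m : ℤ) (b : ℕ), b < 5 ∧ n = 5 * m + b :=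
    ⟨n / 5, (n % 5).toNat, by omega, by omega⟩
  have t1 : tri 1 = 1 := rfl
  have t2 : tri 2 = 3 := rfl
  have t3 : tri 3 = 6 := rfl
  have t4 : tri 4 = 10 := rfl
  have d : ∀ b : ℤ, 0 ≤ b → b < 5 → (5 * m + b) / 5 = m := fun b _ _ => by omega
  have r : ∀ b : ℤ, 0 ≤ b → b < 5 → (5 * m + b) % 5 = b := fun b _ _ => by omega
  interval_cases b
  · rw [gen m 0 0 0 rfl rfl]
    simp only [rankCoeff, combCoeff, tripleSum, tripleCoeff]
    have := d 0 (by norm_num) (by norm_num)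
    have := r 0 (by norm_num) (by norm_num)
    simp only [Nat.cast_ofNat, Nat.cast_zero, Nat.cast_one, *]
    norm_num
    norm_cast
    simp only [a1, a2, a3, a4, i1, i2, i3, i4, cofactorComp]
    generalize triCoeff ((q ^ 5) ^ 5) m = c, app (q ^ 5) 1 = u, app (q ^ 5) 2 = v at n1 n2 ⊢
    generalize (((q ^ 5) ^ (5 * m))⁻¹) = w0
    generalize (((q ^ 5) ^ (6 * m))⁻¹) = w1
    field_simp
    ring
  · rw [gen m 1 4 3 rfl rfl]
    simp only [rankCoeff, combCoeff, tripleSum, tripleCoeff]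
    have := d 1 (by norm_num) (by norm_num)
    have := r 1 (by norm_num) (by norm_num)
    simp only [Nat.cast_ofNat, Nat.cast_zero, Nat.cast_one, *]
    norm_num
    norm_cast
    simp only [a1, a2, a3, a4, i1, i2, i3, i4, cofactorComp]
    generalize triCoeff ((q ^ 5) ^ 5) m = c, app (q ^ 5) 1 = u, app (q ^ 5) 2 = v at n1 n2 ⊢
    generalize ((q ^ 5) ^ (2 * m))⁻¹ = w0
    generalize ((q ^ 5) ^ (3 * m))⁻¹ = w1
    field_simp
    ring
  · rw [gen m 2 11 9 rfl rfl]
    simp only [rankCoeff, combCoeff, tripleSum, tripleCoeff]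
    have := d 2 (by norm_num) (by norm_num)
    have := r 2 (by norm_num) (by norm_num)
    simp only [Nat.cast_ofNat, Nat.cast_zero, Nat.cast_one, *]
    norm_num
    norm_cast
    simp only [a1, a2, a3, a4, i1, i2, i3, i4, cofactorComp]
    generalize triCoeff ((q ^ 5) ^ 5) m = c, app (q ^ 5) 1 = u, app (q ^ 5) 2 = v at n1 n2 ⊢
    generalize (q ^ 5) ^ m = w0
    field_simp
    ring
  · rw [gen m 3 21 18 rfl rfl]
    simp only [rankCoeff, combCoeff, tripleSum, tripleCoeff]
    have := d 3 (by norm_num) (by norm_num)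
    have := r 3 (by norm_num) (by norm_num)
    simp only [Nat.cast_ofNat, Nat.cast_zero, Nat.cast_one, *]
    norm_num
    norm_cast
    simp only [a1, a2, a3, a4, i1, i2, i3, i4, cofactorComp]
    generalize triCoeff ((q ^ 5) ^ 5) m = c, app (q ^ 5) 1 = u, app (q ^ 5) 2 = v at n1 n2 ⊢
    generalize (q ^ 5) ^ (4 * m) = w0
    generalize (q ^ 5) ^ (3 * m) = w1
    field_simp
    ring
  · rw [gen m 4 34 30 rfl rfl]
    simp only [rankCoeff, combCoeff, tripleSum, tripleCoeff]
    have := d 4 (by norm_num) (by norm_num)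
    have := r 4 (by norm_num) (by norm_num)
    simp only [Nat.cast_ofNat, Nat.cast_zero, Nat.cast_one, *]
    norm_num
    norm_cast
    simp only [a1, a2, a3, a4, i1, i2, i3, i4, cofactorComp]
    generalize triCoeff ((q ^ 5) ^ 5) m = c, app (q ^ 5) 1 = u, app (q ^ 5) 2 = v at n1 n2 ⊢
    generalize (q ^ 5) ^ (7 * m) = w0
    generalize (q ^ 5) ^ (6 * m) = w1
    field_simp
    ring

end

section

open Filter Topology

/-! ### The rank series -/

variable {q : ℂ}

/-- The rational weights of the rank generating function, in base `y`. -/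
noncomputable def rankWeight (y : ℂ) (n : ℤ) : ℂ := 2 * frac y 1 n + 5 * (y ^ n * frac y 1 n ^ 2)

/-- The weighted theta series whose quotient by `poch q q` generates the rank side. -/
noncomputable def rankTheta (q : ℂ) : ℂ := ∑' n : ℤ, rankExp q n * rankWeight (q ^ 5) n

lemma exists_norm_rankWeight_le {y : ℂ} (h0 : y ≠ 0) (h1 : ‖y‖ < 1) :
    (∃ C, ∀ n, ‖frac y 1 n‖ ≤ C) ∧ ∃ C, ∀ n, ‖y ^ n * frac y 1 n ^ 2‖ ≤ C := by
  obtain ⟨C, hC⟩ := exists_norm_frac_le h0 h1 one_ne_zero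
  refine ⟨⟨C, hC⟩, C * C, fun n => ?_⟩
  have e : y ^ n * frac y 1 n ^ 2 = -(frac y 1 n * frac y 1 (-n)) := by
    rw [frac_neg h0 one_ne_zero, inv_one]; ring
  rw [e, norm_neg, norm_mul]
  exact mul_le_mul (hC _) (hC _) (norm_nonneg _) ((norm_nonneg _).trans (hC 0))

lemma summable_rankExp (h0 : q ≠ 0) (h1 : ‖q‖ < 1) : Summable fun n : ℤ => ‖rankExp q n‖ := by
  have h3 : ‖q ^ 3‖ < 1 := by
    rw [norm_pow]; exact pow_lt_one₀ (norm_nonneg _) h1 (by norm_num)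
  have s1 := summable_zpow_tri_mul_zpow (pow_ne_zero 3 h0) h3 h0
  have s2 := summable_zpow_tri_mul_zpow (pow_ne_zero 3 h0) h3 one_ne_zero
  refine Summable.of_nonneg_of_le (fun _ => norm_nonneg _) (fun n => ?_) (s1.add s2)
  have e : ∀ k : ℤ, (q ^ 3) ^ k = q ^ (3 * k) := fun k => by rw [zpow_mul, zpow_ofNat]
  rw [rankExp, norm_mul, norm_zpow, norm_neg, norm_one, one_zpow, one_mul, e, ← zpow_add₀ h0,
    one_zpow, mul_one]
  exact norm_sub_le _ _

lemma exists_norm_rankWeight_le' {y : ℂ} (h0 : y ≠ 0) (h1 : ‖y‖ < 1) :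
    ∃ C, ∀ n, ‖rankWeight y n‖ ≤ C := by
  obtain ⟨⟨C, hC⟩, D, hD⟩ := exists_norm_rankWeight_le h0 h1
  refine ⟨2 * C + 5 * D, fun n => (norm_add_le _ _).trans ?_⟩
  rw [norm_mul, norm_mul 5, Complex.norm_ofNat, Complex.norm_ofNat]
  linarith [hC n, hD n]

lemma summable_rankTheta (h0 : q ≠ 0) (h1 : ‖q‖ < 1) :
    Summable fun n : ℤ => rankExp q n * rankWeight (q ^ 5) n := by
  obtain ⟨C, hC⟩ := exists_norm_rankWeight_le' (pow_ne_zero 5 h0) (norm_pow_five_lt_one h1)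
  exact (summable_norm_mul_of_bdd (summable_rankExp h0 h1) hC).of_norm

lemma classOne_tsum {ζ : ℂ} {F : ℂ → ℤ → ℂ} (h : ∀ k : ℕ, Summable (F (ζ ^ k))) :
    classOne ζ (fun z => ∑' n, F z n) = ∑' n, classOne ζ (fun z => F z n) := by
  simp only [classOne]
  rw [Summable.tsum_finsetSum fun k _ => (h k).mul_left _]
  exact Finset.sum_congr rfl fun k _ => tsum_mul_left.symm

lemma classOne_rankTheta (h0 : q ≠ 0) (h1 : ‖q‖ < 1) {ζ : ℂ} (hζ : IsPrimitiveRoot ζ 5) :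
    classOne ζ (fun z => rankTheta (z * q) / poch (z * q) (z * q)) *
      poch ((q ^ 5) ^ 5) ((q ^ 5) ^ 5) =
    5 * (q * (app (q ^ 5) 1 * (lam (q ^ 5) 1 - 2 * lam (q ^ 5) 2) -
      2 * q ^ 5 * app (q ^ 5) 2 ^ 3 / app (q ^ 5) 1)) := by
  have hq5 := pow_ne_zero 5 h0
  have h15 := norm_pow_five_lt_one h1
  have n1 := app_ne_zero hq5 h15 (b := 1) (by norm_num) (by norm_num)
  have n2 := app_ne_zero hq5 h15 (b := 2) (by norm_num) (by norm_num)
  have hJ := poch_five_ne_zero h15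
  set a := app (q ^ 5) 1 / app (q ^ 5) 2 with ha
  set b := app (q ^ 5) 2 / app (q ^ 5) 1 with hb
  set J := poch ((q ^ 5) ^ 5) ((q ^ 5) ^ 5) with hJd
  have hab : a * b = 1 := by rw [ha, hb]; field_simp
  have hz5 : ∀ z : ℂ, z ^ 5 = 1 → z ≠ 0 ∧ z * q ≠ 0 ∧ ‖z * q‖ < 1 ∧ (z * q) ^ 5 = q ^ 5 := by
    intro z hz
    have hz0 : z ≠ 0 := by rintro rfl; norm_num at hz
    have hn : ‖z‖ = 1 := Complex.norm_eq_one_of_pow_eq_one hz (by norm_num)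
    exact ⟨hz0, mul_ne_zero hz0 h0, by rw [norm_mul, hn, one_mul]; exact h1,
      by rw [mul_pow, hz, one_mul]⟩
  have hp : ∀ z : ℂ, z ^ 5 = 1 → poch (z * q) (z * q) = J * (a - z * q - (z * q) ^ 2 * b) := by
    intro z hz
    obtain ⟨-, hz0, hz1, e⟩ := hz5 z hz
    rw [poch_eq_ratio hz0 hz1, e]
  have hpn : ∀ z : ℂ, z ^ 5 = 1 → a - z * q - (z * q) ^ 2 * b ≠ 0 := by
    intro z hz h
    obtain ⟨-, hz0, hz1, e⟩ := hz5 z hz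
    refine poch_ne_zero_of_norm_lt_one hz1 hz1 ?_
    rw [hp z hz, h, mul_zero]
  have hroot : ∀ k : ℕ, (ζ ^ k) ^ 5 = 1 := fun k => by
    rw [← pow_mul, mul_comm, pow_mul, hζ.pow_eq_one, one_pow]
  have hN : a ^ 5 - 11 * q ^ 5 - (q ^ 5) ^ 2 * b ^ 5 ≠ 0 := by
    have es : 1 + ζ + ζ ^ 2 + ζ ^ 3 + ζ ^ 4 = 0 := by
      have := hζ.geom_sum_eq_zero (by norm_num)
      simpa [Finset.sum_range_succ] using this
    rw [← mul_cofactor hab, cofactor_eq_prod hab hζ.pow_eq_one es]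
    have k1 := hpn 1 (one_pow 5)
    have k2 := hpn ζ hζ.pow_eq_one
    rw [one_mul] at k1
    exact mul_ne_zero k1 (mul_ne_zero (mul_ne_zero k2 (hpn _ (hroot 4)))
      (mul_ne_zero (hpn _ (hroot 2)) (hpn _ (hroot 3))))
  have main : (J * (a ^ 5 - 11 * q ^ 5 - (q ^ 5) ^ 2 * b ^ 5)) *
      classOne ζ (fun z => rankTheta (z * q) / poch (z * q) (z * q)) =
      ∑' n : ℤ, 5 * (q * rankCoeff (q ^ 5) n) * rankWeight (q ^ 5) n := by
    rw [← classOne_mul, classOne_congr hζ (G := fun z => ∑' n : ℤ, rankWeight (q ^ 5) n *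
      (rankExp (z * q) n * cofactor a b (z * q))), classOne_tsum]
    · refine tsum_congr fun n => ?_
      rw [classOne_mul, classOne_rankExp h0 h1 hζ]
      ring
    · intro k
      obtain ⟨-, hz0, hz1, e⟩ := hz5 _ (hroot k)
      refine ((summable_rankTheta hz0 hz1).mul_right (cofactor a b (ζ ^ k * q))).congr fun n => ?_
      rw [e]
      ring
    · intro z hz
      obtain ⟨-, hz0, hz1, e⟩ := hz5 z hz
      have e1 : ∑' n : ℤ, rankWeight (q ^ 5) n * (rankExp (z * q) n * cofactor a b (z * q)) =
          rankTheta (z * q) * cofactor a b (z * q) := by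
        rw [rankTheta, ← tsum_mul_right, e]
        exact tsum_congr fun n => by ring
      rw [e1, ← e, ← mul_cofactor hab, hp z hz]
      have := hpn z hz
      generalize a - z * q - (z * q) ^ 2 * b = d at this ⊢
      field_simp
  have hs := summable_combCoeff hq5 h15
    (q ^ 5 * (3 * a + q ^ 5 * b ^ 4) / (app (q ^ 5) 1 * app (q ^ 5) 2))
    (-(a ^ 3 + 2 * q ^ 5 * b ^ 2) / (app (q ^ 5) 1 * app (q ^ 5) 2))
    (-(2 * a ^ 2 - q ^ 5 * b ^ 3) / (app (q ^ 5) 1 * app (q ^ 5) 2))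
    ((a ^ 4 - 3 * q ^ 5 * b) / (app (q ^ 5) 1 * app (q ^ 5) 2))
  change Summable fun n => ‖rankCoeff (q ^ 5) n‖ at hs
  obtain ⟨⟨C, hC⟩, D, hD⟩ := exists_norm_rankWeight_le hq5 h15
  have s1 := (summable_norm_mul_of_bdd hs hC).of_norm
  have s2 := (summable_norm_mul_of_bdd hs hD).of_norm
  have split : ∑' n : ℤ, 5 * (q * rankCoeff (q ^ 5) n) * rankWeight (q ^ 5) n =
      5 * q * (2 * ∑' n, rankCoeff (q ^ 5) n * frac (q ^ 5) 1 n +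
      5 * ∑' n, rankCoeff (q ^ 5) n * ((q ^ 5) ^ n * frac (q ^ 5) 1 n ^ 2)) := by
    rw [← tsum_mul_left (a := (2 : ℂ)), ← tsum_mul_left (a := (5 : ℂ)),
      ← (s1.mul_left 2).tsum_add (s2.mul_left 5), ← tsum_mul_left]
    refine tsum_congr fun n => ?_
    rw [rankWeight]
    ring
  rw [split, rankCoeff_identity hq5 h15 n1 n2, ← ha, ← hb] at main
  refine mul_left_cancel₀ hN ?_
  linear_combination main

end

section

open Filter Topology

/-! ### The crank series -/

variable {q : ℂ}

lemma lam_dissect (h0 : q ≠ 0) (h1 : ‖q‖ < 1) {a : ℕ} (ha : 0 < a) (ha5 : a < 5) :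
    lam q a = lam (q ^ 5) a + q ^ a * kron ((q ^ 5) ^ 5) ((q ^ 5) ^ 1) ((q ^ 5) ^ a) +
      q ^ (2 * a) * kron ((q ^ 5) ^ 5) ((q ^ 5) ^ 2) ((q ^ 5) ^ a) +
      q ^ (3 * a) * kron ((q ^ 5) ^ 5) ((q ^ 5) ^ 3) ((q ^ 5) ^ a) +
      q ^ (4 * a) * kron ((q ^ 5) ^ 5) ((q ^ 5) ^ 4) ((q ^ 5) ^ a) := by
  have hq5 := pow_ne_zero 5 h0
  have h15 := norm_pow_five_lt_one h1
  have H : ∀ b : ℤ, HasSum (fun m : ℤ => (q ^ a) ^ (5 * m + b) * frac (q ^ 5) 1 (5 * m + b))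
      ((q ^ a) ^ b * kron ((q ^ 5) ^ 5) ((q ^ 5) ^ b) ((q ^ 5) ^ a)) := by
    intro b
    have hs := (summable_norm_zpow_mul_frac (pow_ne_zero 5 hq5) (norm_pow_five_lt_one h15)
      (norm_pow_five_lt_norm_pow hq5 h15 ha5) (norm_pow_lt_one_of_pos h15 ha)
      (zpow_ne_zero b hq5)).of_norm.hasSum
    have e : ∀ m : ℤ, (q ^ a) ^ (5 * m + b) * frac (q ^ 5) 1 (5 * m + b) =
        (q ^ a) ^ b * (((q ^ 5) ^ a) ^ m * frac ((q ^ 5) ^ 5) ((q ^ 5) ^ b) m) := fun m => by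
      rw [← frac_pow_five hq5, one_mul, zpow_add₀ (pow_ne_zero a h0), zpow_mul, zpow_ofNat,
        ← pow_mul, ← pow_mul, mul_comm a 5]
      ring_nf
    simp_rw [e]
    exact hs.mul_left _
  have := (hasSum_five (f := fun n => (q ^ a) ^ n * frac (q ^ 5) 1 n)
    (s := fun b => (q ^ a) ^ b * kron ((q ^ 5) ^ 5) ((q ^ 5) ^ b) ((q ^ 5) ^ a))
    fun b _ _ => H b).tsum_eq
  rw [lam, kron, this]
  rw [lam, zpow_zero, zpow_zero, zpow_one, zpow_one, one_mul, pow_one]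
  have p : ∀ k : ℕ, q ^ (k * a) = (q ^ a) ^ k := fun k => by rw [← pow_mul, mul_comm]
  rw [p, p, p]
  simp only [zpow_ofNat]

lemma lam_one_dissect (h0 : q ≠ 0) (h1 : ‖q‖ < 1) :
    lam q 1 = lam (q ^ 5) 1 + q * (app (q ^ 5) 1 ^ 2 / app (q ^ 5) 2) +
      q ^ 2 * app (q ^ 5) 1 + q ^ 3 * app (q ^ 5) 2 := by
  have hq5 := pow_ne_zero 5 h0
  have h15 := norm_pow_five_lt_one h1
  have n1 := app_ne_zero hq5 h15 (b := 1) (by norm_num) (by norm_num)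
  have n2 := app_ne_zero hq5 h15 (b := 2) (by norm_num) (by norm_num)
  have c : ∀ b : ℕ, 0 < b → b < 5 → ‖(q ^ 5) ^ 5‖ < ‖(q ^ 5) ^ b‖ ∧ ‖(q ^ 5) ^ b‖ < 1 :=
    fun b hb hb5 => ⟨norm_pow_five_lt_norm_pow hq5 h15 hb5, norm_pow_lt_one_of_pos h15 hb⟩
  have k3 : kron ((q ^ 5) ^ 5) ((q ^ 5) ^ 3) ((q ^ 5) ^ 1) = app (q ^ 5) 2 := by
    rw [kron_comm (pow_ne_zero 5 hq5) (norm_pow_five_lt_one h15) (c 3 (by norm_num) (by norm_num)).1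
      (c 3 (by norm_num) (by norm_num)).2 (c 1 (by norm_num) (by norm_num)).1
      (c 1 (by norm_num) (by norm_num)).2, kron_one_three hq5 h15 n1]
  rw [lam_dissect h0 h1 (a := 1) (by norm_num) (by norm_num), kron_one_one hq5 h15 n2,
    kron_two_one hq5 h15 n2, k3, kron_pow_eq_zero hq5 h15 (by norm_num) (by norm_num) (by norm_num)]
  ring

lemma lam_two_dissect (h0 : q ≠ 0) (h1 : ‖q‖ < 1) :
    lam q 2 = lam (q ^ 5) 2 + q ^ 2 * app (q ^ 5) 1 - q ^ 3 * app (q ^ 5) 2 +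
      q ^ 4 * (app (q ^ 5) 2 ^ 2 / app (q ^ 5) 1) := by
  have hq5 := pow_ne_zero 5 h0
  have h15 := norm_pow_five_lt_one h1
  have n1 := app_ne_zero hq5 h15 (b := 1) (by norm_num) (by norm_num)
  have n2 := app_ne_zero hq5 h15 (b := 2) (by norm_num) (by norm_num)
  have c : ∀ b : ℕ, 0 < b → b < 5 → ‖(q ^ 5) ^ 5‖ < ‖(q ^ 5) ^ b‖ ∧ ‖(q ^ 5) ^ b‖ < 1 :=
    fun b hb hb5 => ⟨norm_pow_five_lt_norm_pow hq5 h15 hb5, norm_pow_lt_one_of_pos h15 hb⟩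
  have k4 : kron ((q ^ 5) ^ 5) ((q ^ 5) ^ 4) ((q ^ 5) ^ 2) = -app (q ^ 5) 2 / q ^ 5 := by
    rw [kron_comm (pow_ne_zero 5 hq5) (norm_pow_five_lt_one h15) (c 4 (by norm_num) (by norm_num)).1
      (c 4 (by norm_num) (by norm_num)).2 (c 2 (by norm_num) (by norm_num)).1
      (c 2 (by norm_num) (by norm_num)).2, kron_two_four hq5 h15 n1]
  rw [lam_dissect h0 h1 (a := 2) (by norm_num) (by norm_num), kron_one_two hq5 h15 n2,
    kron_two_two hq5 h15 n1, k4, kron_pow_eq_zero hq5 h15 (by norm_num) (by norm_num) (by norm_num)]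
  field_simp
  ring

/-- The generating function of the crank side. -/
noncomputable def crankSeries (q : ℂ) : ℂ :=
  poch q q / poch (q ^ 5) (q ^ 5) *
    (thB (q ^ 5) 2 * lam q 2 + q * thB (q ^ 5) 1 * (lam q 1 - lam q 2))

lemma crankSeries_mul (h0 : q ≠ 0) (h1 : ‖q‖ < 1) :
    crankSeries q * poch ((q ^ 5) ^ 5) ((q ^ 5) ^ 5) =
      (app (q ^ 5) 1 / app (q ^ 5) 2 - q - q ^ 2 * (app (q ^ 5) 2 / app (q ^ 5) 1)) *
      (app (q ^ 5) 1 * lam q 2 + q * app (q ^ 5) 2 * (lam q 1 - lam q 2)) := by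
  have hq5 := pow_ne_zero 5 h0
  have h15 := norm_pow_five_lt_one h1
  have hJ := poch_five_ne_zero h15
  have hY := poch_five_ne_zero h1
  have b1 := thB_ne_zero hq5 h15 (b := 1) (by norm_num) (by norm_num)
  have b2 := thB_ne_zero hq5 h15 (b := 2) (by norm_num) (by norm_num)
  have e1 := app_mul_thB hq5 h15 (b := 1) (by norm_num) (by norm_num)
  have e2 := app_mul_thB hq5 h15 (b := 2) (by norm_num) (by norm_num)
  have e3 := thB_mul_thB hq5 h15
  rw [crankSeries, poch_eq_ratio h0 h1]
  generalize app (q ^ 5) 1 / app (q ^ 5) 2 - q - q ^ 2 * (app (q ^ 5) 2 / app (q ^ 5) 1) = F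
  generalize poch ((q ^ 5) ^ 5) ((q ^ 5) ^ 5) = J at *
  generalize poch (q ^ 5) (q ^ 5) = Y at *
  generalize thB (q ^ 5) 1 = B1 at *
  generalize thB (q ^ 5) 2 = B2 at *
  generalize app (q ^ 5) 1 = A1 at *
  generalize app (q ^ 5) 2 = A2 at *
  have f1 : J ^ 2 * B2 = Y * A1 := by
    refine mul_left_cancel₀ (mul_ne_zero hJ b1) ?_
    linear_combination J ^ 3 * e3 - J * Y * e1
  have f2 : J ^ 2 * B1 = Y * A2 := by
    refine mul_left_cancel₀ (mul_ne_zero hJ b2) ?_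
    linear_combination J ^ 3 * e3 - J * Y * e2
  have : J * F / Y * (B2 * lam q 2 + q * B1 * (lam q 1 - lam q 2)) * J =
      F / Y * ((J ^ 2 * B2) * lam q 2 + q * (J ^ 2 * B1) * (lam q 1 - lam q 2)) := by ring
  rw [this, f1, f2]
  field_simp

lemma classOne_sum_pow {ζ : ℂ} (hζ : IsPrimitiveRoot ζ 5) (c : ℕ → ℂ) :
    classOne ζ (fun z => ∑ i ∈ Finset.range 8, c i * z ^ i) = 5 * (c 1 + c 6) := by
  have : classOne ζ (fun z => ∑ i ∈ Finset.range 8, c i * z ^ i) =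
      ∑ i ∈ Finset.range 8, c i * classOne ζ (fun z => z ^ i) := by
    simp only [classOne, Finset.mul_sum]
    rw [Finset.sum_comm]
    exact Finset.sum_congr rfl fun i _ => Finset.sum_congr rfl fun k _ => by ring
  rw [this]
  simp_rw [classOne_pow hζ]
  simp [Finset.sum_range_succ]
  ring

lemma classOne_crankSeries (h0 : q ≠ 0) (h1 : ‖q‖ < 1) {ζ : ℂ} (hζ : IsPrimitiveRoot ζ 5) :
    classOne ζ (fun z => crankSeries (z * q)) * poch ((q ^ 5) ^ 5) ((q ^ 5) ^ 5) =
    5 * (q * (app (q ^ 5) 1 * (lam (q ^ 5) 1 - 2 * lam (q ^ 5) 2) -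
      2 * q ^ 5 * app (q ^ 5) 2 ^ 3 / app (q ^ 5) 1)) := by
  have hq5 := pow_ne_zero 5 h0
  have h15 := norm_pow_five_lt_one h1
  have n1 := app_ne_zero hq5 h15 (b := 1) (by norm_num) (by norm_num)
  have n2 := app_ne_zero hq5 h15 (b := 2) (by norm_num) (by norm_num)
  set u := app (q ^ 5) 1 with hu
  set v := app (q ^ 5) 2 with hv
  set a := lam (q ^ 5) 1 with ha
  set b := lam (q ^ 5) 2 with hb
  have key : ∀ z : ℂ, z ^ 5 = 1 →
      poch ((q ^ 5) ^ 5) ((q ^ 5) ^ 5) * crankSeries (z * q) = ∑ i ∈ Finset.range 8,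
      (![u / v * (u * b), u / v * (v * (a - b)) - u * b,
        2 * u ^ 2 * (u / v) - v * (a - b) - v / u * (u * b),
        -u * v * (u / v) - 2 * u ^ 2 - v / u * (v * (a - b)),
        3 * v ^ 2 * (u / v) + u * v - v / u * (2 * u ^ 2),
        -v ^ 3 / u * (u / v) - 3 * v ^ 2 + v / u * (u * v),
        v ^ 3 / u - v / u * (3 * v ^ 2), v / u * (v ^ 3 / u)] (Fin.ofNat 8 i) * q ^ i) * z ^ i := by
    intro z hz
    have hz0 : z ≠ 0 := by rintro rfl; norm_num at hz
    have hn : ‖z‖ = 1 := Complex.norm_eq_one_of_pow_eq_one hz (by norm_num)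
    have g0 := mul_ne_zero hz0 h0
    have g1 : ‖z * q‖ < 1 := by rw [norm_mul, hn, one_mul]; exact h1
    have e : (z * q) ^ 5 = q ^ 5 := by rw [mul_pow, hz, one_mul]
    have := crankSeries_mul g0 g1
    rw [lam_one_dissect g0 g1, lam_two_dissect g0 g1, e, ← hu, ← hv, ← ha, ← hb] at this
    rw [mul_comm, this]
    simp only [Finset.sum_range_succ, Finset.sum_range_zero]
    simp [Fin.ofNat]
    field_simp
    ring
  rw [mul_comm, ← classOne_mul, classOne_congr hζ key, classOne_sum_pow hζ]
  simp [Fin.ofNat]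
  field_simp
  ring

end

section

open Filter Topology

/-! ### Generating functions of weighted partitions -/

variable {q : ℂ}

/-- The power series `φ` converges absolutely at `q`, with value `v`. -/
def HasEval (φ : PowerSeries ℂ) (q v : ℂ) : Prop :=
  (Summable fun n => ‖PowerSeries.coeff n φ * q ^ n‖) ∧
    HasSum (fun n => PowerSeries.coeff n φ * q ^ n) v

lemma HasEval.one (q : ℂ) : HasEval 1 q 1 := by
  have h : ∀ n, n ≠ 0 → PowerSeries.coeff n (1 : PowerSeries ℂ) * q ^ n = 0 := fun n hn => by
    rw [PowerSeries.coeff_one, if_neg hn, zero_mul]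
  refine ⟨summable_of_ne_finset_zero (s := {0}) fun n hn => ?_, ?_⟩
  · rw [h n (by simpa using hn), norm_zero]
  · convert hasSum_single 0 h
    simp

lemma HasEval.mul {φ ψ : PowerSeries ℂ} {v w : ℂ} (hφ : HasEval φ q v) (hψ : HasEval ψ q w) :
    HasEval (φ * ψ) q (v * w) := by
  have e : ∀ n, PowerSeries.coeff n (φ * ψ) * q ^ n = ∑ kl ∈ Finset.HasAntidiagonal.antidiagonal n,
      (PowerSeries.coeff kl.1 φ * q ^ kl.1) * (PowerSeries.coeff kl.2 ψ * q ^ kl.2) := by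
    intro n
    rw [PowerSeries.coeff_mul, Finset.sum_mul]
    refine Finset.sum_congr rfl fun kl hkl => ?_
    rw [← Finset.HasAntidiagonal.mem_antidiagonal.1 hkl, pow_add]
    ring
  have hs := summable_norm_sum_mul_antidiagonal_of_summable_norm hφ.1 hψ.1
  have hv := tsum_mul_tsum_eq_tsum_sum_antidiagonal_of_summable_norm hφ.1 hψ.1
  rw [hφ.2.tsum_eq, hψ.2.tsum_eq] at hv
  unfold HasEval
  simp_rw [e]
  exact ⟨hs, hv ▸ hs.of_norm.hasSum⟩

lemma HasEval.prod {φ : ℕ → PowerSeries ℂ} {v : ℕ → ℂ} (h : ∀ i, HasEval (φ i) q (v i)) (N : ℕ) :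
    HasEval (∏ i ∈ Finset.range N, φ i) q (∏ i ∈ Finset.range N, v i) := by
  induction N with
  | zero => simpa using HasEval.one q
  | succ N ih =>
    rw [Finset.prod_range_succ, Finset.prod_range_succ]
    exact ih.mul (h N)

open scoped PowerSeries.WithPiTopology in
/-- The factor of the partition generating function belonging to the part `i + 1`. -/
noncomputable def partFactor (f : ℕ → ℕ → ℂ) (i : ℕ) : PowerSeries ℂ :=
  1 + ∑' j, f (i + 1) (j + 1) • (PowerSeries.X : PowerSeries ℂ) ^ ((i + 1) * (j + 1))

/-- The value at `q` of the factor of the partition generating function for the part `i + 1`. -/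
noncomputable def partSum (f : ℕ → ℕ → ℂ) (q : ℂ) (i : ℕ) : ℂ :=
  ∑' c : ℕ, (if c = 0 then 1 else f (i + 1) c) * q ^ ((i + 1) * c)

open scoped PowerSeries.WithPiTopology in
lemma coeff_partFactor (f : ℕ → ℕ → ℂ) (i n : ℕ) : PowerSeries.coeff n (partFactor f i) =
    if (i + 1) ∣ n then (if n / (i + 1) = 0 then 1 else f (i + 1) (n / (i + 1))) else 0 := by
  rw [partFactor, map_add, (Nat.Partition.summable_genFun_term f i).map_tsum _
    (PowerSeries.WithPiTopology.continuous_coeff _ _)]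
  simp only [map_smul, PowerSeries.coeff_X_pow, PowerSeries.coeff_one, smul_eq_mul, mul_ite,
    mul_one, mul_zero]
  rcases eq_or_ne n 0 with rfl | h1
  · simp
  rw [if_neg h1, zero_add]
  by_cases h2 : (i + 1) ∣ n
  · obtain ⟨k, rfl⟩ := h2
    have hk : k ≠ 0 := by rintro rfl; simp at h1
    rw [if_pos (dvd_mul_right _ _), Nat.mul_div_cancel_left _ (Nat.succ_pos i), if_neg hk,
      tsum_eq_single (k - 1), Nat.sub_add_cancel (Nat.pos_of_ne_zero hk), if_pos rfl]
    intro j hj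
    rw [if_neg]
    intro h
    exact hj (by have := Nat.eq_of_mul_eq_mul_left (Nat.succ_pos i) h; omega)
  · rw [if_neg h2]
    convert tsum_zero with j
    rw [if_neg]
    rintro rfl
    exact h2 (dvd_mul_right _ _)

lemma hasEval_partFactor (h1 : ‖q‖ < 1) {f : ℕ → ℕ → ℂ} (hf : ∀ i c, ‖f i c‖ ≤ 1) (i : ℕ) :
    HasEval (partFactor f i) q (partSum f q i) := by
  have hb : ∀ n, ‖PowerSeries.coeff n (partFactor f i)‖ ≤ 1 := fun n => by
    rw [coeff_partFactor]
    split_ifs <;> simp [hf]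
  have hs : Summable fun n => ‖PowerSeries.coeff n (partFactor f i) * q ^ n‖ := by
    refine Summable.of_nonneg_of_le (fun _ => norm_nonneg _) (fun n => ?_)
      (summable_geometric_of_lt_one (norm_nonneg q) h1)
    rw [norm_mul, norm_pow]
    exact mul_le_of_le_one_left (by positivity) (hb n)
  refine ⟨hs, ?_⟩
  have hinj : Function.Injective fun c : ℕ => (i + 1) * c :=
    fun a b h => Nat.eq_of_mul_eq_mul_left (Nat.succ_pos i) h
  have hsupp : ∀ n, n ∉ Set.range (fun c : ℕ => (i + 1) * c) →
      PowerSeries.coeff n (partFactor f i) * q ^ n = 0 := by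
    intro n hn
    rw [coeff_partFactor, if_neg, zero_mul]
    rintro ⟨c, rfl⟩
    exact hn ⟨c, rfl⟩
  have e : partSum f q i = ∑' n, PowerSeries.coeff n (partFactor f i) * q ^ n := by
    rw [← hinj.tsum_eq (f := fun n => PowerSeries.coeff n (partFactor f i) * q ^ n)
      fun n hn => by_contra fun h => hn (hsupp n h), partSum]
    refine tsum_congr fun c => ?_
    rw [coeff_partFactor, if_pos (dvd_mul_right _ _), Nat.mul_div_cancel_left _ (Nat.succ_pos i)]
  rw [e]
  exact hs.of_norm.hasSum

open scoped PowerSeries.WithPiTopology in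
lemma hasEval_genFun (h1 : ‖q‖ < 1) {f : ℕ → ℕ → ℂ} (hf : ∀ i c, ‖f i c‖ ≤ 1) (N : ℕ) :
    HasEval (Nat.Partition.genFun fun i c => if i ≤ N then f i c else 0) q
      (∏ i ∈ Finset.range N, partSum f q i) := by
  have e : Nat.Partition.genFun (fun i c => if i ≤ N then f i c else 0) =
      ∏ i ∈ Finset.range N, partFactor f i := by
    have h0 := Nat.Partition.hasProd_genFun (fun i c => if i ≤ N then f i c else 0)
    refine h0.unique ?_
    have h : HasProd (fun i => (1 : PowerSeries ℂ) +
        ∑' j, (if i + 1 ≤ N then f (i + 1) (j + 1) else 0) •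
          (PowerSeries.X : PowerSeries ℂ) ^ ((i + 1) * (j + 1)))
        (∏ i ∈ Finset.range N, ((1 : PowerSeries ℂ) +
          ∑' j, (if i + 1 ≤ N then f (i + 1) (j + 1) else 0) •
            (PowerSeries.X : PowerSeries ℂ) ^ ((i + 1) * (j + 1)))) := by
      refine hasProd_prod_of_ne_finset_one fun i hi => ?_
      have : ¬ i + 1 ≤ N := by rw [Finset.mem_range] at hi; omega
      simp [this]
    rw [Finset.prod_congr rfl (g := fun i => (1 : PowerSeries ℂ) +
      ∑' j, (if i + 1 ≤ N then f (i + 1) (j + 1) else 0) •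
        (PowerSeries.X : PowerSeries ℂ) ^ ((i + 1) * (j + 1)))]
    · exact h
    · intro i hi
      have : i + 1 ≤ N := by rw [Finset.mem_range] at hi; omega
      simp [this, partFactor]
  rw [e]
  exact HasEval.prod (hasEval_partFactor h1 hf) N

lemma partSum_one (h1 : ‖q‖ < 1) (i : ℕ) : partSum (fun _ _ => 1) q i = (1 - q * q ^ i)⁻¹ := by
  have h : ‖q ^ (i + 1)‖ < 1 := by
    rw [norm_pow]
    exact pow_lt_one₀ (norm_nonneg _) h1 (Nat.succ_ne_zero i)
  rw [partSum, ← pow_succ', ← tsum_geometric_of_norm_lt_one h]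
  simp [pow_mul]

lemma tendsto_prod_partSum_one (h1 : ‖q‖ < 1) :
    Tendsto (fun N => ∏ i ∈ Finset.range N, partSum (fun _ _ => 1) q i) atTop
      (𝓝 (poch q q)⁻¹) := by
  simp_rw [partSum_one h1, Finset.prod_inv_distrib]
  exact (tendsto_poch h1 q).inv₀ (poch_ne_zero_of_norm_lt_one h1 h1)

lemma norm_prod_le_one {f : ℕ → ℕ → ℂ} (hf : ∀ i c, ‖f i c‖ ≤ 1) (p : ℕ →₀ ℕ) :
    ‖p.prod f‖ ≤ 1 := by
  rw [Finsupp.prod, norm_prod]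
  exact Finset.prod_le_one (fun _ _ => norm_nonneg _) fun i _ => hf i _

lemma genFun_coeff_congr {f g : ℕ → ℕ → ℂ} {n : ℕ} (h : ∀ i c, i ≤ n → f i c = g i c) :
    PowerSeries.coeff n (Nat.Partition.genFun f) =
      PowerSeries.coeff n (Nat.Partition.genFun g) := by
  rw [Nat.Partition.coeff_genFun, Nat.Partition.coeff_genFun]
  refine Finset.sum_congr rfl fun p _ => Finset.prod_congr rfl fun i hi => h i _ ?_
  exact p.le_of_mem_parts (by simpa using hi)

lemma norm_coeff_genFun_le {f : ℕ → ℕ → ℂ} (hf : ∀ i c, ‖f i c‖ ≤ 1) (n : ℕ) :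
    ‖PowerSeries.coeff n (Nat.Partition.genFun f)‖ ≤ Fintype.card n.Partition := by
  rw [Nat.Partition.coeff_genFun]
  refine (norm_sum_le _ _).trans ((Finset.sum_le_sum fun p _ => norm_prod_le_one hf _).trans ?_)
  simp

lemma summable_card_partition {ρ : ℝ} (h0 : 0 ≤ ρ) (h1 : ρ < 1) :
    Summable fun n => (Fintype.card n.Partition : ℝ) * ρ ^ n := by
  have hρ : ‖(ρ : ℂ)‖ < 1 := by simpa [abs_of_nonneg h0] using h1
  obtain ⟨B, hB⟩ := (tendsto_prod_partSum_one hρ).norm.bddAbove_range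
  refine summable_of_sum_range_le (c := B) (fun n => by positivity) fun N => ?_
  have hs := Complex.hasSum_re (hasEval_genFun hρ (f := fun _ _ => 1) (fun _ _ => by simp) N).2
  have hr : ∀ n, (PowerSeries.coeff n (Nat.Partition.genFun fun i _ =>
      if i ≤ N then (1 : ℂ) else 0) * (ρ : ℂ) ^ n).re = (∑ p : n.Partition,
        (Multiset.toFinsupp p.parts).prod fun i _ => if i ≤ N then (1 : ℝ) else 0) * ρ ^ n := by
    intro n
    rw [Nat.Partition.coeff_genFun, ← Complex.ofReal_re ((∑ p : n.Partition,
        (Multiset.toFinsupp p.parts).prod fun i _ => if i ≤ N then (1 : ℝ) else 0) * ρ ^ n)]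
    congr 1
    simp only [Finsupp.prod]
    push_cast
    congr 1
    refine Finset.sum_congr rfl fun p _ => Finset.prod_congr rfl fun i _ => ?_
    split_ifs <;> simp
  simp_rw [hr] at hs
  refine le_trans (le_trans (le_of_eq ?_) (sum_le_hasSum (Finset.range N) (fun n _ => ?_) hs))
    ((Complex.re_le_norm _).trans (hB ⟨N, rfl⟩))
  · refine Finset.sum_congr rfl fun n hn => ?_
    congr 1
    rw [Finset.sum_congr rfl (g := fun _ => (1 : ℝ))]
    · simp
    · intro p _
      refine Finset.prod_eq_one fun i hi => if_pos ?_
      have := p.le_of_mem_parts (m := i) (by simpa using hi)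
      have := Finset.mem_range.1 hn
      omega
  · refine mul_nonneg (Finset.sum_nonneg fun p _ => Finset.prod_nonneg fun i _ => ?_)
      (pow_nonneg h0 n)
    dsimp only
    split_ifs <;> simp

lemma hasSum_genFun (h1 : ‖q‖ < 1) {f : ℕ → ℕ → ℂ} (hf : ∀ i c, ‖f i c‖ ≤ 1) {v : ℂ}
    (hv : Tendsto (fun N => ∏ i ∈ Finset.range N, partSum f q i) atTop (𝓝 v)) :
    HasSum (fun n => PowerSeries.coeff n (Nat.Partition.genFun f) * q ^ n) v := by
  have hb : ∀ g : ℕ → ℕ → ℂ, (∀ i c, ‖g i c‖ ≤ 1) → ∀ n,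
      ‖PowerSeries.coeff n (Nat.Partition.genFun g) * q ^ n‖ ≤
        (Fintype.card n.Partition : ℝ) * ‖q‖ ^ n := fun g hg n => by
    rw [norm_mul, norm_pow]
    exact mul_le_mul_of_nonneg_right (norm_coeff_genFun_le hg n) (by positivity)
  have hB := summable_card_partition (norm_nonneg q) h1
  have ht := tendsto_tsum_of_dominated_convergence (𝓕 := atTop)
    (f := fun N n => PowerSeries.coeff n (Nat.Partition.genFun fun i c =>
      if i ≤ N then f i c else 0) * q ^ n)
    (g := fun n => PowerSeries.coeff n (Nat.Partition.genFun f) * q ^ n) hB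
    (fun n => tendsto_const_nhds.congr' ?_)
    (Eventually.of_forall fun N n => hb _ (fun i c => by split_ifs <;> simp [hf]) n)
  · simp_rw [(hasEval_genFun h1 hf _).2.tsum_eq] at ht
    rw [tendsto_nhds_unique hv ht]
    exact (Summable.of_norm_bounded hB (hb f hf)).hasSum
  · filter_upwards [eventually_ge_atTop n] with N hN
    rw [genFun_coeff_congr]
    intro i c hi
    rw [if_pos (hi.trans hN)]

/-- The generating function of the partition numbers. -/
lemma hasSum_card_partition (h1 : ‖q‖ < 1) :
    HasSum (fun n => (Fintype.card n.Partition : ℂ) * q ^ n) (poch q q)⁻¹ := by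
  convert hasSum_genFun h1 (f := fun _ _ => 1) (by simp) (tendsto_prod_partSum_one h1) using 3
  rw [Nat.Partition.coeff_genFun]
  simp [Finsupp.prod]

lemma summable_pow_mul_card_partition (k : ℕ) {ρ : ℝ} (h0 : 0 ≤ ρ) (h1 : ρ < 1) :
    Summable fun n : ℕ => (n : ℝ) ^ k * Fintype.card n.Partition * ρ ^ n := by
  obtain ⟨r, hr0, hr1⟩ := exists_between h1
  have hr : 0 < r := h0.trans_lt hr0
  have hρ : ‖ρ / r‖ < 1 := by
    rw [Real.norm_of_nonneg (by positivity), div_lt_one hr]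
    exact hr0
  have hk := (summable_pow_mul_geometric_of_norm_lt_one k hρ).tendsto_atTop_zero
  obtain ⟨B, hB⟩ := hk.norm.bddAbove_range
  refine Summable.of_nonneg_of_le (fun n => by positivity) (fun n => ?_)
    ((summable_card_partition hr.le hr1).mul_left B)
  have h := mul_le_mul_of_nonneg_right ((le_abs_self _).trans (hB ⟨n, rfl⟩))
    (show 0 ≤ (Fintype.card n.Partition : ℝ) * r ^ n by positivity)
  refine le_trans (le_of_eq ?_) h
  rw [div_pow]
  field_simp

end

section

open Filter Topology

/-! ### Conjugation of partitions -/

lemma sum_rowLens (μ : YoungDiagram) : μ.rowLens.sum = μ.card := by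
  rw [YoungDiagram.rowLens, YoungDiagram.card,
    Finset.card_eq_sum_card_fiberwise (f := Prod.fst) (t := Finset.range (μ.colLen 0)),
    ← List.sum_toFinset _ List.nodup_range, List.toFinset_range]
  · refine Finset.sum_congr rfl fun i _ => ?_
    exact YoungDiagram.rowLen_eq_card μ
  · intro c hc
    rw [Finset.coe_range, Set.mem_Iio, ← YoungDiagram.mem_iff_lt_colLen]
    exact μ.up_left_mem le_rfl (Nat.zero_le _) hc

lemma sup_rowLens (μ : YoungDiagram) : (μ.rowLens : Multiset ℕ).sup = μ.rowLen 0 := by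
  refine le_antisymm (Multiset.sup_le.2 fun x hx => ?_) ?_
  · rw [Multiset.mem_coe, YoungDiagram.rowLens, List.mem_map] at hx
    obtain ⟨i, -, rfl⟩ := hx
    exact μ.rowLen_anti 0 i (Nat.zero_le _)
  · rcases Nat.eq_zero_or_pos (μ.rowLen 0) with h | h
    · rw [h]
      exact Nat.zero_le _
    · refine Multiset.le_sup ?_
      rw [Multiset.mem_coe, YoungDiagram.rowLens, List.mem_map]
      refine ⟨0, ?_, rfl⟩
      rwa [List.mem_range, ← YoungDiagram.mem_iff_lt_colLen, YoungDiagram.mem_iff_lt_rowLen]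

/-- The partition whose parts are the row lengths of a Young diagram. -/
def ofYoungDiagram {n : ℕ} (μ : YoungDiagram) (h : μ.card = n) : n.Partition where
  parts := μ.rowLens
  parts_pos := fun {i} hi => μ.pos_of_mem_rowLens i (Multiset.mem_coe.1 hi)
  parts_sum := by rw [Multiset.sum_coe, sum_rowLens, h]

/-- The Young diagram of a partition. -/
def toYoungDiagram {n : ℕ} (π : n.Partition) : YoungDiagram :=
  YoungDiagram.ofRowLens (π.parts.sort (· ≥ ·)) (π.parts.pairwise_sort (· ≥ ·)).sortedGE

lemma rowLens_toYoungDiagram {n : ℕ} (π : n.Partition) :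
    (toYoungDiagram π).rowLens = π.parts.sort (· ≥ ·) :=
  YoungDiagram.rowLens_ofRowLens_eq_self fun _ hx =>
    π.parts_pos ((Multiset.mem_sort _).1 hx)

lemma card_toYoungDiagram {n : ℕ} (π : n.Partition) : (toYoungDiagram π).card = n := by
  rw [← sum_rowLens, rowLens_toYoungDiagram, ← Multiset.sum_coe, Multiset.sort_eq, π.parts_sum]

lemma ofYoungDiagram_toYoungDiagram {n : ℕ} (π : n.Partition) :
    ofYoungDiagram (toYoungDiagram π) (card_toYoungDiagram π) = π := by
  refine Nat.Partition.ext ?_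
  change ((toYoungDiagram π).rowLens : Multiset ℕ) = π.parts
  rw [rowLens_toYoungDiagram, Multiset.sort_eq]

lemma toYoungDiagram_ofYoungDiagram {n : ℕ} (μ : YoungDiagram) (h : μ.card = n) :
    toYoungDiagram (ofYoungDiagram μ h) = μ := by
  refine YoungDiagram.equivListRowLens.injective (Subtype.ext ?_)
  rw [YoungDiagram.equivListRowLens_apply_coe, YoungDiagram.equivListRowLens_apply_coe,
    rowLens_toYoungDiagram, ofYoungDiagram, Multiset.coe_sort]
  exact List.mergeSort_eq_self _ (by simpa using μ.rowLens_sorted.pairwise)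

lemma card_transpose (μ : YoungDiagram) : μ.transpose.card = μ.card :=
  Finset.card_map _

/-- The conjugate partition. -/
def conj {n : ℕ} (π : n.Partition) : n.Partition :=
  ofYoungDiagram (toYoungDiagram π).transpose
    ((card_transpose _).trans (card_toYoungDiagram π))

lemma conj_conj {n : ℕ} (π : n.Partition) : conj (conj π) = π := by
  have : (toYoungDiagram (conj π)).transpose = toYoungDiagram π := by
    rw [conj, toYoungDiagram_ofYoungDiagram, YoungDiagram.transpose_transpose]
  conv_rhs => rw [← ofYoungDiagram_toYoungDiagram π]
  rw [conj]
  simp only [this]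

lemma numParts_eq_colLen {n : ℕ} (π : n.Partition) : numParts π = (toYoungDiagram π).colLen 0 := by
  rw [← YoungDiagram.length_rowLens, rowLens_toYoungDiagram, Multiset.length_sort, numParts]

lemma largestPart_eq_rowLen {n : ℕ} (π : n.Partition) :
    largestPart π = (toYoungDiagram π).rowLen 0 := by
  rw [← sup_rowLens, rowLens_toYoungDiagram, Multiset.sort_eq, largestPart]

lemma numParts_conj {n : ℕ} (π : n.Partition) : numParts (conj π) = largestPart π := by
  rw [numParts_eq_colLen, conj, toYoungDiagram_ofYoungDiagram, YoungDiagram.colLen_transpose,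
    largestPart_eq_rowLen]

lemma largestPart_conj {n : ℕ} (π : n.Partition) : largestPart (conj π) = numParts π := by
  rw [← numParts_conj, conj_conj]

lemma rank_conj {n : ℕ} (π : n.Partition) : rank (conj π) = -rank π := by
  rw [rank, rank, numParts_conj, largestPart_conj]
  ring

lemma sum_conj {n : ℕ} {M : Type*} [AddCommMonoid M] (f : n.Partition → M) :
    ∑ π, f (conj π) = ∑ π, f π :=
  Equiv.sum_comp (Function.Involutive.toPerm conj conj_conj) f

end

section

open Filter Topology

/-! ### Dyson's map -/

/-- Dyson's map: one from every part, and a new part that exceeds their number by `k + 1`. -/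
def dysonUp (k : ℕ) (s : Multiset ℕ) : Multiset ℕ :=
  (Multiset.card s + k + 1) ::ₘ (s.filter (1 < ·)).map (· - 1)

/-- The inverse of Dyson's map. -/
def dysonDown (k : ℕ) (t : Multiset ℕ) : Multiset ℕ :=
  (t.erase t.sup).map (· + 1) + Multiset.replicate (t.sup - k - Multiset.card t) 1

lemma filter_not_one_lt {s : Multiset ℕ} (hs : ∀ x ∈ s, 0 < x) :
    s.filter (¬ 1 < ·) = Multiset.replicate (Multiset.card (s.filter (¬ 1 < ·))) 1 :=
  Multiset.eq_replicate_card.2 fun x hx => by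
    rw [Multiset.mem_filter] at hx
    have := hs x hx.1
    omega

lemma sup_dysonUp {k : ℕ} {s : Multiset ℕ} (hk : s.sup ≤ Multiset.card s + k + 2) :
    (dysonUp k s).sup = Multiset.card s + k + 1 := by
  rw [dysonUp, Multiset.sup_cons, max_eq_left]
  refine Multiset.sup_le.2 fun x hx => ?_
  obtain ⟨y, hy, rfl⟩ := Multiset.mem_map.1 hx
  have := Multiset.le_sup (Multiset.mem_filter.1 hy).1
  omega

lemma pos_of_mem_dysonUp {k : ℕ} {s : Multiset ℕ} {x : ℕ} (hx : x ∈ dysonUp k s) : 0 < x := by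
  rcases Multiset.mem_cons.1 hx with rfl | hx
  · omega
  · obtain ⟨y, hy, rfl⟩ := Multiset.mem_map.1 hx
    have := (Multiset.mem_filter.1 hy).2
    omega

lemma pos_of_mem_dysonDown {k : ℕ} {t : Multiset ℕ} {x : ℕ} (hx : x ∈ dysonDown k t) : 0 < x := by
  rcases Multiset.mem_add.1 hx with hx | hx
  · obtain ⟨y, -, rfl⟩ := Multiset.mem_map.1 hx
    omega
  · rw [Multiset.eq_of_mem_replicate hx]
    exact one_pos

lemma map_pred_map_succ (s : Multiset ℕ) : (s.map (· + 1)).map (· - 1) = s := by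
  rw [Multiset.map_map]
  exact (Multiset.map_congr rfl fun x _ => by simp).trans (Multiset.map_id s)

lemma map_succ_map_pred {s : Multiset ℕ} (hs : ∀ x ∈ s, 0 < x) :
    (s.map (· - 1)).map (· + 1) = s := by
  rw [Multiset.map_map]
  refine (Multiset.map_congr rfl fun x hx => ?_).trans (Multiset.map_id s)
  have := hs x hx
  simp only [Function.comp, id]
  omega

lemma dysonDown_dysonUp {k : ℕ} {s : Multiset ℕ} (hs : ∀ x ∈ s, 0 < x)
    (hk : s.sup ≤ Multiset.card s + k + 2) : dysonDown k (dysonUp k s) = s := by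
  rw [dysonDown, sup_dysonUp hk, dysonUp, Multiset.erase_cons_head,
    map_succ_map_pred fun x hx => hs x (Multiset.mem_filter.1 hx).1, Multiset.card_cons,
    Multiset.card_map]
  have h := Multiset.filter_add_not (1 < ·) s
  have hc := congrArg Multiset.card h
  rw [Multiset.card_add] at hc
  conv_rhs => rw [← h, filter_not_one_lt hs]
  congr 2
  omega

lemma card_dysonDown {k : ℕ} {t : Multiset ℕ} (ht : t.sup ∈ t)
    (hk : Multiset.card t + k ≤ t.sup) : Multiset.card (dysonDown k t) = t.sup - k - 1 := by
  rw [dysonDown, Multiset.card_add, Multiset.card_map, Multiset.card_replicate,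
    Multiset.card_erase_of_mem ht]
  have := Multiset.card_pos_iff_exists_mem.2 ⟨_, ht⟩
  rw [Nat.pred_eq_sub_one]
  omega

lemma dysonUp_dysonDown {k : ℕ} {t : Multiset ℕ} (ht0 : ∀ x ∈ t, 0 < x) (ht : t.sup ∈ t)
    (hk : Multiset.card t + k ≤ t.sup) : dysonUp k (dysonDown k t) = t := by
  have h := card_dysonDown ht hk
  have h1 := Multiset.card_pos_iff_exists_mem.2 ⟨_, ht⟩
  have hf : (dysonDown k t).filter (1 < ·) = (t.erase t.sup).map (· + 1) := by
    rw [dysonDown, Multiset.filter_add, Multiset.filter_eq_self.2, Multiset.filter_eq_nil.2,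
      add_zero]
    · intro x hx
      rw [Multiset.eq_of_mem_replicate hx]
      exact lt_irrefl 1
    · intro x hx
      obtain ⟨y, hy, rfl⟩ := Multiset.mem_map.1 hx
      have := ht0 y (Multiset.mem_of_mem_erase hy)
      omega
  rw [dysonUp, h, hf, map_pred_map_succ]
  conv_rhs => rw [← Multiset.cons_erase ht]
  congr 1
  omega

lemma sum_map_succ (s : Multiset ℕ) : (s.map (· + 1)).sum = s.sum + Multiset.card s := by
  rw [Multiset.sum_map_add]
  simp

lemma sum_dysonUp (k : ℕ) {s : Multiset ℕ} (hs : ∀ x ∈ s, 0 < x) :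
    (dysonUp k s).sum = s.sum + k + 1 := by
  have h := Multiset.filter_add_not (1 < ·) s
  have hc := congrArg Multiset.card h
  have hsum := congrArg Multiset.sum h
  rw [filter_not_one_lt hs] at hsum
  rw [Multiset.card_add] at hc
  rw [Multiset.sum_add, Multiset.sum_replicate, smul_eq_mul, mul_one] at hsum
  have h2 := sum_map_succ ((s.filter (1 < ·)).map (· - 1))
  rw [map_succ_map_pred fun x hx => hs x (Multiset.mem_filter.1 hx).1, Multiset.card_map] at h2
  rw [dysonUp, Multiset.sum_cons]
  omega

lemma sum_dysonDown {k : ℕ} {t : Multiset ℕ} (ht : t.sup ∈ t)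
    (hk : Multiset.card t + k ≤ t.sup) : (dysonDown k t).sum + k + 1 = t.sum := by
  have h1 := Multiset.card_pos_iff_exists_mem.2 ⟨_, ht⟩
  rw [dysonDown, Multiset.sum_add, sum_map_succ, Multiset.sum_replicate, smul_eq_mul, mul_one,
    Multiset.card_erase_of_mem ht, Nat.pred_eq_sub_one]
  have := congrArg Multiset.sum (Multiset.cons_erase ht)
  rw [Multiset.sum_cons] at this
  omega

lemma sup_dysonDown_le {k : ℕ} {t : Multiset ℕ} : (dysonDown k t).sup ≤ t.sup + 1 := by
  refine Multiset.sup_le.2 fun x hx => ?_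
  rcases Multiset.mem_add.1 hx with hx | hx
  · obtain ⟨y, hy, rfl⟩ := Multiset.mem_map.1 hx
    have := Multiset.le_sup (Multiset.mem_of_mem_erase hy)
    omega
  · rw [Multiset.eq_of_mem_replicate hx]
    omega

lemma sup_mem {s : Multiset ℕ} (hs : 0 < s.sup) : s.sup ∈ s := by
  induction s using Multiset.induction with
  | empty => simp at hs
  | cons a s ih =>
    rw [Multiset.sup_cons] at hs ⊢
    rcases le_total s.sup a with h | h
    · rw [sup_eq_left.2 h]
      exact Multiset.mem_cons_self a s
    · rw [sup_eq_right.2 h] at hs ⊢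
      exact Multiset.mem_cons_of_mem (ih hs)

/-- The number of partitions of `n` with rank at least `k`. -/
def rankTail (k n : ℕ) : ℕ := (Finset.univ.filter fun π : n.Partition => (k : ℤ) ≤ rank π).card

lemma rankTail_add (k m : ℕ) (hk : 0 < k) :
    rankTail k (m + k + 1) + rankTail (k + 3) m = Fintype.card m.Partition := by
  have h : rankTail k (m + k + 1) =
      (Finset.univ.filter fun μ : m.Partition => ¬ ((k + 3 : ℕ) : ℤ) ≤ rank μ).card := by
    have key : ∀ π : (m + k + 1).Partition, (k : ℤ) ≤ rank π →
        π.parts.sup ∈ π.parts ∧ Multiset.card π.parts + k ≤ π.parts.sup := by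
      intro π h
      have h : Multiset.card π.parts + k ≤ π.parts.sup := by
        simp only [rank, largestPart, numParts] at h
        omega
      exact ⟨sup_mem (by omega), h⟩
    symm
    refine Finset.card_bij' (fun μ _ => ⟨dysonUp k μ.parts, pos_of_mem_dysonUp, by
        rw [sum_dysonUp k (fun _ => μ.parts_pos), μ.parts_sum]⟩)
      (fun π hπ => ⟨dysonDown k π.parts, pos_of_mem_dysonDown, by
        obtain ⟨h1, h2⟩ := key π (Finset.mem_filter.1 hπ).2
        have := sum_dysonDown h1 h2
        rw [π.parts_sum] at this
        omega⟩) ?_ ?_ ?_ ?_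
    · intro μ hμ
      have h1 := (Finset.mem_filter.1 hμ).2
      simp only [rank, largestPart, numParts] at h1
      refine Finset.mem_filter.2 ⟨Finset.mem_univ _, ?_⟩
      simp only [rank, largestPart, numParts]
      rw [sup_dysonUp (by omega), dysonUp, Multiset.card_cons, Multiset.card_map]
      have := Multiset.card_le_card (Multiset.filter_le (1 < ·) μ.parts)
      push_cast
      omega
    · intro π hπ
      obtain ⟨h1, h2⟩ := key π (Finset.mem_filter.1 hπ).2
      refine Finset.mem_filter.2 ⟨Finset.mem_univ _, ?_⟩
      simp only [rank, largestPart, numParts]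
      rw [card_dysonDown h1 h2]
      have := sup_dysonDown_le (k := k) (t := π.parts)
      have := Multiset.card_pos_iff_exists_mem.2 ⟨_, h1⟩
      push_cast
      omega
    · intro μ hμ
      have h1 := (Finset.mem_filter.1 hμ).2
      simp only [rank, largestPart, numParts] at h1
      exact Nat.Partition.ext (dysonDown_dysonUp (fun _ => μ.parts_pos) (by omega))
    · intro π hπ
      obtain ⟨h1, h2⟩ := key π (Finset.mem_filter.1 hπ).2
      exact Nat.Partition.ext (dysonUp_dysonDown (fun _ => π.parts_pos) h1 h2)
  rw [h, add_comm, rankTail, Finset.card_filter_add_card_filter_not, Finset.card_univ]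

lemma largestPart_le {n : ℕ} (π : n.Partition) : largestPart π ≤ n :=
  Multiset.sup_le.2 fun _ => π.le_of_mem_parts

lemma numParts_le {n : ℕ} (π : n.Partition) : numParts π ≤ n := by
  rw [← largestPart_conj]
  exact largestPart_le _

lemma numParts_pos {n : ℕ} (hn : 0 < n) (π : n.Partition) : 0 < numParts π := by
  rw [numParts, Multiset.card_pos]
  intro h
  have := π.parts_sum
  rw [h, Multiset.sum_zero] at this
  omega

lemma rankTail_eq_zero {k n : ℕ} (hk : 0 < k) (h : n ≤ k) : rankTail k n = 0 := by
  rw [rankTail, Finset.card_eq_zero, Finset.filter_eq_empty_iff]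
  intro π _
  have := largestPart_le π
  have := fun hn => numParts_pos (n := n) hn π
  rw [rank]
  omega

lemma rankTail_le (k n : ℕ) : rankTail k n ≤ Fintype.card n.Partition :=
  Finset.card_le_univ _

end

section

open Filter Topology

/-! ### Counting partitions by rank -/

variable {q : ℂ}

/-- The number of partitions of `n` with rank `k`. -/
def rankCount (k n : ℕ) : ℕ := (Finset.univ.filter fun π : n.Partition => rank π = k).card

/-- The coefficient with which the rank counts enter `NT 3 5 n - NT 2 5 n`. -/
def rankSign (k : ℕ) : ℤ := if k % 5 = 2 then k else if k % 5 = 3 then -k else 0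

lemma abs_rankSign_le (k : ℕ) : |rankSign k| ≤ k := by
  rw [rankSign]
  split_ifs <;> simp

lemma NT_sub_eq_sum_rank (n : ℕ) : NT 3 5 n - NT 2 5 n =
    ∑ π : n.Partition, if rank π % 5 = 2 then rank π else 0 := by
  rw [NT, ← sum_conj, NT, ← Finset.sum_sub_distrib]
  refine Finset.sum_congr rfl fun π _ => ?_
  rw [rank_conj, numParts_conj]
  have : rank π = (largestPart π : ℤ) - numParts π := rfl
  split_ifs <;> omega

lemma NT_sub_eq_sum_sign (n : ℕ) : NT 3 5 n - NT 2 5 n =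
    ∑ π : n.Partition, if 0 ≤ rank π then rankSign (rank π).toNat else 0 := by
  have h1 : NT 3 5 n - NT 2 5 n =
      (∑ π : n.Partition, if 0 ≤ rank π ∧ rank π % 5 = 2 then rank π else 0) +
      ∑ π : n.Partition, if rank π < 0 ∧ rank π % 5 = 2 then rank π else 0 := by
    rw [NT_sub_eq_sum_rank, ← Finset.sum_add_distrib]
    refine Finset.sum_congr rfl fun π _ => ?_
    split_ifs <;> omega
  rw [h1, ← sum_conj fun π : n.Partition => if rank π < 0 ∧ rank π % 5 = 2 then rank π else 0,
    ← Finset.sum_add_distrib]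
  refine Finset.sum_congr rfl fun π _ => ?_
  rw [rank_conj, rankSign]
  split_ifs <;> omega

lemma rank_le {n : ℕ} (π : n.Partition) : rank π ≤ n := by
  have := largestPart_le π
  rw [rank]
  omega

lemma NT_sub_eq_sum_count (n : ℕ) : NT 3 5 n - NT 2 5 n =
    ∑ k ∈ Finset.range (n + 1), rankSign k * rankCount k n := by
  rw [NT_sub_eq_sum_sign]
  have h : ∀ k, rankSign k * rankCount k n =
      ∑ π : n.Partition, if rank π = k then rankSign k else 0 := fun k => by
    rw [← Finset.sum_filter, Finset.sum_const, rankCount, nsmul_eq_mul, mul_comm]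
  simp_rw [h]
  rw [Finset.sum_comm]
  refine Finset.sum_congr rfl fun π _ => ?_
  have := rank_le π
  split_ifs with h0
  · rw [Finset.sum_eq_single (rank π).toNat, if_pos (by omega)]
    · intro k _ hk
      rw [if_neg (by omega)]
    · intro hk
      rw [Finset.mem_range] at hk
      omega
  · refine (Finset.sum_eq_zero fun k _ => ?_).symm
    rw [if_neg (by omega)]

lemma rankCount_add_rankTail (k n : ℕ) : rankCount k n + rankTail (k + 1) n = rankTail k n := by
  rw [rankCount, rankTail, rankTail, ← Finset.card_union_of_disjoint]
  · congr 1
    ext π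
    simp only [Finset.mem_union, Finset.mem_filter, Finset.mem_univ, true_and]
    omega
  · rw [Finset.disjoint_filter]
    intro π _ _
    omega

lemma rankCount_eq_zero {k n : ℕ} (h : n < k) : rankCount k n = 0 := by
  rw [rankCount, Finset.card_eq_zero, Finset.filter_eq_empty_iff]
  intro π _
  have := rank_le π
  omega

lemma sum_rankCount_le (n : ℕ) (s : Finset ℕ) :
    ∑ k ∈ s, rankCount k n ≤ Fintype.card n.Partition := by
  simp only [rankCount]
  rw [← Finset.card_biUnion]
  · exact Finset.card_le_univ _
  · intro a _ b _ hab
    simp only [Function.onFun]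
    rw [Finset.disjoint_filter]
    intro π _ _
    omega

/-- The generating function of the number of partitions with rank at least `k`. -/
noncomputable def rankTailSeries (q : ℂ) (k : ℕ) : ℂ := ∑' n, (rankTail k n : ℂ) * q ^ n

lemma norm_rankTail_mul_le (k n : ℕ) : ‖(rankTail k n : ℂ) * q ^ n‖ ≤
    (Fintype.card n.Partition : ℝ) * ‖q‖ ^ n := by
  rw [norm_mul, norm_pow, Complex.norm_natCast]
  exact mul_le_mul_of_nonneg_right (by exact_mod_cast rankTail_le k n) (by positivity)

lemma hasSum_rankTailSeries (h1 : ‖q‖ < 1) (k : ℕ) :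
    HasSum (fun n => (rankTail k n : ℂ) * q ^ n) (rankTailSeries q k) :=
  (Summable.of_norm_bounded (summable_card_partition (norm_nonneg q) h1)
    (norm_rankTail_mul_le k)).hasSum

lemma norm_rankTailSeries_le (h1 : ‖q‖ < 1) (k : ℕ) : ‖rankTailSeries q k‖ ≤
    ∑' n, (Fintype.card (Nat.Partition n) : ℝ) * ‖q‖ ^ n :=
  tsum_of_norm_bounded (summable_card_partition (norm_nonneg q) h1).hasSum
    (norm_rankTail_mul_le k)

lemma rankTailSeries_eq (h1 : ‖q‖ < 1) {k : ℕ} (hk : 0 < k) :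
    rankTailSeries q k = q ^ (k + 1) * ((poch q q)⁻¹ - rankTailSeries q (k + 3)) := by
  have h := (hasSum_rankTailSeries h1 k)
  rw [← hasSum_nat_add_iff' (k + 1), Finset.sum_eq_zero, sub_zero] at h
  · refine h.unique ?_
    refine (((hasSum_card_partition h1).sub (hasSum_rankTailSeries h1 (k + 3))).mul_left
      (q ^ (k + 1))).congr_fun fun m => ?_
    rw [← rankTail_add k m hk, add_assoc m k 1]
    push_cast
    ring
  · intro n hn
    rw [rankTail_eq_zero hk (by rw [Finset.mem_range] at hn; omega)]
    simp

/-- The pentagonal numbers. -/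
def pent (m : ℕ) : ℕ := m + 3 * m.choose 2

lemma pent_succ (m : ℕ) : pent (m + 1) = pent m + 3 * m + 1 := by
  rw [pent, pent, Nat.choose_succ_succ' m 1, Nat.choose_one_right]
  ring

lemma rankTailSeries_eq_sum (h1 : ‖q‖ < 1) {k : ℕ} (hk : 0 < k) (M : ℕ) :
    rankTailSeries q k = (∑ m ∈ Finset.range M,
      (-1) ^ m * q ^ (pent (m + 1) + k * (m + 1)) * (poch q q)⁻¹) +
      (-1) ^ M * q ^ (pent M + k * M) * rankTailSeries q (k + 3 * M) := by
  induction M with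
  | zero => simp [pent]
  | succ M ih =>
    rw [ih, Finset.sum_range_succ, rankTailSeries_eq h1 (k := k + 3 * M) (by omega), pent_succ,
      show k + 3 * M + 3 = k + 3 * (M + 1) by ring]
    ring

lemma norm_rankTerm_le (h1 : ‖q‖ < 1) (k m : ℕ) :
    ‖(-1) ^ m * q ^ (pent (m + 1) + k * (m + 1)) * (poch q q)⁻¹‖ ≤
      ‖q‖ ^ k * ‖q‖ ^ m * ‖(poch q q)⁻¹‖ := by
  rw [norm_mul, norm_mul, norm_pow, norm_pow, norm_neg, norm_one, one_pow, one_mul, ← pow_add]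
  refine mul_le_mul_of_nonneg_right ?_ (norm_nonneg _)
  refine pow_le_pow_of_le_one (norm_nonneg _) h1.le ?_
  rw [pent]
  nlinarith

lemma hasSum_rankTail_terms (h1 : ‖q‖ < 1) {k : ℕ} (hk : 0 < k) :
    HasSum (fun m => (-1) ^ m * q ^ (pent (m + 1) + k * (m + 1)) * (poch q q)⁻¹)
      (rankTailSeries q k) := by
  have hs : Summable fun m =>
      (-1) ^ m * q ^ (pent (m + 1) + k * (m + 1)) * (poch q q)⁻¹ :=
    Summable.of_norm_bounded (((summable_geometric_of_lt_one (norm_nonneg q) h1).mul_left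
      (‖q‖ ^ k)).mul_right ‖(poch q q)⁻¹‖) (norm_rankTerm_le h1 k)
  refine (hs.hasSum_iff_tendsto_nat).2 ?_
  have hr : Tendsto (fun M => (-1) ^ M * q ^ (pent M + k * M) * rankTailSeries q (k + 3 * M))
      atTop (𝓝 0) := by
    set B := ∑' n, (Fintype.card (Nat.Partition n) : ℝ) * ‖q‖ ^ n
    refine squeeze_zero_norm (a := fun M => ‖q‖ ^ M * B) (fun M => ?_) ?_
    · rw [norm_mul, norm_mul, norm_pow, norm_pow, norm_neg, norm_one, one_pow, one_mul]
      refine mul_le_mul (pow_le_pow_of_le_one (norm_nonneg _) h1.le ?_)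
        (norm_rankTailSeries_le h1 _) (norm_nonneg _) (by positivity)
      rw [pent]
      nlinarith
    · simpa using (tendsto_pow_atTop_nhds_zero_of_lt_one (norm_nonneg q) h1).mul_const B
  have := hr.const_sub (rankTailSeries q k)
  rw [sub_zero] at this
  refine this.congr fun M => ?_
  rw [rankTailSeries_eq_sum h1 hk M]
  ring

lemma hasSum_rankCount (h1 : ‖q‖ < 1) (k : ℕ) :
    HasSum (fun n => (rankCount k n : ℂ) * q ^ n)
      (rankTailSeries q k - rankTailSeries q (k + 1)) := by
  refine ((hasSum_rankTailSeries h1 k).sub (hasSum_rankTailSeries h1 (k + 1))).congr_fun ?_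
  intro n
  rw [← rankCount_add_rankTail]
  push_cast
  ring

lemma hasSum_rankCount_terms (h1 : ‖q‖ < 1) {k : ℕ} (hk : 0 < k) :
    HasSum (fun m => (-1) ^ m * q ^ pent (m + 1) * (1 - q ^ (m + 1)) * (q ^ (m + 1)) ^ k *
      (poch q q)⁻¹) (rankTailSeries q k - rankTailSeries q (k + 1)) := by
  refine ((hasSum_rankTail_terms h1 hk).sub
    (hasSum_rankTail_terms h1 (Nat.succ_pos k))).congr_fun fun m => ?_
  rw [Nat.succ_eq_add_one]
  ring

end

section

open Filter Topology

/-! ### The generating function of the rank side -/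

variable {q : ℂ}

lemma hasSum_rankSign {x : ℂ} (hx : ‖x‖ < 1) : HasSum (fun k => (rankSign k : ℂ) * x ^ k)
    (x ^ 2 * (2 * (1 - x ^ 5)⁻¹ + 5 * (x ^ 5 * (1 - x ^ 5)⁻¹ ^ 2)) -
      x ^ 3 * (3 * (1 - x ^ 5)⁻¹ + 5 * (x ^ 5 * (1 - x ^ 5)⁻¹ ^ 2))) := by
  have hX : 1 - x ^ 5 ≠ 0 := by
    have h := norm_pow_five_lt_one hx
    intro h0
    rw [← sub_eq_zero.1 h0, norm_one] at h
    exact lt_irrefl _ h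
  set e : ℕ → ℤ := fun k => if k % 5 = 2 then 1 else if k % 5 = 3 then -1 else 0 with he
  have hc : Summable fun k : ℕ => (k : ℝ) * ‖x‖ ^ k := by
    simpa using summable_pow_mul_geometric_of_norm_lt_one 1
      (show ‖‖x‖‖ < 1 by simpa using hx)
  have hS : Summable fun k => (rankSign k : ℂ) * x ^ k := by
    refine Summable.of_norm_bounded hc fun k => ?_
    rw [norm_mul, norm_pow, Complex.norm_intCast]
    exact mul_le_mul_of_nonneg_right (by exact_mod_cast abs_rankSign_le k) (by positivity)
  have hE : Summable fun k => (e k : ℂ) * x ^ k := by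
    refine Summable.of_norm_bounded (summable_geometric_of_lt_one (norm_nonneg x) hx) fun k => ?_
    rw [norm_mul, norm_pow, Complex.norm_intCast]
    refine mul_le_of_le_one_left (by positivity) ?_
    simp only [he]
    split_ifs <;> simp
  obtain ⟨S, hS⟩ := hS
  obtain ⟨E, hE⟩ := hE
  have h1 : ∀ k, rankSign (k + 5) = rankSign k + 5 * e k := fun k => by
    simp only [he, rankSign]
    split_ifs <;> omega
  have h2 : ∀ k, e (k + 5) = e k := fun k => by
    simp only [he]
    split_ifs <;> omega
  have hE5 := (hasSum_nat_add_iff' 5).2 hE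
  have hS5 := (hasSum_nat_add_iff' 5).2 hS
  simp only [h1, h2] at hE5 hS5
  have e1 := hE5.unique ((hE.mul_left (x ^ 5)).congr_fun fun k => by ring)
  have e2 := hS5.unique (((hS.add (hE.mul_left 5)).mul_left (x ^ 5)).congr_fun fun k => by
    push_cast; ring)
  simp [Finset.sum_range_succ, he, rankSign] at e1 e2
  convert hS using 1
  have hE' : E = (x ^ 2 - x ^ 3) * (1 - x ^ 5)⁻¹ := by
    field_simp
    linear_combination e1
  rw [hE'] at e2
  field_simp
  field_simp at e2
  linear_combination -e2

lemma summable_rankCount (h1 : ‖q‖ < 1) :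
    Summable fun p : ℕ × ℕ => (rankSign p.2 : ℂ) * rankCount p.2 p.1 * q ^ p.1 := by
  refine Summable.of_norm ?_
  have hfin : ∀ n k, k ∉ Finset.range (n + 1) →
      ‖(rankSign k : ℂ) * rankCount k n * q ^ n‖ = 0 := fun n k hk => by
    rw [rankCount_eq_zero (by rw [Finset.mem_range] at hk; omega)]
    simp
  refine (summable_prod_of_nonneg fun _ => norm_nonneg _).2 ⟨fun n => ?_, ?_⟩
  · exact summable_of_ne_finset_zero (hfin n)
  · refine Summable.of_nonneg_of_le (fun _ => tsum_nonneg fun _ => norm_nonneg _) (fun n => ?_)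
      (summable_pow_mul_card_partition 1 (norm_nonneg q) h1)
    rw [tsum_eq_sum (hfin n)]
    have h : ((∑ k ∈ Finset.range (n + 1), rankCount k n : ℕ) : ℝ) ≤ Fintype.card n.Partition := by
      exact_mod_cast sum_rankCount_le n _
    refine le_trans (Finset.sum_le_sum (g := fun k => n * (rankCount k n : ℝ) * ‖q‖ ^ n)
      fun k hk => ?_) ?_
    · rw [norm_mul, norm_mul, norm_pow, Complex.norm_intCast, Complex.norm_natCast]
      refine mul_le_mul_of_nonneg_right (mul_le_mul_of_nonneg_right ?_ (by positivity))
        (by positivity)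
      have h2 : |(rankSign k : ℝ)| ≤ k := by exact_mod_cast abs_rankSign_le k
      refine h2.trans ?_
      rw [Finset.mem_range] at hk
      exact_mod_cast Nat.lt_succ_iff.1 hk
    · rw [← Finset.sum_mul, ← Finset.mul_sum, pow_one]
      push_cast at h
      gcongr

lemma summable_rankCount_terms (h1 : ‖q‖ < 1) :
    Summable fun p : ℕ × ℕ => (rankSign p.1 : ℂ) * ((-1) ^ p.2 * q ^ pent (p.2 + 1) *
      (1 - q ^ (p.2 + 1)) * (q ^ (p.2 + 1)) ^ p.1 * (poch q q)⁻¹) := by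
  have hc : Summable fun k : ℕ => (k : ℝ) * ‖q‖ ^ k := by
    simpa using summable_pow_mul_geometric_of_norm_lt_one 1
      (show ‖‖q‖‖ < 1 by simpa using h1)
  have hB := ((hc.mul_of_nonneg (summable_geometric_of_lt_one (norm_nonneg q) h1)
    (fun _ => by positivity) (fun _ => by positivity)).mul_right (2 * ‖(poch q q)⁻¹‖))
  refine Summable.of_norm_bounded hB fun p => ?_
  obtain ⟨k, m⟩ := p
  have h2 : |(rankSign k : ℝ)| ≤ k := by exact_mod_cast abs_rankSign_le k
  have h3 : ‖1 - q ^ (m + 1)‖ ≤ 2 := by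
    refine (norm_sub_le _ _).trans ?_
    rw [norm_one, norm_pow]
    linarith [pow_le_one₀ (n := m + 1) (norm_nonneg q) h1.le]
  have h4 : ‖q‖ ^ pent (m + 1) ≤ ‖q‖ ^ m :=
    pow_le_pow_of_le_one (norm_nonneg _) h1.le (by rw [pent]; omega)
  have h5 : (‖q‖ ^ (m + 1)) ^ k ≤ ‖q‖ ^ k := by
    refine pow_le_pow_left₀ (by positivity) ?_ k
    exact pow_le_of_le_one (norm_nonneg _) h1.le (by omega)
  simp only [norm_mul, norm_pow, norm_neg, norm_one, one_pow, one_mul, Complex.norm_intCast]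
  calc |(rankSign k : ℝ)| * (‖q‖ ^ pent (m + 1) * ‖1 - q ^ (m + 1)‖ * (‖q‖ ^ (m + 1)) ^ k *
        ‖(poch q q)⁻¹‖) ≤ k * (‖q‖ ^ m * 2 * ‖q‖ ^ k * ‖(poch q q)⁻¹‖) := by gcongr
    _ = _ := by ring

lemma two_mul_choose_two (m : ℕ) : 2 * ((m + 1).choose 2 : ℤ) = m * (m + 1) := by
  induction m with
  | zero => simp
  | succ m ih =>
    rw [Nat.choose_succ_succ' (m + 1) 1, Nat.choose_one_right]
    push_cast
    linear_combination ih

lemma tri_natCast_succ (m : ℕ) : tri ((m + 1 : ℕ) : ℤ) = ((m + 1).choose 2 + (m + 1) : ℕ) := by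
  have h : 2 * tri ((m + 1 : ℕ) : ℤ) = 2 * ((m + 1).choose 2 + (m + 1) : ℕ) := by
    rw [two_mul_tri]
    push_cast
    linear_combination -two_mul_choose_two m
  omega

lemma rankTheta_pair (h0 : q ≠ 0) (h1 : ‖q‖ < 1) (m : ℕ) :
    rankExp q ((m + 1 : ℕ) : ℤ) * rankWeight (q ^ 5) ((m + 1 : ℕ) : ℤ) +
      rankExp q (-((m + 1 : ℕ) : ℤ)) * rankWeight (q ^ 5) (-((m + 1 : ℕ) : ℤ)) =
    (-1) ^ m * q ^ pent (m + 1) * (1 - q ^ (m + 1)) *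
      ((q ^ (m + 1)) ^ 2 * (2 * (1 - (q ^ (m + 1)) ^ 5)⁻¹ +
        5 * ((q ^ (m + 1)) ^ 5 * (1 - (q ^ (m + 1)) ^ 5)⁻¹ ^ 2)) -
      (q ^ (m + 1)) ^ 3 * (3 * (1 - (q ^ (m + 1)) ^ 5)⁻¹ +
        5 * ((q ^ (m + 1)) ^ 5 * (1 - (q ^ (m + 1)) ^ 5)⁻¹ ^ 2))) := by
  set c := (m + 1).choose 2 with hc
  set x := q ^ (m + 1) with hx
  have hx0 : x ≠ 0 := pow_ne_zero _ h0
  have hx1 : ‖x‖ < 1 := by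
    rw [hx, norm_pow]
    exact pow_lt_one₀ (norm_nonneg _) h1 (by omega)
  have hX : 1 - x ^ 5 ≠ 0 := by
    have h := norm_pow_five_lt_one hx1
    intro h0
    rw [← sub_eq_zero.1 h0, norm_one] at h
    exact lt_irrefl _ h
  have hy : (q ^ 5) ^ ((m + 1 : ℕ) : ℤ) = x ^ 5 := by
    rw [zpow_natCast, hx, ← pow_mul, ← pow_mul, mul_comm]
  have hyn : (q ^ 5) ^ (-((m + 1 : ℕ) : ℤ)) = (x ^ 5)⁻¹ := by rw [zpow_neg, hy]
  have hf : frac (q ^ 5) 1 ((m + 1 : ℕ) : ℤ) = (1 - x ^ 5)⁻¹ := by rw [frac, one_mul, hy]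
  have hfn : frac (q ^ 5) 1 (-((m + 1 : ℕ) : ℤ)) = -(x ^ 5 * (1 - x ^ 5)⁻¹) := by
    rw [frac_neg (pow_ne_zero 5 h0) one_ne_zero, inv_one, hy, hf]
    ring
  have hxz : ∀ k : ℤ, q ^ (k * ((m + 1 : ℕ) : ℤ)) = x ^ k := fun k => by
    rw [mul_comm, zpow_mul, zpow_natCast]
  have hpent : q ^ pent (m + 1) = q ^ (3 * (c : ℤ)) * x := by
    rw [pent, pow_add, ← hc, ← hx, mul_comm]
    norm_cast
  have e1 : rankExp q ((m + 1 : ℕ) : ℤ) = -(-1) ^ m * (q ^ (3 * (c : ℤ)) * (x ^ 4 - x ^ 3)) := by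
    rw [rankExp, tri_natCast_succ, ← hc, zpow_natCast, pow_succ,
      show 3 * ((c + (m + 1) : ℕ) : ℤ) + ((m + 1 : ℕ) : ℤ) = 3 * c + 4 * ((m + 1 : ℕ) : ℤ) by
        push_cast; ring,
      show 3 * ((c + (m + 1) : ℕ) : ℤ) = 3 * c + 3 * ((m + 1 : ℕ) : ℤ) by push_cast; ring,
      zpow_add₀ h0, zpow_add₀ h0, hxz, hxz, zpow_ofNat, zpow_ofNat]
    ring
  have e2 : rankExp q (-((m + 1 : ℕ) : ℤ)) = -(-1) ^ m * (q ^ (3 * (c : ℤ)) * (x⁻¹ - 1)) := by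
    rw [rankExp, tri_neg, tri_natCast_succ, ← hc, zpow_neg, zpow_natCast, ← inv_pow,
      show ((-1 : ℂ))⁻¹ = -1 by norm_num, pow_succ,
      show 3 * (((c + (m + 1) : ℕ) : ℤ) - ((m + 1 : ℕ) : ℤ)) + -((m + 1 : ℕ) : ℤ) =
        3 * c + (-1) * ((m + 1 : ℕ) : ℤ) by push_cast; ring,
      show 3 * (((c + (m + 1) : ℕ) : ℤ) - ((m + 1 : ℕ) : ℤ)) = 3 * c by push_cast; ring,
      zpow_add₀ h0, hxz, zpow_neg_one]
    ring
  rw [e1, e2, hpent, rankWeight, rankWeight, hf, hfn, hy, hyn]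
  generalize q ^ (3 * (c : ℤ)) = Q
  field_simp
  ring

lemma hasSum_rankTheta (h0 : q ≠ 0) (h1 : ‖q‖ < 1) :
    HasSum (fun m : ℕ => rankExp q ((m + 1 : ℕ) : ℤ) * rankWeight (q ^ 5) ((m + 1 : ℕ) : ℤ) +
      rankExp q (-((m + 1 : ℕ) : ℤ)) * rankWeight (q ^ 5) (-((m + 1 : ℕ) : ℤ)))
      (rankTheta q) := by
  have hz : rankExp q 0 * rankWeight (q ^ 5) 0 = 0 := by simp [rankExp]
  have h := (summable_rankTheta h0 h1).hasSum.nat_add_neg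
  rw [← hasSum_nat_add_iff' 1] at h
  simpa [hz, rankTheta] using h

/-- The generating function of `NT 3 5 n - NT 2 5 n`. -/
theorem hasSum_NT_sub (h0 : q ≠ 0) (h1 : ‖q‖ < 1) :
    HasSum (fun n => ((NT 3 5 n - NT 2 5 n : ℤ) : ℂ) * q ^ n) (rankTheta q / poch q q) := by
  have hF := (summable_rankCount h1).hasSum
  have hG := (summable_rankCount_terms h1).hasSum
  have a1 := hF.prod_fiberwise (g := fun n => ((NT 3 5 n - NT 2 5 n : ℤ) : ℂ) * q ^ n) fun n => by
    have : HasSum (fun k => (rankSign k : ℂ) * rankCount k n * q ^ n)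
        (∑ k ∈ Finset.range (n + 1), (rankSign k : ℂ) * rankCount k n * q ^ n) :=
      hasSum_sum_of_ne_finset_zero fun k hk => by
        rw [rankCount_eq_zero (by rw [Finset.mem_range] at hk; omega)]
        simp
    rw [← Finset.sum_mul] at this
    rw [NT_sub_eq_sum_count]
    exact_mod_cast this
  have hF' := (Equiv.prodComm ℕ ℕ).hasSum_iff.2 hF
  have a2 := hF'.prod_fiberwise
    (g := fun k => (rankSign k : ℂ) * (rankTailSeries q k - rankTailSeries q (k + 1)))
    fun k => ((hasSum_rankCount h1 k).mul_left _).congr_fun fun n => by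
      simp only [Function.comp, Equiv.prodComm_apply, Prod.swap_prod_mk]
      ring
  have a3 := hG.prod_fiberwise
    (g := fun k => (rankSign k : ℂ) * (rankTailSeries q k - rankTailSeries q (k + 1)))
    fun k => by
      rcases Nat.eq_zero_or_pos k with rfl | hk
      · simp [rankSign]
      · exact (hasSum_rankCount_terms h1 hk).mul_left _
  have hG' := (Equiv.prodComm ℕ ℕ).hasSum_iff.2 hG
  have a4 := hG'.prod_fiberwise fun m => by
    have hx : ‖q ^ (m + 1)‖ < 1 := by
      rw [norm_pow]
      exact pow_lt_one₀ (norm_nonneg _) h1 (by omega)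
    exact ((hasSum_rankSign hx).mul_left ((-1) ^ m * q ^ pent (m + 1) * (1 - q ^ (m + 1)) *
      (poch q q)⁻¹)).congr_fun fun k => by
        simp only [Function.comp, Equiv.prodComm_apply, Prod.swap_prod_mk]
        ring
  have hT : HasSum (fun n => ((NT 3 5 n - NT 2 5 n : ℤ) : ℂ) * q ^ n)
      (rankTheta q * (poch q q)⁻¹) := by
    rw [((hasSum_rankTheta h0 h1).mul_right (poch q q)⁻¹).unique (a4.congr_fun fun m => by
      rw [rankTheta_pair h0 h1]
      ring), a3.unique a2]
    exact a1
  rwa [div_eq_mul_inv]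

end

section

open Filter Topology

/-! ### The generating function of ones by crank -/

variable {q : ℂ}

/-- The weight giving `a c` to `c` ones, and `z` to each part larger than `r`. -/
def crankWeight (z : ℂ) (a : ℕ → ℂ) (r i c : ℕ) : ℂ :=
  if i = 1 then a c else if i ≤ r then 1 else z ^ c

lemma norm_crankWeight_le {z : ℂ} (hz : ‖z‖ = 1) {a : ℕ → ℂ} (ha : ∀ c, ‖a c‖ ≤ 1) (r i c : ℕ) :
    ‖crankWeight z a r i c‖ ≤ 1 := by
  rw [crankWeight]
  split_ifs <;> simp [ha, hz]

lemma prod_map_ite_eq_pow_card (s : Multiset ℕ) (z : ℂ) (r : ℕ) :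
    (s.map fun i => if r < i then z else 1).prod = z ^ Multiset.card (s.filter (r < ·)) := by
  induction s using Multiset.induction with
  | empty => simp
  | cons i s ih =>
    by_cases h : r < i
    · simp [h, ih, pow_succ']
    · simp [h, ih]

lemma prod_crankWeight (z : ℂ) (a : ℕ → ℂ) {r : ℕ} (hr : 1 ≤ r) {n : ℕ} (π : n.Partition) :
    (Multiset.toFinsupp π.parts).prod (crankWeight z a r) =
      (if omegaOnes π = 0 then 1 else a (omegaOnes π)) *
        z ^ Multiset.card (π.parts.filter (r < ·)) := by
  have e : ∀ i c, crankWeight z a r i c =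
      (if i = 1 then a c else 1) * (if r < i then z else 1) ^ c := fun i c => by
    rw [crankWeight]
    by_cases h1 : i = 1
    · simp [h1, show ¬ r < 1 by omega]
    · by_cases h2 : i ≤ r
      · simp [h1, h2, show ¬ r < i by omega]
      · simp [h1, h2, show r < i by omega]
  rw [Finsupp.prod, Multiset.toFinsupp_support]
  simp only [e, Multiset.toFinsupp_apply]
  rw [Finset.prod_mul_distrib, ← Finset.prod_multiset_map_count, prod_map_ite_eq_pow_card,
    Finset.prod_ite_eq']
  congr 1
  simp only [Multiset.mem_toFinset, omegaOnes, Multiset.count_eq_zero, ite_not]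

/-- The sum of `z ^ μ` over the partitions of `n` with `r` ones. -/
noncomputable def crankCoeff (z : ℂ) (r n : ℕ) : ℂ :=
  ∑ π : n.Partition, if omegaOnes π = r then z ^ muParts π else 0

lemma crankCoeff_eq_sub (z : ℂ) {r : ℕ} (hr : 1 ≤ r) (n : ℕ) : crankCoeff z r n =
    PowerSeries.coeff n (Nat.Partition.genFun
      (crankWeight z (fun c => if c = r then 1 else 0) r)) -
    PowerSeries.coeff n (Nat.Partition.genFun (crankWeight z (fun _ => 0) r)) := by
  rw [Nat.Partition.coeff_genFun, Nat.Partition.coeff_genFun, ← Finset.sum_sub_distrib, crankCoeff]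
  refine Finset.sum_congr rfl fun π _ => ?_
  rw [prod_crankWeight z _ hr, prod_crankWeight z _ hr, muParts]
  by_cases h : omegaOnes π = r
  · have h0 : r ≠ 0 := by omega
    simp [h, h0]
  · simp [h]

/-- The product `∏ (1 - z q ^ (i + 1)) / (1 - q ^ (i + 1))` over `i < r`. -/
noncomputable def crankRatio (q z : ℂ) (r : ℕ) : ℂ :=
  ∏ i ∈ Finset.range r, (1 - z * q * q ^ i) * (1 - q ^ (i + 1))⁻¹

lemma norm_mul_mul_pow_lt_one (h1 : ‖q‖ < 1) {z : ℂ} (hz : ‖z‖ = 1) (i : ℕ) :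
    ‖z * q * q ^ i‖ < 1 := by
  rw [mul_assoc, ← pow_succ', norm_mul, hz, one_mul]
  exact norm_pow_lt_one_of_pos h1 (Nat.succ_pos i)

lemma one_sub_ne_zero_of_norm_lt_one {x : ℂ} (hx : ‖x‖ < 1) : 1 - x ≠ 0 := by
  intro h
  rw [← sub_eq_zero.1 h, norm_one] at hx
  exact lt_irrefl _ hx

lemma partSum_crankWeight (h1 : ‖q‖ < 1) {z : ℂ} (hz : ‖z‖ = 1) (a : ℕ → ℂ) (r : ℕ) {i : ℕ}
    (hi : i ≠ 0) : partSum (crankWeight z a r) q i =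
      (if i < r then (1 - z * q * q ^ i) * (1 - q ^ (i + 1))⁻¹ else 1) *
        (1 - z * q * q ^ i)⁻¹ := by
  have hx := norm_pow_lt_one_of_pos h1 (Nat.succ_pos i)
  have hy := norm_mul_mul_pow_lt_one h1 hz i
  have hy0 := one_sub_ne_zero_of_norm_lt_one hy
  rw [partSum]
  by_cases h : i < r
  · rw [if_pos h, mul_comm, ← mul_assoc, inv_mul_cancel₀ hy0, one_mul,
      ← tsum_geometric_of_norm_lt_one hx]
    refine tsum_congr fun c => ?_
    rw [crankWeight, if_neg (show i + 1 ≠ 1 by omega), if_pos (show i + 1 ≤ r by omega),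
      ite_self, one_mul, pow_mul]
  · rw [if_neg h, one_mul, ← tsum_geometric_of_norm_lt_one hy]
    refine tsum_congr fun c => ?_
    rw [crankWeight, if_neg (show i + 1 ≠ 1 by omega), if_neg (show ¬ i + 1 ≤ r by omega),
      mul_assoc, ← pow_succ', mul_pow, ← pow_mul]
    split_ifs with hc
    · simp [hc]
    · rfl

lemma tendsto_prod_partSum_crankWeight (h1 : ‖q‖ < 1) {z : ℂ} (hz : ‖z‖ = 1) (a : ℕ → ℂ) {r : ℕ}
    (hr : 1 ≤ r) : Tendsto (fun N => ∏ i ∈ Finset.range N, partSum (crankWeight z a r) q i) atTop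
      (𝓝 ((∑' c : ℕ, (if c = 0 then 1 else a c) * q ^ c) * (1 - q) * crankRatio q z r *
        (poch (z * q) q)⁻¹)) := by
  have hzq : ‖z * q‖ < 1 := by simpa [hz] using h1
  have hP := ((tendsto_poch h1 (z * q)).inv₀ (poch_ne_zero_of_norm_lt_one h1 hzq)).const_mul
    ((∑' c : ℕ, (if c = 0 then 1 else a c) * q ^ c) * (1 - q) * crankRatio q z r)
  refine hP.congr' ?_
  filter_upwards [eventually_ge_atTop r] with N hN
  have hz1 : 1 - z * q ≠ 0 := one_sub_ne_zero_of_norm_lt_one hzq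
  have hq1 : 1 - q ≠ 0 := one_sub_ne_zero_of_norm_lt_one h1
  have e : ∀ i, partSum (crankWeight z a r) q i =
      (if i = 0 then (∑' c : ℕ, (if c = 0 then 1 else a c) * q ^ c) * (1 - q) else 1) *
      (if i < r then (1 - z * q * q ^ i) * (1 - q ^ (i + 1))⁻¹ else 1) *
        (1 - z * q * q ^ i)⁻¹ := fun i => by
    rcases eq_or_ne i 0 with rfl | hi
    · rw [if_pos rfl, if_pos (by omega), partSum]
      simp only [crankWeight, zero_add, if_true, one_mul, pow_zero, mul_one, pow_one]
      rw [mul_assoc, mul_assoc, ← mul_assoc (1 - q), ← mul_assoc (1 - q), mul_comm (1 - q),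
        mul_assoc (1 - z * q), mul_inv_cancel₀ hq1, mul_one, mul_inv_cancel₀ hz1, mul_one]
    · rw [if_neg hi, one_mul, partSum_crankWeight h1 hz a r hi]
  simp only [e]
  rw [Finset.prod_mul_distrib, Finset.prod_mul_distrib, Finset.prod_inv_distrib,
    Finset.prod_ite_eq' (Finset.range N) 0, if_pos (by simp; omega), ← Finset.prod_filter,
    crankRatio]
  congr 3
  ext i
  simp only [Finset.mem_range, Finset.mem_filter]
  omega

/-- The generating function of `crankCoeff z r`. -/
lemma hasSum_crankCoeff (h1 : ‖q‖ < 1) {z : ℂ} (hz : ‖z‖ = 1) {r : ℕ} (hr : 1 ≤ r) :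
    HasSum (fun n => crankCoeff z r n * q ^ n)
      (q ^ r * (1 - q) * crankRatio q z r * (poch (z * q) q)⁻¹) := by
  have A := hasSum_genFun h1 (norm_crankWeight_le hz (a := fun c => if c = r then 1 else 0)
    (fun c => by split_ifs <;> simp) r) (tendsto_prod_partSum_crankWeight h1 hz _ hr)
  have B := hasSum_genFun h1 (norm_crankWeight_le hz (a := fun _ => 0)
    (fun c => by simp) r) (tendsto_prod_partSum_crankWeight h1 hz _ hr)
  have hs : HasSum (fun c : ℕ => (if c = 0 then 1 else (0 : ℂ)) * q ^ c) 1 := by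
    have := hasSum_single (f := fun c : ℕ => (if c = 0 then 1 else (0 : ℂ)) * q ^ c) 0
      fun c hc => by simp [hc]
    simpa using this
  have hd : HasSum (fun c : ℕ => (if c = r then 1 else (0 : ℂ)) * q ^ c) (q ^ r) := by
    have := hasSum_single (f := fun c : ℕ => (if c = r then 1 else (0 : ℂ)) * q ^ c) r
      fun c hc => by simp [hc]
    simpa using this
  have hsd : HasSum (fun c : ℕ => (if c = 0 then 1 else if c = r then 1 else (0 : ℂ)) * q ^ c)
      (1 + q ^ r) := (hs.add hd).congr_fun fun c => by
    split_ifs <;> first | omega | simp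
  rw [hs.tsum_eq] at B
  rw [hsd.tsum_eq] at A
  have h := (A.sub B).congr_fun fun n =>
    show crankCoeff z r n * q ^ n = _ by rw [crankCoeff_eq_sub z hr, sub_mul]
  rwa [show q ^ r * (1 - q) * crankRatio q z r * (poch (z * q) q)⁻¹ =
    (1 + q ^ r) * (1 - q) * crankRatio q z r * (poch (z * q) q)⁻¹ -
      1 * (1 - q) * crankRatio q z r * (poch (z * q) q)⁻¹ by ring]

lemma norm_crankCoeff_le {z : ℂ} (hz : ‖z‖ = 1) (r n : ℕ) :
    ‖crankCoeff z r n‖ ≤ ∑ π : n.Partition, if omegaOnes π = r then 1 else 0 := by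
  refine (norm_sum_le _ _).trans (Finset.sum_le_sum fun π _ => ?_)
  split_ifs <;> simp [hz]

lemma omegaOnes_le {n : ℕ} (π : n.Partition) : omegaOnes π ≤ n :=
  (Multiset.count_le_card _ _).trans (numParts_le π)

lemma crankCoeff_eq_zero (z : ℂ) {r n : ℕ} (h : n < r) : crankCoeff z r n = 0 :=
  Finset.sum_eq_zero fun π _ => if_neg (by have := omegaOnes_le π; omega)

/-- The sum of `ω z ^ crank` over the partitions of `n`. -/
noncomputable def onesCrankSum (z : ℂ) (n : ℕ) : ℂ :=
  ∑ π : n.Partition, (omegaOnes π : ℂ) * z ^ crank π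

lemma onesCrankSum_eq {z : ℂ} (hz : z ≠ 0) (n : ℕ) : onesCrankSum z n =
    ∑ r ∈ Finset.range (n + 1), (r : ℂ) * z⁻¹ ^ r * crankCoeff z r n := by
  simp only [crankCoeff, Finset.mul_sum]
  rw [Finset.sum_comm, onesCrankSum]
  refine Finset.sum_congr rfl fun π _ => ?_
  simp only [mul_ite, mul_zero]
  rw [Finset.sum_ite_eq, if_pos (by have := omegaOnes_le π; simp; omega), crank]
  split_ifs with h
  · simp [h]
  · rw [zpow_sub₀ hz, zpow_natCast, zpow_natCast, inv_pow]
    ring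

lemma summable_crankCoeff (h1 : ‖q‖ < 1) {z : ℂ} (hz : ‖z‖ = 1) :
    Summable fun p : ℕ × ℕ => (p.2 : ℂ) * z⁻¹ ^ p.2 * crankCoeff z p.2 p.1 * q ^ p.1 := by
  refine Summable.of_norm ?_
  have hfin : ∀ n r, r ∉ Finset.range (n + 1) →
      ‖(r : ℂ) * z⁻¹ ^ r * crankCoeff z r n * q ^ n‖ = 0 := fun n r hr => by
    rw [crankCoeff_eq_zero z (by rw [Finset.mem_range] at hr; omega)]
    simp
  refine (summable_prod_of_nonneg fun _ => norm_nonneg _).2 ⟨fun n => ?_, ?_⟩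
  · exact summable_of_ne_finset_zero (hfin n)
  · refine Summable.of_nonneg_of_le (fun _ => tsum_nonneg fun _ => norm_nonneg _) (fun n => ?_)
      (summable_pow_mul_card_partition 1 (norm_nonneg q) h1)
    rw [tsum_eq_sum (hfin n)]
    refine le_trans (Finset.sum_le_sum (g := fun r => n *
      (∑ π : n.Partition, if omegaOnes π = r then (1 : ℝ) else 0) * ‖q‖ ^ n)
      fun r hr => ?_) ?_
    · rw [norm_mul, norm_mul, norm_mul, norm_pow, norm_pow, norm_inv, hz, inv_one, one_pow,
        mul_one, Complex.norm_natCast]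
      have h3 : (r : ℝ) ≤ n := by
        rw [Finset.mem_range] at hr
        exact_mod_cast Nat.lt_succ_iff.1 hr
      have := norm_crankCoeff_le hz r n
      gcongr
    · rw [← Finset.sum_mul, ← Finset.mul_sum, pow_one, Finset.sum_comm]
      gcongr
      refine (Finset.sum_le_sum (g := fun _ => (1 : ℝ)) fun π _ => ?_).trans (by simp)
      rw [Finset.sum_ite_eq]
      split_ifs <;> simp

/-- The general term `(q / z) ^ r ∏ (1 - z q ^ (i + 1)) / (1 - q ^ (i + 1))`. -/
noncomputable def crankTerm (q z : ℂ) (r : ℕ) : ℂ := (q * z⁻¹) ^ r * crankRatio q z r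

lemma exists_norm_crankRatio_le (h1 : ‖q‖ < 1) (z : ℂ) : ∃ C, ∀ r, ‖crankRatio q z r‖ ≤ C := by
  have h := ((tendsto_poch h1 (z * q)).mul ((tendsto_qfac h1).inv₀
    (poch_ne_zero_of_norm_lt_one h1 h1))).norm.bddAbove_range
  obtain ⟨C, hC⟩ := h
  refine ⟨C, fun r => le_trans (le_of_eq ?_) (hC ⟨r, rfl⟩)⟩
  rw [crankRatio, Finset.prod_mul_distrib, Finset.prod_inv_distrib]
  rfl

lemma summable_norm_crankTerm (h1 : ‖q‖ < 1) {z : ℂ} (hz : ‖z‖ = 1) :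
    Summable fun r => ‖crankTerm q z r‖ := by
  obtain ⟨C, hC⟩ := exists_norm_crankRatio_le h1 z
  exact summable_norm_mul_of_bdd
    (summable_norm_geometric_of_norm_lt_one (by simpa [hz] using h1)) hC

lemma summable_norm_mul_crankTerm (h1 : ‖q‖ < 1) {z : ℂ} (hz : ‖z‖ = 1) :
    Summable fun r : ℕ => ‖(r : ℂ) * crankTerm q z r‖ := by
  obtain ⟨C, hC⟩ := exists_norm_crankRatio_le h1 z
  have h : Summable fun r : ℕ => ‖(r : ℂ) * (q * z⁻¹) ^ r‖ := by
    simpa using summable_norm_pow_mul_geometric_of_norm_lt_one 1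
      (show ‖q * z⁻¹‖ < 1 by simpa [hz] using h1)
  refine (summable_norm_mul_of_bdd h hC).congr fun r => ?_
  rw [crankTerm, mul_assoc]

lemma hasSum_onesCrankSum (h1 : ‖q‖ < 1) {z : ℂ} (hz : ‖z‖ = 1) :
    HasSum (fun n => onesCrankSum z n * q ^ n)
      ((1 - q) * (poch (z * q) q)⁻¹ * ∑' r : ℕ, (r : ℂ) * crankTerm q z r) := by
  have hz0 : z ≠ 0 := fun h => by simp [h] at hz
  have hF := (summable_crankCoeff h1 hz).hasSum
  have a1 := hF.prod_fiberwise (g := fun n => onesCrankSum z n * q ^ n) fun n => by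
    have : HasSum (fun r : ℕ => (r : ℂ) * z⁻¹ ^ r * crankCoeff z r n * q ^ n)
        (∑ r ∈ Finset.range (n + 1), (r : ℂ) * z⁻¹ ^ r * crankCoeff z r n * q ^ n) :=
      hasSum_sum_of_ne_finset_zero fun k hk => by
        rw [crankCoeff_eq_zero z (by rw [Finset.mem_range] at hk; omega)]
        simp
    rwa [← Finset.sum_mul, ← onesCrankSum_eq hz0] at this
  have hF' := (Equiv.prodComm ℕ ℕ).hasSum_iff.2 hF
  have a2 := hF'.prod_fiberwise
    (g := fun r : ℕ => (1 - q) * (poch (z * q) q)⁻¹ * ((r : ℂ) * crankTerm q z r)) fun r => by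
      rcases Nat.eq_zero_or_pos r with rfl | hr
      · simp [hasSum_zero]
      · have := ((hasSum_crankCoeff h1 hz hr).mul_left ((r : ℂ) * z⁻¹ ^ r)).congr_fun fun n =>
          show (r : ℂ) * z⁻¹ ^ r * crankCoeff z r n * q ^ n = _ by ring
        rw [show (1 - q) * (poch (z * q) q)⁻¹ * ((r : ℂ) * crankTerm q z r) =
          (r : ℂ) * z⁻¹ ^ r * (q ^ r * (1 - q) * crankRatio q z r * (poch (z * q) q)⁻¹) by
            rw [crankTerm, mul_pow]; ring]
        exact this
  have a3 := (summable_norm_mul_crankTerm h1 hz).of_norm.hasSum.mul_left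
    ((1 - q) * (poch (z * q) q)⁻¹)
  rw [a3.unique a2]
  exact a1

end

section

open Filter Topology

/-! ### Evaluation of the crank generating function -/

variable {q : ℂ}

lemma crankTerm_succ (h1 : ‖q‖ < 1) {z : ℂ} (hz : z ≠ 0) (r : ℕ) :
    crankTerm q z (r + 1) * (1 - q ^ (r + 1)) =
      (q * z⁻¹ - q * q * q ^ r) * crankTerm q z r := by
  have h := one_sub_pow_ne_zero h1 r
  rw [crankTerm, crankTerm, crankRatio, crankRatio, Finset.prod_range_succ]
  generalize ∏ i ∈ Finset.range r, (1 - z * q * q ^ i) * (1 - q ^ (i + 1))⁻¹ = R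
  rw [pow_succ (q * z⁻¹)]
  generalize (q * z⁻¹) ^ r = W
  linear_combination W * q * z⁻¹ * R * (1 - z * q * q ^ r) * inv_mul_cancel₀ h -
    W * R * q * q * q ^ r * inv_mul_cancel₀ hz

/-- The values at the powers of `q` of the power series with coefficients `crankTerm q z`. -/
noncomputable def crankEval (q z : ℂ) (N : ℕ) : ℂ := ∑' r, crankTerm q z r * (q ^ N) ^ r

/-- The values at the powers of `q` of the Euler derivative of the power series with
coefficients `crankTerm q z`. -/
noncomputable def crankDeriv (q z : ℂ) (N : ℕ) : ℂ :=
  ∑' r : ℕ, ((r : ℂ) * crankTerm q z r) * (q ^ N) ^ r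

lemma summable_mul_pow_pow (h1 : ‖q‖ < 1) {c : ℕ → ℂ} (hc : Summable fun r => ‖c r‖) (N : ℕ) :
    Summable fun r => c r * (q ^ N) ^ r := by
  refine (summable_norm_mul_of_bdd hc (C := 1) fun r => ?_).of_norm
  rw [norm_pow, norm_pow]
  exact pow_le_one₀ (by positivity) (pow_le_one₀ (norm_nonneg _) h1.le)

lemma crankEval_succ (h1 : ‖q‖ < 1) {z : ℂ} (hz : ‖z‖ = 1) (N : ℕ) :
    (1 - z⁻¹ * q * q ^ N) * crankEval q z N = (1 - q * q * q ^ N) * crankEval q z (N + 1) := by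
  have hz0 : z ≠ 0 := fun h => by simp [h] at hz
  have A := (summable_mul_pow_pow h1 (summable_norm_crankTerm h1 hz) N).hasSum
  have B := (summable_mul_pow_pow h1 (summable_norm_crankTerm h1 hz) (N + 1)).hasSum
  have L := (hasSum_nat_add_iff' 1).2 (A.sub B)
  have R := (A.mul_left (z⁻¹ * q * q ^ N)).sub (B.mul_left (q * q * q ^ N))
  have h := L.unique (R.congr_fun fun r => by
    linear_combination (q ^ N) ^ (r + 1) * crankTerm_succ h1 hz0 r)
  rw [crankEval, crankEval]
  simp only [Finset.range_one, Finset.sum_singleton, pow_zero, sub_self, sub_zero] at h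
  linear_combination h

lemma crankDeriv_succ (h1 : ‖q‖ < 1) {z : ℂ} (hz : ‖z‖ = 1) (N : ℕ) :
    (1 - z⁻¹ * q * q ^ N) * crankDeriv q z N - z⁻¹ * q * q ^ N * crankEval q z N =
      (1 - q * q * q ^ N) * crankDeriv q z (N + 1) - q * q * q ^ N * crankEval q z (N + 1) := by
  have hz0 : z ≠ 0 := fun h => by simp [h] at hz
  have A := (summable_mul_pow_pow h1 (summable_norm_crankTerm h1 hz) N).hasSum
  have B := (summable_mul_pow_pow h1 (summable_norm_crankTerm h1 hz) (N + 1)).hasSum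
  have A' := (summable_mul_pow_pow h1 (summable_norm_mul_crankTerm h1 hz) N).hasSum
  have B' := (summable_mul_pow_pow h1 (summable_norm_mul_crankTerm h1 hz) (N + 1)).hasSum
  have L := (hasSum_nat_add_iff' 1).2 (A'.sub B')
  have R := ((A'.add A).mul_left (z⁻¹ * q * q ^ N)).sub ((B'.add B).mul_left (q * q * q ^ N))
  have h := L.unique (R.congr_fun fun r => by
    push_cast
    linear_combination (r + 1 : ℂ) * (q ^ N) ^ (r + 1) * crankTerm_succ h1 hz0 r)
  rw [crankEval, crankEval, crankDeriv, crankDeriv]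
  simp only [Finset.range_one, Finset.sum_singleton, pow_zero, sub_self, sub_zero] at h
  linear_combination h

/-- The Lambert series `∑ w q ^ k / (1 - w q ^ k)` over `k ≥ 1`. -/
noncomputable def lambert (q w : ℂ) : ℂ := ∑' i : ℕ, w * q * q ^ i * (1 - w * q * q ^ i)⁻¹

lemma summable_lambert (h1 : ‖q‖ < 1) (w : ℂ) :
    Summable fun i : ℕ => w * q * q ^ i * (1 - w * q * q ^ i)⁻¹ := by
  have h : Tendsto (fun i : ℕ => (1 - w * q * q ^ i)⁻¹) atTop (𝓝 (1 - 0)⁻¹) :=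
    (tendsto_mul_pow_zero h1 (w * q)).const_sub 1 |>.inv₀ (by simp)
  obtain ⟨C, hC⟩ := h.norm.bddAbove_range
  have hs : Summable fun i : ℕ => ‖w * q * q ^ i‖ := by
    simpa using summable_norm_mul_pow h1 (w * q)
  exact (summable_norm_mul_of_bdd hs fun i => hC ⟨i, rfl⟩).of_norm

lemma crankEval_zero (h1 : ‖q‖ < 1) {z : ℂ} (hz : ‖z‖ = 1) (N : ℕ) :
    crankEval q z 0 = (∏ i ∈ Finset.range N, (1 - q * q * q ^ i)) *
      (∏ i ∈ Finset.range N, (1 - z⁻¹ * q * q ^ i))⁻¹ * crankEval q z N := by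
  induction N with
  | zero => simp
  | succ N ih =>
    have ha : 1 - z⁻¹ * q * q ^ N ≠ 0 := one_sub_ne_zero_of_norm_lt_one
      (norm_mul_mul_pow_lt_one h1 (by rw [norm_inv, hz, inv_one]) N)
    have h := crankEval_succ h1 hz N
    rw [ih, Finset.prod_range_succ, Finset.prod_range_succ, mul_inv]
    linear_combination ((∏ i ∈ Finset.range N, (1 - q * q * q ^ i)) *
      (∏ i ∈ Finset.range N, (1 - z⁻¹ * q * q ^ i))⁻¹) * (1 - z⁻¹ * q * q ^ N)⁻¹ * h -
      ((∏ i ∈ Finset.range N, (1 - q * q * q ^ i)) *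
      (∏ i ∈ Finset.range N, (1 - z⁻¹ * q * q ^ i))⁻¹) * crankEval q z N * inv_mul_cancel₀ ha

lemma crankDeriv_zero (h1 : ‖q‖ < 1) {z : ℂ} (hz : ‖z‖ = 1) (N : ℕ) :
    crankDeriv q z 0 = (∏ i ∈ Finset.range N, (1 - q * q * q ^ i)) *
      (∏ i ∈ Finset.range N, (1 - z⁻¹ * q * q ^ i))⁻¹ * crankDeriv q z N +
      crankEval q z 0 * ∑ i ∈ Finset.range N, (z⁻¹ * q * q ^ i * (1 - z⁻¹ * q * q ^ i)⁻¹ -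
        q * q * q ^ i * (1 - q * q * q ^ i)⁻¹) := by
  induction N with
  | zero => simp
  | succ N ih =>
    have ha : 1 - z⁻¹ * q * q ^ N ≠ 0 := one_sub_ne_zero_of_norm_lt_one
      (norm_mul_mul_pow_lt_one h1 (by rw [norm_inv, hz, inv_one]) N)
    have hb : 1 - q * q * q ^ N ≠ 0 := by
      rw [mul_assoc, ← pow_succ', ← pow_succ']
      exact one_sub_pow_ne_zero h1 (N + 1)
    have h := crankDeriv_succ h1 hz N
    have e1 := crankEval_zero h1 hz N
    have e2 := crankEval_zero h1 hz (N + 1)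
    rw [ih, Finset.sum_range_succ]
    rw [Finset.prod_range_succ, Finset.prod_range_succ, mul_inv] at e2 ⊢
    generalize ∏ i ∈ Finset.range N, (1 - q * q * q ^ i) = P at *
    generalize (∏ i ∈ Finset.range N, (1 - z⁻¹ * q * q ^ i))⁻¹ = R at *
    generalize z⁻¹ * q * q ^ N = A at *
    generalize q * q * q ^ N = B at *
    linear_combination P * R * (1 - A)⁻¹ * h - A * (1 - A)⁻¹ * e1 + B * (1 - B)⁻¹ * e2 +
      P * R * (1 - A)⁻¹ * B * crankEval q z (N + 1) * inv_mul_cancel₀ hb -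
      P * R * crankDeriv q z N * inv_mul_cancel₀ ha

lemma tsum_mul_crankTerm (h1 : ‖q‖ < 1) {z : ℂ} (hz : ‖z‖ = 1) :
    ∑' r : ℕ, (r : ℂ) * crankTerm q z r =
      poch (q * q) q * (poch (z⁻¹ * q) q)⁻¹ * (lambert q z⁻¹ - lambert q q) := by
  have hw : ‖z⁻¹ * q‖ < 1 := by simpa [hz] using h1
  have hu : Tendsto (fun N => q ^ N) atTop (𝓝 0) := tendsto_pow_atTop_nhds_zero_of_norm_lt_one h1
  have hux : ∀ N : ℕ, ‖q ^ N‖ ≤ ‖(1 : ℂ)‖ := fun N => by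
    rw [norm_pow, norm_one]
    exact pow_le_one₀ (norm_nonneg _) h1.le
  have hD := (tendsto_poch h1 (q * q)).mul
    ((tendsto_poch h1 (z⁻¹ * q)).inv₀ (poch_ne_zero_of_norm_lt_one h1 hw))
  have hf : Tendsto (crankEval q z) atTop (𝓝 (crankTerm q z 0)) :=
    tendsto_tsum_mul_pow_zero (by simpa using summable_norm_crankTerm h1 hz) hu hux
  have hg : Tendsto (crankDeriv q z) atTop (𝓝 (((0 : ℕ) : ℂ) * crankTerm q z 0)) :=
    tendsto_tsum_mul_pow_zero (c := fun r : ℕ => (r : ℂ) * crankTerm q z r)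
      (by simpa using summable_norm_mul_crankTerm h1 hz) hu hux
  have hS := ((summable_lambert h1 z⁻¹).hasSum.sub (summable_lambert h1 q).hasSum).tendsto_sum_nat
  have e0 : crankTerm q z 0 = 1 := by simp [crankTerm, crankRatio]
  rw [e0] at hf hg
  have ef : crankEval q z 0 = poch (q * q) q * (poch (z⁻¹ * q) q)⁻¹ * 1 :=
    tendsto_nhds_unique (tendsto_const_nhds.congr fun N => crankEval_zero h1 hz N) (hD.mul hf)
  have eg := tendsto_nhds_unique (tendsto_const_nhds.congr fun N => crankDeriv_zero h1 hz N)
    ((hD.mul hg).add (hS.const_mul (crankEval q z 0)))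
  have : ∑' r : ℕ, (r : ℂ) * crankTerm q z r = crankDeriv q z 0 := by simp [crankDeriv]
  rw [this, eg, ef, lambert, lambert]
  simp

/-- The difference of the generating functions of `onesCrankSum z` and `onesCrankSum z⁻¹`. -/
lemma hasSum_onesCrankSum_sub (h1 : ‖q‖ < 1) {z : ℂ} (hz : ‖z‖ = 1) :
    HasSum (fun n => (onesCrankSum z n - onesCrankSum z⁻¹ n) * q ^ n)
      (poch q q * (poch (z * q) q * poch (z⁻¹ * q) q)⁻¹ * (lambert q z⁻¹ - lambert q z)) := by
  have hw : ‖z⁻¹‖ = 1 := by rw [norm_inv, hz, inv_one]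
  have A := hasSum_onesCrankSum h1 hz
  have B := hasSum_onesCrankSum h1 hw
  rw [tsum_mul_crankTerm h1 hz] at A
  rw [tsum_mul_crankTerm h1 hw, inv_inv] at B
  rw [poch_succ h1 q, mul_inv]
  have h := (A.sub B).congr_fun fun n =>
    show (onesCrankSum z n - onesCrankSum z⁻¹ n) * q ^ n = _ by ring
  refine Eq.subst (motive := fun v => HasSum _ v) ?_ h
  ring

lemma summable_geom_div (h1 : ‖q‖ < 1) {a : ℕ} (ha : 0 < a) :
    Summable fun i : ℕ => q ^ (a * (i + 1)) * (1 - (q ^ 5) ^ (i + 1))⁻¹ := by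
  obtain ⟨C, hC⟩ := exists_norm_frac_le_of_nonneg (norm_pow_five_lt_one h1) 1
  have hs : Summable fun i : ℕ => ‖q ^ (a * (i + 1))‖ := by
    have := (summable_geometric_of_lt_one (norm_nonneg (q ^ a))
      (norm_pow_lt_one_of_pos h1 ha)).mul_right ‖q ^ a‖
    refine this.congr fun i => ?_
    rw [pow_mul, pow_succ, norm_mul, norm_pow (q ^ a) i]
  refine (summable_norm_mul_of_bdd hs (C := C) fun i => ?_).of_norm
  have := hC (i + 1)
  rw [frac, one_mul, zpow_natCast] at this
  exact this

/-- The Lambert series `∑ q ^ (a k) / (1 - q ^ (5 k))` over `k ≥ 1`. -/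
noncomputable def lambertFive (q : ℂ) (a : ℕ) : ℂ :=
  ∑' i : ℕ, q ^ (a * (i + 1)) * (1 - (q ^ 5) ^ (i + 1))⁻¹

lemma lam_eq_lambertFive (h0 : q ≠ 0) (h1 : ‖q‖ < 1) {b : ℕ} (hb : 0 < b) (hb5 : b < 5) :
    lam q b = lambertFive q b - lambertFive q (5 - b) := by
  have e : q ^ 5 / q ^ b = q ^ (5 - b) := by
    rw [div_eq_iff (pow_ne_zero b h0), ← pow_add, Nat.sub_add_cancel hb5.le]
  rw [lam, kron_eq_nat (pow_ne_zero 5 h0) (norm_pow_five_lt_one h1) one_ne_zero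
    (norm_pow_five_lt_norm_pow h0 h1 hb5) (norm_pow_lt_one_of_pos h1 hb), mul_one, div_one, e,
    ← tsum_mul_left]
  congr 1
  · have hA : HasSum (fun m : ℕ => (q ^ b) ^ (m + 1) * frac (q ^ 5) 1 ((m + 1 : ℕ) : ℤ))
        (lambertFive q b) :=
      (summable_geom_div h1 hb).hasSum.congr_fun fun m => by
        rw [frac, zpow_natCast, one_mul, pow_mul]
    rw [hasSum_nat_add_iff (f := fun m : ℕ => (q ^ b) ^ m * frac (q ^ 5) 1 (m : ℤ)) 1] at hA
    rw [hA.tsum_eq]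
    simp [frac_one_zero]
  · refine tsum_congr fun m => ?_
    rw [frac, zpow_natCast, pow_mul, pow_succ' (q ^ 5), pow_succ']
    ring

lemma lambert_sub (h0 : q ≠ 0) (h1 : ‖q‖ < 1) {z : ℂ} (hz : z ^ 5 = 1) :
    lambert q z - lambert q z⁻¹ = (z - z ^ 4) * lam q 1 + (z ^ 2 - z ^ 3) * lam q 2 := by
  have key : ∀ w : ℂ, w ^ 5 = 1 → lambert q w = w * lambertFive q 1 + w ^ 2 * lambertFive q 2 +
      w ^ 3 * lambertFive q 3 + w ^ 4 * lambertFive q 4 + lambertFive q 5 := fun w hw => by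
    have hL := fun a ha => (summable_geom_div h1 (a := a) ha).hasSum
    have h := ((((hL 1 (by norm_num)).mul_left w).add ((hL 2 (by norm_num)).mul_left (w ^ 2))).add
      ((hL 3 (by norm_num)).mul_left (w ^ 3))).add ((hL 4 (by norm_num)).mul_left (w ^ 4)) |>.add
      (hL 5 (by norm_num))
    have hw1 : ‖w‖ = 1 := Complex.norm_eq_one_of_pow_eq_one hw (by norm_num)
    refine (summable_lambert h1 w).hasSum.unique (h.congr_fun fun i => ?_)
    have n1 := one_sub_ne_zero_of_norm_lt_one (norm_mul_mul_pow_lt_one h1 hw1 i)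
    have n2 : 1 - (q ^ 5) ^ (i + 1) ≠ 0 := one_sub_pow_ne_zero (norm_pow_five_lt_one h1) i
    have ex : ∀ a, q ^ (a * (i + 1)) = (q ^ (i + 1)) ^ a := fun a => by rw [mul_comm, pow_mul]
    have e5 : (q ^ 5) ^ (i + 1) = (q ^ (i + 1)) ^ 5 := by rw [← pow_mul, ex]
    rw [e5] at n2 ⊢
    rw [ex, ex, ex, ex, ex]
    rw [show w * q * q ^ i = w * q ^ (i + 1) by ring] at n1 ⊢
    generalize q ^ (i + 1) = x at *
    field_simp
    linear_combination x ^ 5 * hw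
  have hz0 : z ≠ 0 := by rintro rfl; norm_num at hz
  have hzi : z⁻¹ = z ^ 4 := by
    field_simp; exact hz.symm
  rw [key z hz, key z⁻¹ (by rw [inv_pow, hz, inv_one]), hzi,
    lam_eq_lambertFive h0 h1 (by norm_num) (by norm_num),
    lam_eq_lambertFive h0 h1 (by norm_num) (by norm_num)]
  norm_num
  linear_combination (-lambertFive q 2 * z ^ 3 - lambertFive q 3 * (z ^ 7 + z ^ 2) -
    lambertFive q 4 * (z ^ 11 + z ^ 6 + z)) * hz

end

section

open Filter Topology

/-! ### The crank side at fifth roots of unity -/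

variable {q : ℂ}

lemma sum_roots_zpow {ζ : ℂ} (hζ : IsPrimitiveRoot ζ 5) (j : ℤ) :
    ∑ k ∈ Finset.range 5, ((ζ ^ k) ^ 2 - (ζ ^ k) ^ 3) * (ζ ^ k) ^ j =
      5 * ((if j % 5 = 3 then 1 else 0) - if j % 5 = 2 then 1 else 0) := by
  obtain ⟨e, he⟩ : ∃ e : ℕ, j % 5 = e := ⟨(j % 5).toNat, by omega⟩
  have h : ∀ k : ℕ, ((ζ ^ k) ^ 2 - (ζ ^ k) ^ 3) * (ζ ^ k) ^ j =
      (ζ ^ k) ^ (e + 2) - (ζ ^ k) ^ (e + 3) := fun k => by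
    have h5 : (ζ ^ k) ^ 5 = 1 := by rw [← pow_mul, mul_comm, pow_mul, hζ.pow_eq_one, one_pow]
    have h0 : ζ ^ k ≠ 0 := pow_ne_zero _ (hζ.ne_zero (by norm_num))
    rw [show j = 5 * (j / 5) + e by omega, zpow_add₀ h0, zpow_mul, zpow_ofNat, h5, one_zpow,
      zpow_natCast]
    ring
  rw [Finset.sum_congr rfl fun k _ => h k, Finset.sum_sub_distrib, sum_roots_pow hζ,
    sum_roots_pow hζ]
  have e1 : 5 ∣ e + 2 ↔ j % 5 = 3 := by omega
  have e2 : 5 ∣ e + 3 ↔ j % 5 = 2 := by omega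
  simp only [e1, e2]
  split_ifs <;> simp

lemma Mw_sub_eq {ζ : ℂ} (hζ : IsPrimitiveRoot ζ 5) (n : ℕ) :
    5 * ((Mw 3 5 n - Mw 2 5 n : ℤ) : ℂ) =
      ∑ k ∈ Finset.range 5, ((ζ ^ k) ^ 2 - (ζ ^ k) ^ 3) * onesCrankSum (ζ ^ k) n := by
  simp only [onesCrankSum, Finset.mul_sum]
  rw [Finset.sum_comm, Mw, Mw, ← Finset.sum_sub_distrib, Int.cast_sum, Finset.mul_sum]
  refine Finset.sum_congr rfl fun π _ => ?_
  have h := sum_roots_zpow hζ (crank π)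
  rw [Finset.sum_congr rfl fun k _ => mul_left_comm _ _ _, ← Finset.mul_sum, h]
  push_cast
  split_ifs <;> ring

lemma Mw_sub_eq_sub {ζ : ℂ} (hζ : IsPrimitiveRoot ζ 5) (n : ℕ) :
    5 * ((Mw 3 5 n - Mw 2 5 n : ℤ) : ℂ) =
      (ζ ^ 2 - ζ ^ 3) * (onesCrankSum ζ n - onesCrankSum ζ⁻¹ n) +
      (ζ ^ 4 - ζ) * (onesCrankSum (ζ ^ 2) n - onesCrankSum (ζ ^ 2)⁻¹ n) := by
  have h5 := hζ.pow_eq_one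
  have h0 : ζ ≠ 0 := hζ.ne_zero (by norm_num)
  have e1 : ζ⁻¹ = ζ ^ 4 := by field_simp; exact h5.symm
  have e2 : (ζ ^ 2)⁻¹ = ζ ^ 3 := by field_simp; rw [← h5]
  rw [Mw_sub_eq hζ, e1, e2]
  simp only [Finset.sum_range_succ, Finset.range_zero, Finset.sum_empty, pow_zero, pow_one]
  linear_combination (-onesCrankSum (ζ ^ 2) n * ζ + onesCrankSum (ζ ^ 3) n * (ζ - ζ ^ 4) +
    onesCrankSum (ζ ^ 4) n * (ζ ^ 3 - ζ ^ 7 - ζ ^ 2)) * h5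

lemma hasSum_onesCrankSum_root (h0 : q ≠ 0) (h1 : ‖q‖ < 1) {z : ℂ} (hz : IsPrimitiveRoot z 5) :
    HasSum (fun n => (onesCrankSum z n - onesCrankSum z⁻¹ n) * q ^ n)
      (-(poch q q / poch (q ^ 5) (q ^ 5)) * (thB (q ^ 5) 2 + q * (z + z ^ 4) * thB (q ^ 5) 1) *
        ((z - z ^ 4) * lam q 1 + (z ^ 2 - z ^ 3) * lam q 2)) := by
  have h5 := hz.pow_eq_one
  have hz0 : z ≠ 0 := hz.ne_zero (by norm_num)
  have hn : ‖z‖ = 1 := Complex.norm_eq_one_of_pow_eq_one h5 (by norm_num)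
  have hzi : z⁻¹ = z ^ 4 := by field_simp; exact h5.symm
  have hJ := poch_ne_zero_of_norm_lt_one h1 h1
  have hJ5 := poch_five_ne_zero h1
  have hP := poch_ne_zero_of_norm_lt_one h1 (show ‖z * q‖ < 1 by simpa [hn] using h1)
  have hP' := poch_ne_zero_of_norm_lt_one h1 (show ‖z ^ 4 * q‖ < 1 by simpa [hn] using h1)
  have hT := tripleProd_mul_tripleProd hz h1
  rw [tripleProd_eq (z := z ^ 2) h0 h1 (by rw [← pow_mul, mul_comm, pow_mul, h5, one_pow])
    (hz.pow_ne_one_of_pos_of_lt (by norm_num) (by norm_num)), tripleProd] at hT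
  have hsum : 1 + z + z ^ 2 + z ^ 3 + z ^ 4 = 0 := by
    have := hz.geom_sum_eq_zero (by norm_num)
    simpa [Finset.sum_range_succ] using this
  have hC : poch q q * (poch (z * q) q * poch (z⁻¹ * q) q)⁻¹ =
      poch q q / poch (q ^ 5) (q ^ 5) * (thB (q ^ 5) 2 + q * (z + z ^ 4) * thB (q ^ 5) 1) := by
    have hT2 : poch (z * q) q * poch (z ^ 4 * q) q *
        (thB (q ^ 5) 2 + q * (z + z ^ 4) * thB (q ^ 5) 1) = poch (q ^ 5) (q ^ 5) := by
      refine mul_left_cancel₀ hJ (Eq.trans ?_ hT)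
      linear_combination (poch q q * poch (z * q) q * poch (z ^ 4 * q) q * q * thB (q ^ 5) 1) *
        (hsum + z ^ 3 * h5)
    rw [hzi, ← hT2]
    have hX : thB (q ^ 5) 2 + q * (z + z ^ 4) * thB (q ^ 5) 1 ≠ 0 := fun h => by
      rw [h, mul_zero] at hT2
      exact hJ5 hT2.symm
    generalize thB (q ^ 5) 2 + q * (z + z ^ 4) * thB (q ^ 5) 1 = X at *
    field_simp
  have hL := lambert_sub h0 h1 h5
  have h := hasSum_onesCrankSum_sub h1 hn
  rw [hC, show lambert q z⁻¹ - lambert q z =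
    -((z - z ^ 4) * lam q 1 + (z ^ 2 - z ^ 3) * lam q 2) by rw [← hL]; ring] at h
  refine Eq.subst (motive := fun v => HasSum _ v) ?_ h
  ring

/-- The generating function of `Mw 3 5 n - Mw 2 5 n`. -/
theorem hasSum_Mw_sub (h0 : q ≠ 0) (h1 : ‖q‖ < 1) :
    HasSum (fun n => ((Mw 3 5 n - Mw 2 5 n : ℤ) : ℂ) * q ^ n) (crankSeries q) := by
  have hζ := Complex.isPrimitiveRoot_exp 5 (by norm_num)
  set ζ := Complex.exp (2 * Real.pi * Complex.I / (5 : ℕ)) with hζd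
  clear_value ζ
  have hsum : 1 + ζ + ζ ^ 2 + ζ ^ 3 + ζ ^ 4 = 0 := by
    have := hζ.geom_sum_eq_zero (by norm_num)
    simpa [Finset.sum_range_succ] using this
  have A := hasSum_onesCrankSum_root h0 h1 hζ
  have B := hasSum_onesCrankSum_root h0 h1 (hζ.pow_of_coprime 2 (by norm_num))
  have h := (((A.mul_left (ζ ^ 2 - ζ ^ 3)).add (B.mul_left (ζ ^ 4 - ζ))).mul_left 5⁻¹).congr_fun
    fun n => show ((Mw 3 5 n - Mw 2 5 n : ℤ) : ℂ) * q ^ n = _ by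
      linear_combination 5⁻¹ * q ^ n * Mw_sub_eq_sub hζ n
  refine Eq.subst (motive := fun v => HasSum _ v) ?_ h
  have h5 := hζ.pow_eq_one
  rw [crankSeries]
  generalize poch q q / poch (q ^ 5) (q ^ 5) = C
  generalize thB (q ^ 5) 2 = t2
  generalize thB (q ^ 5) 1 = t1
  generalize lam q 1 = l1
  generalize lam q 2 = l2
  linear_combination (C * t2 * l1 * (ζ ^ 4 - ζ ^ 5 - ζ ^ 7 + ζ ^ 8) / 5 +
    C * t2 * l2 * (-5 + 5 * ζ ^ 1 - ζ ^ 4 - ζ ^ 5 + ζ ^ 6) / 5 +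
    C * q * t1 * l1 * (-5 + 5 * ζ ^ 1 - ζ ^ 4 - 2 * ζ ^ 5 + 3 * ζ ^ 6 - ζ ^ 8 - ζ ^ 10 + ζ ^ 11 +
      ζ ^ 12 - ζ ^ 13 - ζ ^ 15 + ζ ^ 16) / 5 +
    C * q * t1 * l2 * (5 - 5 * ζ ^ 1 + 4 * ζ ^ 5 - 2 * ζ ^ 6 - 2 * ζ ^ 7 - ζ ^ 8 + 2 * ζ ^ 9 +
      ζ ^ 10 - ζ ^ 12 - ζ ^ 13 + ζ ^ 14) / 5) * hsum

end

section

open Filter Topology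

/-! ### The residue class one modulo five -/

variable {q : ℂ}

lemma coeff_eq_zero_of_hasSum_zero {c : ℕ → ℂ}
    (h : ∀ q : ℂ, ‖q‖ < 1 → HasSum (fun n => c n * q ^ n) 0)
    (n : ℕ) : c n = 0 := by
  have hp : HasFPowerSeriesAt (0 : ℂ → ℂ) (FormalMultilinearSeries.ofScalars ℂ c) 0 := by
    rw [hasFPowerSeriesAt_iff]
    filter_upwards [Metric.ball_mem_nhds (0 : ℂ) one_pos] with z hz
    refine (h z (by simpa using hz)).congr_fun fun n => ?_
    rw [FormalMultilinearSeries.coeff_ofScalars, smul_eq_mul, mul_comm]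
  rw [← FormalMultilinearSeries.coeff_ofScalars (𝕜 := ℂ) (p := c), hp.eq_zero]
  simp [FormalMultilinearSeries.coeff]

/-- The difference of the two sides of the identity between `NT` and `Mw`. -/
def beckDefect (n : ℕ) : ℤ := (NT 3 5 n - NT 2 5 n) - (Mw 3 5 n - Mw 2 5 n)

lemma hasSum_beckDefect (h0 : q ≠ 0) (h1 : ‖q‖ < 1) : HasSum (fun n => (beckDefect n : ℂ) * q ^ n)
    (rankTheta q / poch q q - crankSeries q) :=
  ((hasSum_NT_sub h0 h1).sub (hasSum_Mw_sub h0 h1)).congr_fun fun n => by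
    rw [beckDefect]
    push_cast
    ring

lemma hasSum_beckDefect_classOne (h0 : q ≠ 0) (h1 : ‖q‖ < 1) :
    HasSum (fun n => (if n % 5 = 1 then (beckDefect n : ℂ) else 0) * q ^ n) 0 := by
  have hζ := Complex.isPrimitiveRoot_exp 5 (by norm_num)
  set ζ := Complex.exp (2 * Real.pi * Complex.I / (5 : ℕ)) with hζd
  clear_value ζ
  have hz : ∀ k : ℕ, ‖ζ ^ k‖ = 1 := fun k => by
    rw [norm_pow, Complex.norm_eq_one_of_pow_eq_one hζ.pow_eq_one (by norm_num), one_pow]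
  have hk := hasSum_sum (s := Finset.range 5) fun k _ => ((hasSum_beckDefect (q := ζ ^ k * q)
    (mul_ne_zero (pow_ne_zero k (hζ.ne_zero (by norm_num))) h0)
    (by rw [norm_mul, hz, one_mul]; exact h1)).mul_left ((ζ ^ k) ^ 4))
  have hv : ∑ k ∈ Finset.range 5, (ζ ^ k) ^ 4 * (rankTheta (ζ ^ k * q) /
      poch (ζ ^ k * q) (ζ ^ k * q) - crankSeries (ζ ^ k * q)) = 0 := by
    have hJ := poch_five_ne_zero (norm_pow_five_lt_one h1)
    have h := mul_right_cancel₀ hJ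
      ((classOne_rankTheta h0 h1 hζ).trans (classOne_crankSeries h0 h1 hζ).symm)
    simp only [mul_sub, Finset.sum_sub_distrib]
    exact sub_eq_zero.2 h
  rw [hv] at hk
  have h5 := (hk.mul_left 5⁻¹).congr_fun fun n =>
    show (if n % 5 = 1 then (beckDefect n : ℂ) else 0) * q ^ n = _ by
      have e : ∀ k : ℕ, (ζ ^ k) ^ 4 * ((beckDefect n : ℂ) * (ζ ^ k * q) ^ n) =
          (ζ ^ k) ^ (n + 4) * ((beckDefect n : ℂ) * q ^ n) := fun k => by
        rw [mul_pow]
        ring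
      have hd : 5 ∣ n + 4 ↔ n % 5 = 1 := by omega
      simp only [e]
      rw [← Finset.sum_mul, sum_roots_pow hζ]
      simp only [hd]
      split_ifs <;> ring
  rwa [mul_zero] at h5

lemma beckDefect_five_mul_add_one (n : ℕ) : beckDefect (5 * n + 1) = 0 := by
  have h := coeff_eq_zero_of_hasSum_zero
    (c := fun n => if n % 5 = 1 then (beckDefect n : ℂ) else 0) (fun q h1 => ?_) (5 * n + 1)
  · rw [if_pos (by omega)] at h
    exact_mod_cast h
  · rcases eq_or_ne q 0 with rfl | h0
    · refine hasSum_zero.congr_fun fun n => ?_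
      rcases eq_or_ne n 0 with rfl | hn <;> simp [*]
    · exact hasSum_beckDefect_classOne h0 h1

end

/-- For every `n ≥ 0`,
`Mω(2,5,5n+1) − Mω(3,5,5n+1) = NT(2,5,5n+1) − NT(3,5,5n+1)`. -/
theorem statement_4 (n : ℕ) :
    Mw 2 5 (5 * n + 1) - Mw 3 5 (5 * n + 1)
      = NT 2 5 (5 * n + 1) - NT 3 5 (5 * n + 1) := by
  have h := beckDefect_five_mul_add_one n
  rw [beckDefect] at h
  omega

end Beck
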